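/- Let F_q be a finite field and let f_t(z) = a(z)/b(z), where a, b ∈ F_q[t][z] are monic in z, coprime as polynomials in z over F_q(t), deg_z(a) > deg_z(b) + 1, and a is separable in z. Let Ω be an algebraic closure of the completion F_q((1/t)) of F_q(t) at the place ord_∞, equipped with the unique extension ‖·‖ of the ∞-adic absolute value, and let R be the maximum of ‖α‖ over the roots α of a in Ω. Assume: (i) R > 1; (ii) every root of b in Ω lies in the closed disk D(0,R) = {x : ‖x‖ ≤ R}; (iii) a(z) − z·b(z) has a root in Ω of absolute value exactly R; (iv) for each root α of a there is a radius r_α > 0 such that the closed disk D(α, r_α) contains no pole of f = a/b and f maps D(α, r_α) onto D(0,R); and (v) the disks D(α, r_α) and D(β, r_β) are disjoint for distinct roots α, β of a. Then for every field k containing F_q, every function field K over k, and every integer D ≥ 1, there exists a bound B such that: for every field extension L/K with [L : K] ≤ D and every σ ∈ L for which the specialized rational function f_σ(z) = a(σ,z)/b(σ,z) ∈ L(z) is not isotrivial over k, the number of preperiodic points of f_σ in P¹(L) is at most B. -/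

import Mathlib

open Polynomial

/-- A point is preperiodic for a self-map if its forward orbit is finite. -/
def IsPreperiodic {S : Type*} (f : S → S) (x : S) : Prop :=
  (Set.range fun n : ℕ => f^[n] x).Finite

/-- The action of a polynomial on `P¹(L) = L ∪ {∞}`, with `none` playing the role of `∞`. -/
def polyP1Map {L : Type*} [Field L] (f : Polynomial L) : Option L → Option L
  | none => none
  | some x => some (f.eval x)

open scoped Classical in
/-- The self-map of `P¹(F) = F ∪ {∞}` induced by the rational function `p/q`. -/
noncomputable def ratP1Map {F : Type*} [Field F] (p q : Polynomial F) :
    Option F → Option F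
  | none =>
      if q.degree < p.degree then none
      else if p.degree < q.degree then some 0
      else some (p.leadingCoeff / q.leadingCoeff)
  | some x => if q.eval x = 0 then none else some (p.eval x / q.eval x)

/-- The Möbius transformation `z ↦ (az + b)/(cz + d)` as a self-map of `P¹(F)`. -/
noncomputable def mobiusMap {F : Type*} [Field F] (a b c d : F) : Option F → Option F :=
  ratP1Map (C a * X + C b) (C c * X + C d)

/-- `x` is algebraic over the image of `ι`. -/
def AlgebraicOver {k F : Type*} [Field k] [Field F] (ι : k →+* F) (x : F) : Prop :=
  ∃ p : Polynomial k, p ≠ 0 ∧ (p.map ι).IsRoot x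

/-- A self-map `g` of `P¹(F)` is isotrivial over `k` (w.r.t. `ι : k →+* F`, `F` playing the
role of an algebraic closure of `L`) if some Möbius conjugate `γ⁻¹ ∘ g ∘ γ` of `g` is given by a
rational function all of whose coefficients are algebraic over `k`. -/
def IsotrivialMap {k F : Type*} [Field k] [Field F] (ι : k →+* F)
    (g : Option F → Option F) : Prop :=
  ∃ a b c d : F, a * d - b * c ≠ 0 ∧
    ∃ p q : Polynomial F, q ≠ 0 ∧
      (∀ n, AlgebraicOver ι (p.coeff n)) ∧ (∀ n, AlgebraicOver ι (q.coeff n)) ∧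
      (mobiusMap d (-b) (-c) a) ∘ g ∘ (mobiusMap a b c d) = ratP1Map p q

open FunctionField in
/-- The embedding of the coefficient ring `F_q[t]` into the algebraic closure `Ω` of the
completion `F_q((1/t))` of `F_q(t)` at the place `ord_∞`, induced by the inclusion
`jC : F_q(t) → F_q((1/t))`. -/
noncomputable def coeffEmbed (F : Type) [Field F] [DecidableEq (RatFunc F)]
    (jC : RatFunc F →+* RatFunc.CompletionAtInfty F) :
    Polynomial F →+* AlgebraicClosure (RatFunc.CompletionAtInfty F) :=
  ((algebraMap (RatFunc.CompletionAtInfty F) (AlgebraicClosure (RatFunc.CompletionAtInfty F))).comp jC).comp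
    (algebraMap (Polynomial F) (RatFunc F))

section
set_option linter.style.haveILetI false
open Polynomial

section bideg
open IntermediateField
variable {k L : Type*} [Field k] [Field L] [Algebra k L]

lemma SUB_fracRing (c : L) (hc : Transcendental k c) :
    letI : Algebra k[X] k⟮c⟯ := (aeval (AdjoinSimple.gen k c)).toAlgebra
    IsFractionRing k[X] k⟮c⟯ := by
  letI : Algebra k[X] k⟮c⟯ := (aeval (AdjoinSimple.gen k c)).toAlgebra
  let e : RatFunc k ≃ₐ[k[X]] k⟮c⟯ :=
    AlgEquiv.ofRingEquiv (f := (RatFunc.algEquivOfTranscendental c hc).toRingEquiv) (by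
      intro g
      exact RatFunc.algEquivOfTranscendental_algebraMap c hc g)
  exact IsLocalization.isLocalization_of_algEquiv _ e

variable {K0 : Type*} [Field K0] [Algebra k K0] [Algebra K0 L] [IsScalarTower k K0 L]

/-- `K0` is generated by the transcendental element `c` -/
def SUB_Gen (k : Type*) [Field k] {K0 : Type*} [Field K0] [Algebra k K0] (c : K0) : Prop :=
  letI : Algebra k[X] K0 := (aeval c).toAlgebra
  IsFractionRing k[X] K0

/-- clearing denominators -/
lemma SUB_clear (c : K0) (hc : SUB_Gen k c) (p : K0[X]) :
    ∃ (q : k[X]) (P : k[X][X]), q ≠ 0 ∧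
      P.map (aeval c : k[X] →ₐ[k] K0).toRingHom = C (aeval c q) * p := by
  letI : Algebra k[X] K0 := (aeval c).toAlgebra
  haveI : IsFractionRing k[X] K0 := hc
  obtain ⟨b, hb, h⟩ := IsLocalization.integerNormalization_spec (nonZeroDivisors k[X]) p
  refine ⟨b, IsLocalization.integerNormalization (nonZeroDivisors k[X]) p,
    nonZeroDivisors.ne_zero hb, ?_⟩
  refine h.trans ?_
  ext1 i
  rw [coeff_smul, coeff_C_mul, Algebra.smul_def]
  rfl

lemma SUB_aeval_gen_inj (c : K0) (hc : SUB_Gen k c) :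
    Function.Injective (aeval c : k[X] →ₐ[k] K0).toRingHom := by
  letI : Algebra k[X] K0 := (aeval c).toAlgebra
  haveI : IsFractionRing k[X] K0 := hc
  exact IsFractionRing.injective k[X] K0

lemma SUB_map_gen (c : K0) (P : k[X][X]) :
    (P.map (aeval c : k[X] →ₐ[k] K0).toRingHom).map (algebraMap K0 L)
     = P.map (aeval (algebraMap K0 L c) : k[X] →ₐ[k] L).toRingHom := by
  rw [Polynomial.map_map]
  congr 1
  ext x
  · simp [← IsScalarTower.algebraMap_apply]
  · simp

lemma SUB_eval_swap (c u : L) (P : k[X][X]) :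
    ((Bivariate.swap P).map (aeval c : k[X] →ₐ[k] L).toRingHom).eval u =
      (P.map (aeval u : k[X] →ₐ[k] L).toRingHom).eval c := by
  induction P using Polynomial.induction_on' with
  | add p q hp hq => rw [map_add, Polynomial.map_add, Polynomial.map_add, eval_add, eval_add, hp, hq]
  | monomial n f =>
    induction f using Polynomial.induction_on' with
    | add p q hp hq =>
      rw [map_add, map_add, Polynomial.map_add, Polynomial.map_add, eval_add, eval_add, hp, hq]
    | monomial m r =>
      rw [Bivariate.swap_monomial_monomial]
      simp
      ring

lemma SUB_coeff_swap (P : k[X][X]) (i j : ℕ) :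
    ((Bivariate.swap P).coeff j).coeff i = (P.coeff i).coeff j := by
  induction P using Polynomial.induction_on' with
  | add p q hp hq => simp only [map_add, coeff_add, hp, hq]
  | monomial n f =>
    induction f using Polynomial.induction_on' with
    | add p q hp hq => simp only [map_add, coeff_add, hp, hq]
    | monomial m r =>
      rw [Bivariate.swap_monomial_monomial]
      simp only [coeff_monomial]
      split_ifs <;> simp [coeff_monomial, *]

/-- Bidegree lemma. -/
lemma SUB_bideg (c : K0) (u : L) (hc : SUB_Gen k c) (hu : Transcendental k u)
    (halg : IsAlgebraic k⟮u⟯ (algebraMap K0 L c)) :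
    IsAlgebraic K0 u ∧ ∃ Φ : k[X][X], Φ ≠ 0 ∧
      Φ.map (aeval (algebraMap K0 L c) : k[X] →ₐ[k] L).toRingHom =
        C (aeval (algebraMap K0 L c) Φ.leadingCoeff) * (minpoly K0 u).map (algebraMap K0 L) ∧
      Φ.natDegree = (minpoly K0 u).natDegree ∧
      (∀ i, (Φ.coeff i).natDegree ≤ (minpoly k⟮u⟯ (algebraMap K0 L c)).natDegree) := by
  classical
  obtain ⟨q, P, hq, hP⟩ := SUB_clear (AdjoinSimple.gen k u) (SUB_fracRing u hu) (minpoly k⟮u⟯ (algebraMap K0 L c))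
  have hinju := SUB_aeval_gen_inj (AdjoinSimple.gen k u) (SUB_fracRing u hu)
  have hinjc := SUB_aeval_gen_inj c hc
  have hq0 : (aeval (AdjoinSimple.gen k u) q) ≠ 0 := fun h => hq (hinju (by simpa using h))
  have hm0 : minpoly k⟮u⟯ (algebraMap K0 L c) ≠ 0 := minpoly.ne_zero halg.isIntegral
  have hPdeg : P.natDegree = (minpoly k⟮u⟯ (algebraMap K0 L c)).natDegree := by
    rw [← natDegree_map_eq_of_injective hinju, hP, natDegree_C_mul hq0]
  have hP0 : P ≠ 0 := by
    rintro rfl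
    simp at hP
    rcases hP with h | h
    · exact hq0 h
    · exact hm0 h
  have hPe : (P.map (aeval u : k[X] →ₐ[k] L).toRingHom).eval (algebraMap K0 L c) = 0 := by
    rw [show u = algebraMap k⟮u⟯ L (AdjoinSimple.gen k u) from rfl, ← SUB_map_gen, hP]
    simp [← aeval_def, eval_map]
  -- swap
  set P' := Bivariate.swap P with hP'
  have hP'0 : P' ≠ 0 := by simpa [hP'] using hP0
  have hP'e : (P'.map (aeval (algebraMap K0 L c) : k[X] →ₐ[k] L).toRingHom).eval u = 0 := by
    rw [hP', SUB_eval_swap, hPe]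
  have hP'g0 : P'.map (aeval c : k[X] →ₐ[k] K0).toRingHom ≠ 0 := by
    rwa [Ne, Polynomial.map_eq_zero_iff hinjc]
  have hroot : aeval u (P'.map (aeval c : k[X] →ₐ[k] K0).toRingHom) = 0 := by
    rw [aeval_def, ← eval_map, SUB_map_gen, hP'e]
  have halg' : IsAlgebraic K0 u := ⟨_, hP'g0, hroot⟩
  refine ⟨halg', ?_⟩
  have hm0' : minpoly K0 u ≠ 0 := minpoly.ne_zero halg'.isIntegral
  obtain ⟨q1, Φ0, hq1, hΦ0⟩ := SUB_clear c hc (minpoly K0 u)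
  have hq10 : (aeval c q1) ≠ 0 := fun h => hq1 (hinjc (by simpa using h))
  have hΦ00 : Φ0 ≠ 0 := by
    rintro rfl
    simp at hΦ0
    rcases hΦ0 with h | h
    · exact hq10 h
    · exact hm0' h
  letI : NormalizedGCDMonoid k[X] := Classical.choice inferInstance
  set Φ := Φ0.primPart with hΦ
  have hprim : Φ.IsPrimitive := isPrimitive_primPart _
  have hfac : Φ0 = C Φ0.content * Φ := eq_C_content_mul_primPart _
  have hct : Φ0.content ≠ 0 := by simpa [content_eq_zero_iff] using hΦ00
  have hctc : (aeval c Φ0.content) ≠ 0 :=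
    fun h => hct (hinjc (by simpa using h))
  have hΦne : Φ ≠ 0 := hprim.ne_zero
  set ev := (aeval c : k[X] →ₐ[k] K0).toRingHom with hev
  have hmapΦ : Φ.map ev = C (ev q1 / ev Φ0.content) * minpoly K0 u := by
    have h1 : C (ev Φ0.content) * Φ.map ev = C (ev q1) * minpoly K0 u := by
      have h2 := hΦ0
      rw [hfac, Polynomial.map_mul, map_C] at h2
      exact h2
    rw [div_eq_inv_mul, C_mul, mul_assoc, ← h1, ← mul_assoc, ← C_mul, inv_mul_cancel₀ (by exact hctc)]
    simp
  have hlc : ev Φ.leadingCoeff = ev q1 / ev Φ0.content := by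
    have := congrArg leadingCoeff hmapΦ
    rw [leadingCoeff_map_of_injective hinjc, leadingCoeff_mul, leadingCoeff_C,
      (minpoly.monic halg'.isIntegral).leadingCoeff, mul_one] at this
    exact this
  have hne : ev q1 / ev Φ0.content ≠ 0 := div_ne_zero hq10 hctc
  refine ⟨Φ, hΦne, ?_, ?_, ?_⟩
  · rw [← SUB_map_gen]
    rw [← hev, hmapΦ, Polynomial.map_mul, map_C, ← hlc]
    congr 2
    simp [hev, aeval_algebraMap_apply]
  · rw [← natDegree_map_eq_of_injective hinjc, hmapΦ, natDegree_C_mul hne]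
  · letI : Algebra k[X] K0 := (aeval c).toAlgebra
    haveI : IsFractionRing k[X] K0 := hc
    have hdvd : Φ ∣ P' := by
      refine IsPrimitive.dvd_of_fraction_map_dvd_fraction_map (K := K0) hprim ?_
      change Φ.map ev ∣ P'.map ev
      rw [hmapΦ]
      refine (IsUnit.mul_left_dvd ?_).mpr (minpoly.dvd _ _ hroot)
      exact isUnit_C.mpr hne.isUnit
    obtain ⟨N, hN⟩ := hdvd
    have hN0 : N ≠ 0 := by rintro rfl; simp at hN; exact hP'0 hN
    have hPs : P = Bivariate.swap Φ * Bivariate.swap N := by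
      rw [← map_mul, ← hN, hP', Bivariate.swap_swap_apply]
    intro i
    have hΦs : Bivariate.swap Φ ≠ 0 := by simpa using hΦne
    have hNs : Bivariate.swap N ≠ 0 := by simpa using hN0
    have : (Bivariate.swap Φ).natDegree ≤ (minpoly k⟮u⟯ (algebraMap K0 L c)).natDegree := by
      rw [← hPdeg, hPs, natDegree_mul hΦs hNs]; omega
    refine le_trans ?_ this
    refine natDegree_le_iff_coeff_eq_zero.mpr fun N hN => ?_
    rw [← SUB_coeff_swap, coeff_eq_zero_of_natDegree_lt hN, coeff_zero]
end bideg
end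

section
set_option linter.style.haveILetI false
open Polynomial

section genEval
variable {k W : Type*} [Field k] [Field W] [Algebra k W]

/-- generic evaluation attains the Gauss norm -/
lemma SUB_gen_eval (V : ValuationSubring W) (hk : ∀ x : k, algebraMap k W x ∈ V) (h : W[X]) :
    {ζ : k | ∃ i, V.valuation (h.eval (algebraMap k W ζ)) < V.valuation (h.coeff i)}.Finite := by
  classical
  by_cases h0 : h = 0
  · subst h0; simp
  obtain ⟨i0, hi0, hmax⟩ := Finset.exists_max_image h.support (fun i => V.valuation (h.coeff i))
    (by simpa using h0)
  have hi0' : h.coeff i0 ≠ 0 := by simpa using hi0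
  have hmax' : ∀ i, V.valuation (h.coeff i) ≤ V.valuation (h.coeff i0) := by
    intro i
    by_cases hi : h.coeff i = 0
    · simp [hi]
    · exact hmax i (by simpa using hi)
  have hmem : ∀ i, (h.coeff i0)⁻¹ * h.coeff i ∈ V := by
    intro i
    rw [← V.valuation_le_one_iff, map_mul, map_inv₀]
    have : V.valuation (h.coeff i0) ≠ 0 := by simpa using hi0'
    calc _ ≤ (V.valuation (h.coeff i0))⁻¹ * V.valuation (h.coeff i0) := by gcongr; exact hmax' i
      _ = 1 := inv_mul_cancel₀ this
  let h2 : V[X] := ∑ i ∈ h.support, monomial i ⟨_, hmem i⟩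
  have hh2 : h2.map V.subtype = C (h.coeff i0)⁻¹ * h := by
    ext n
    simp only [h2, Polynomial.map_sum, map_monomial, finsetSum_coeff, coeff_monomial, coeff_C_mul]
    simp
    tauto
  have hc2 : h2.coeff i0 = 1 := by
    apply Subtype.ext
    have := congrArg (fun p => p.coeff i0) hh2
    simp only [coeff_map, coeff_C_mul, inv_mul_cancel₀ hi0'] at this
    exact this
  let h3 := h2.map (IsLocalRing.residue V)
  have h30 : h3 ≠ 0 := by
    intro hh
    have := congrArg (fun p => p.coeff i0) hh
    simp [h3, hc2] at this
  let kV : k →+* V := (algebraMap k W).codRestrict V.toSubring hk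
  let kr : k →+* IsLocalRing.ResidueField V := (IsLocalRing.residue V).comp kV
  refine Set.Finite.subset ((h3.roots.toFinset.finite_toSet).preimage
    (f := kr) kr.injective.injOn) ?_
  rintro ζ ⟨i, hi⟩
  simp only [Set.mem_preimage, Finset.mem_coe, Multiset.mem_toFinset, mem_roots h30, IsRoot.def]
  have e1 : h3.eval (kr ζ) = IsLocalRing.residue V (h2.eval (kV ζ)) := by
    simp [h3, kr, eval_map, eval₂_hom]
  rw [e1, IsLocalRing.residue_eq_zero_iff, ValuationSubring.valuation_lt_one_iff]
  have e2 : ((h2.eval (kV ζ) : V) : W) = (h.coeff i0)⁻¹ * h.eval (algebraMap k W ζ) := by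
    have := congrArg (fun p => p.eval (algebraMap k W ζ)) hh2
    simp only [eval_mul, eval_C] at this
    rw [← this]
    change V.subtype _ = _
    rw [show algebraMap k W ζ = V.subtype (kV ζ) from rfl, eval_map, eval₂_hom]
  have hne : V.valuation (h.coeff i0) ≠ 0 := by simpa using hi0'
  rw [e2, map_mul, map_inv₀]
  have hpos : 0 < V.valuation (h.coeff i0) := zero_lt_iff.mpr hne
  rw [inv_mul_lt_iff₀ hpos, mul_one]
  exact hi.trans_le (hmax' i)

lemma SUB_place (s : W) (hs : Transcendental k s) :
    ∃ V : ValuationSubring W, (∀ x : k, algebraMap k W x ∈ V) ∧ V.valuation s < 1 := by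
  let A : Subring W := (Algebra.adjoin k {s}).toSubring
  have hsA : s ∈ A := Algebra.self_mem_adjoin_singleton k s
  let I : Ideal A := Ideal.span {⟨s, hsA⟩}
  have hI : I ≠ ⊤ := by
    intro h
    rw [Ideal.eq_top_iff_one, Ideal.mem_span_singleton'] at h
    obtain ⟨⟨a, ha⟩, h⟩ := h
    have ha' : a ∈ Algebra.adjoin k {s} := ha
    rw [Algebra.adjoin_singleton_eq_range_aeval] at ha'
    obtain ⟨p, rfl⟩ := ha'
    have h' : aeval s p * s = 1 := congrArg Subtype.val h
    have : p * X - 1 = 0 := by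
      apply transcendental_iff.mp hs
      simp [h']
    have := congrArg (fun q => q.coeff 0) this
    simp at this
  obtain ⟨B, hB, hIB⟩ := Ideal.image_subset_nonunits_valuationSubring (A := A) I hI
  refine ⟨B, fun x => hB (Subalgebra.algebraMap_mem _ x), ?_⟩
  rw [← B.mem_nonunits_iff]
  exact hIB ⟨⟨s, hsA⟩, Ideal.subset_span rfl, rfl⟩
end genEval
end

section
set_option linter.style.haveILetI false
open Polynomial

section lemA
open IntermediateField

lemma SUB_norm_sub {K L : Type*} [Field K] [Field L] [Algebra K L] [FiniteDimensional K L]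
    (T : L) (ζ : K) : ∃ ε : K, (ε = 1 ∨ ε = -1) ∧
      Algebra.norm K (T - algebraMap K L ζ) =
        ε * ((minpoly K T).eval ζ) ^ Module.finrank K⟮T⟯ L := by
  have hadj : K⟮T - algebraMap K L ζ⟯ = K⟮T⟯ := by
    apply le_antisymm
    · rw [adjoin_simple_le_iff]
      exact sub_mem (mem_adjoin_simple_self K T) (IntermediateField.algebraMap_mem _ _)
    · rw [adjoin_simple_le_iff]
      have := add_mem (mem_adjoin_simple_self K (T - algebraMap K L ζ))
        (IntermediateField.algebraMap_mem K⟮T - algebraMap K L ζ⟯ ζ)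
      simpa using this
  have h_itg : IsIntegral K (T - algebraMap K L ζ) := IsIntegral.of_finite K _
  have hfr : Module.finrank K⟮T - algebraMap K L ζ⟯ L = Module.finrank K⟮T⟯ L := by rw [hadj]
  rw [Algebra.norm_eq_norm_adjoin, hfr, ← adjoin.powerBasis_gen h_itg,
    Algebra.PowerBasis.norm_gen_eq_coeff_zero_minpoly, adjoin.powerBasis_gen h_itg, minpoly_gen,
    minpoly.sub_algebraMap, mul_pow]
  refine ⟨((-1) ^ (adjoin.powerBasis h_itg).dim) ^ Module.finrank K⟮T⟯ L, ?_, ?_⟩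
  · rw [← pow_mul]
    exact neg_one_pow_eq_or K _
  · congr 2
    rw [coeff_zero_eq_eval_zero, eval_comp]
    simp

lemma SUB_subfield_fin {L : Type*} [Field L] (A B : Subfield L) (h : A ≤ B)
    [FiniteDimensional A L] : FiniteDimensional B L := by
  letI : Algebra A B := (Subfield.inclusion h).toAlgebra
  haveI : IsScalarTower A B L := IsScalarTower.of_algebraMap_eq (fun _ => rfl)
  exact Module.Finite.of_restrictScalars_finite A B L

variable {k L : Type*} [Field k] [Field L] [Algebra k L]

lemma SUB_fin_transc {K0 : Type*} [Field K0] [Algebra k K0] [Algebra K0 L] [IsScalarTower k K0 L]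
    (T : L) (s : K0) (hT : Transcendental k T)
    [FiniteDimensional k⟮T⟯ L] (hs : SUB_Gen k s) : FiniteDimensional K0 L := by
  have h1 : IsAlgebraic k⟮T⟯ (algebraMap K0 L s) := Algebra.IsAlgebraic.isAlgebraic _
  have h2 := (SUB_bideg s T hs hT h1).1
  haveI : FiniteDimensional K0 K0⟮T⟯ := adjoin.finiteDimensional h2.isIntegral
  haveI : FiniteDimensional K0⟮T⟯ L := by
    refine @SUB_subfield_fin L _ k⟮T⟯.toSubfield K0⟮T⟯.toSubfield ?_ ‹_›
    have : k⟮T⟯ ≤ K0⟮T⟯.restrictScalars k := by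
      rw [adjoin_simple_le_iff]
      exact mem_adjoin_simple_self _ T
    exact this
  exact Module.Finite.trans K0⟮T⟯ L

lemma SUB_finrank_eq {E : Type*} [Field E] [Algebra k E] [Algebra E L] [IsScalarTower k E L]
    (c : E) (T : L) :
    Module.finrank k⟮c⟯⟮T⟯ L = Module.finrank k⟮T⟯⟮algebraMap E L c⟯ L := by
  have key : ∀ s s' : Subfield L, s = s' → Module.finrank s L = Module.finrank s' L := by
    rintro s _ rfl; rfl
  refine key k⟮c⟯⟮T⟯.toSubfield k⟮T⟯⟮algebraMap E L c⟯.toSubfield ?_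
  have h : k⟮c⟯⟮T⟯.restrictScalars k = k⟮T⟯⟮algebraMap E L c⟯.restrictScalars k := by
    rw [adjoin_simple_adjoin_simple]
    apply le_antisymm
    · have hc : ∀ x : k⟮c⟯, algebraMap k⟮c⟯ L x ∈ k⟮T, algebraMap E L c⟯ := by
        rintro ⟨x, hx⟩
        have h1 : k⟮c⟯ ≤ (k⟮T, algebraMap E L c⟯).comap (IsScalarTower.toAlgHom k E L) := by
          rw [adjoin_simple_le_iff]
          exact subset_adjoin k {T, algebraMap E L c} (by simp)
        exact h1 hx
      let W : IntermediateField k⟮c⟯ L :=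
        { (k⟮T, algebraMap E L c⟯).toSubfield with algebraMap_mem' := hc }
      have : k⟮c⟯⟮T⟯ ≤ W := by
        rw [adjoin_simple_le_iff]
        exact subset_adjoin k {T, algebraMap E L c} (by simp)
      exact this
    · rw [adjoin_le_iff]
      rintro x (rfl | rfl)
      · exact mem_adjoin_simple_self k⟮c⟯ x
      · exact IntermediateField.algebraMap_mem k⟮c⟯⟮T⟯ (AdjoinSimple.gen k c)
  exact congrArg IntermediateField.toSubfield h

lemma SUB_val_norm_ge {K E W : Type*} [Field K] [Field E] [Algebra K E] [FiniteDimensional K E]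
    [Field W] [Algebra E W] [Algebra K W] [IsScalarTower K E W] [IsAlgClosed W]
    (V : ValuationSubring W) (x : E) (m : V.ValueGroup)
    (h : ∀ τ : E →ₐ[K] W, m ≤ V.valuation (τ x)) :
    m ^ Module.finrank K E ≤ V.valuation (algebraMap K W (Algebra.norm K x)) := by
  rw [Algebra.norm_eq_prod_roots (F := W) (x := x) (IsAlgClosed.splits _), map_pow]
  have h_itg : IsIntegral K x := IsIntegral.of_finite K x
  have hcard : Multiset.card ((minpoly K x).aroots W) = (minpoly K x).natDegree :=
    IsAlgClosed.card_aroots_eq_natDegree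
  have hfr : Module.finrank K E = (minpoly K x).natDegree * Module.finrank K⟮x⟯ E := by
    rw [← adjoin.finrank h_itg, Module.finrank_mul_finrank]
  rw [hfr, pow_mul]
  gcongr
  rw [← hcard, map_multiset_prod]
  have : ∀ y ∈ (minpoly K x).aroots W, m ≤ V.valuation y := by
    intro y hy
    have hy' : aeval y (minpoly K x) = 0 := by
      rw [mem_aroots] at hy; exact hy.2
    obtain ⟨τ, hτ⟩ := IntermediateField.exists_algHom_of_splits_of_aeval
      (K := W) (F := K) (E := E) (x := x) (y := y) (fun s => ⟨IsIntegral.of_finite K s, IsAlgClosed.splits _⟩) hy'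
    rw [← hτ]; exact h τ
  generalize (minpoly K x).aroots W = S at this
  induction S using Multiset.induction_on with
  | empty => simp
  | cons a S ih =>
    simp only [Multiset.card_cons, Multiset.map_cons, Multiset.prod_cons, pow_succ']
    exact mul_le_mul' (this a (by simp)) (ih (fun y hy => this y (by simp [hy])))

lemma SUB_transc_of_ne [IsAlgClosed k] (c : L) (hc : ∀ x : k, algebraMap k L x ≠ c) :
    Transcendental k c := by
  intro h
  haveI : Algebra.IsAlgebraic k k⟮c⟯ := isAlgebraic_adjoin_simple h.isIntegral
  obtain ⟨x, hx⟩ := (IsAlgClosed.algebraMap_bijective_of_isIntegral (k := k) (K := k⟮c⟯)).2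
    (AdjoinSimple.gen k c)
  exact hc x (congrArg (algebraMap k⟮c⟯ L) hx)

lemma SUB_val_const (V : ValuationSubring L) (hk : ∀ x : k, algebraMap k L x ∈ V) (x : k)
    (hx : x ≠ 0) : V.valuation (algebraMap k L x) = 1 := by
  apply le_antisymm ((V.valuation_le_one_iff _).mpr (hk x))
  have h := (V.valuation_le_one_iff _).mpr (hk x⁻¹)
  have h0 : V.valuation (algebraMap k L x) ≠ 0 := by simpa using hx
  rw [map_inv₀, map_inv₀] at h
  exact (inv_le_one₀ (zero_lt_iff.mpr h0)).mp h

lemma SUB_val_poly [IsAlgClosed k] (V : ValuationSubring L) (hk : ∀ x : k, algebraMap k L x ∈ V)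
    (c : L) (hc : 1 < V.valuation c) (p : k[X]) (hp : p ≠ 0) :
    V.valuation (aeval c p) = V.valuation c ^ p.natDegree := by
  have hs := IsAlgClosed.splits p
  have hcard := hs.natDegree_eq_card_roots
  conv_lhs => rw [hs.eq_prod_roots]
  rw [map_mul, map_mul, aeval_C, SUB_val_const V hk _ (leadingCoeff_ne_zero.mpr hp), one_mul, hcard]
  generalize p.roots = S
  induction S using Multiset.induction_on with
  | empty => simp
  | cons a S ih =>
    simp only [Multiset.card_cons, Multiset.map_cons, Multiset.prod_cons, pow_succ', map_mul, ih]
    congr 1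
    rw [map_sub, aeval_X, aeval_C]
    exact Valuation.map_sub_eq_of_lt_left _ (((V.valuation_le_one_iff _).mpr (hk a)).trans_lt hc)

theorem SUB_lemmaA [IsAlgClosed k] {E : Type*} [Field E] [Algebra k E] [Algebra E L]
    [IsScalarTower k E L] (T : L) (hT : Transcendental k T) [FiniteDimensional k⟮T⟯ L]
    [FiniteDimensional E L] :
    ∃ c : E, Transcendental k c ∧ FiniteDimensional k⟮c⟯ E ∧
      Module.finrank k⟮c⟯ E ≤ Module.finrank k⟮T⟯ L := by
  classical
  have hTint : IsIntegral E T := IsIntegral.of_finite E T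
  set g := minpoly E T with hg
  have hex : ∃ i, ∀ x : k, algebraMap k E x ≠ g.coeff i := by
    by_contra! hcon
    apply hT
    have : g ∈ lifts (algebraMap k E) := by
      rw [lifts_iff_coeff_lifts]
      exact fun i => hcon i
    obtain ⟨g0, hg0⟩ := this
    refine ⟨g0, ?_, ?_⟩
    · rintro rfl
      exact minpoly.ne_zero hTint (by rw [← hg, ← hg0]; simp)
    · have h2 : aeval T g = 0 := minpoly.aeval E T
      rw [← hg0] at h2
      simpa [aeval_map_algebraMap] using h2
  obtain ⟨i0, hi0⟩ := hex
  set c := g.coeff i0 with hc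
  have hct : Transcendental k c := SUB_transc_of_ne c hi0
  haveI hfL : FiniteDimensional k⟮c⟯ L :=
    SUB_fin_transc T (AdjoinSimple.gen k c) hT (SUB_fracRing c hct)
  haveI hfE : FiniteDimensional k⟮c⟯ E := FiniteDimensional.left k⟮c⟯ E L
  refine ⟨c, hct, hfE, ?_⟩
  have halgc : IsAlgebraic k⟮T⟯ (algebraMap k⟮c⟯ L (AdjoinSimple.gen k c)) :=
    Algebra.IsAlgebraic.isAlgebraic _
  obtain ⟨-, Φ, hΦ0, hΦmap, hΦdeg, hΦc⟩ := SUB_bideg (AdjoinSimple.gen k c) T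
    (SUB_fracRing c hct) hT halgc
  have hgenc : algebraMap k⟮c⟯ L (AdjoinSimple.gen k c) = algebraMap E L c := rfl
  let W := AlgebraicClosure L
  have hctW : Transcendental k (algebraMap E W c) :=
    (transcendental_algebraMap_iff (FaithfulSMul.algebraMap_injective E W)).mpr hct
  obtain ⟨V, hkV, hVc⟩ := SUB_place (k := k) (W := W) (algebraMap E W c)⁻¹
    (fun h => hctW (IsAlgebraic.inv_iff.mp h))
  set vc := V.valuation (algebraMap E W c) with hvc
  have hvc0 : vc ≠ 0 := by
    rw [hvc, Ne, map_eq_zero]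
    intro h
    exact hctW (h ▸ isAlgebraic_zero)
  have hvc1 : 1 < vc := by
    rw [map_inv₀] at hVc
    exact (inv_lt_one₀ (zero_lt_iff.mpr hvc0)).mp hVc
  -- choose a generic constant
  have hfin : (⋃ τ : E →ₐ[k⟮c⟯] W, {ζ : k | ∃ i, V.valuation ((g.map (τ : E →+* W)).eval
      (algebraMap k W ζ)) < V.valuation ((g.map (τ : E →+* W)).coeff i)}).Finite :=
    Set.finite_iUnion fun τ => SUB_gen_eval V hkV _
  haveI : Infinite k := IsAlgClosed.instInfinite
  obtain ⟨ζ, hζ⟩ := hfin.infinite_compl.nonempty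
  simp only [Set.mem_compl_iff, Set.mem_iUnion, Set.mem_ofPred_eq, not_exists, not_lt] at hζ
  obtain ⟨ε, hε, hN⟩ := SUB_norm_sub (K := k⟮c⟯) (L := L) T (algebraMap k k⟮c⟯ ζ)
  obtain ⟨ε', hε', hN'⟩ := SUB_norm_sub (K := E) (L := L) T (algebraMap k E ζ)
  rw [← IsScalarTower.algebraMap_apply] at hN hN'
  have hNN := Algebra.norm_norm (R := k⟮c⟯) (S := E) (A := L) (a := T - algebraMap k L ζ)
  have hvε : ∀ (y : W), (y = 1 ∨ y = -1) → V.valuation y = 1 := by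
    rintro y (rfl | rfl) <;> simp [Valuation.map_neg]
  have hlow : vc ^ Module.finrank k⟮c⟯ E ≤
      V.valuation (algebraMap k⟮c⟯ W (Algebra.norm k⟮c⟯ (T - algebraMap k L ζ))) := by
    rw [← hNN]
    apply SUB_val_norm_ge
    intro τ
    rw [hN', map_mul, map_mul, map_pow, map_pow, hvε (τ ε') (by
      rcases hε' with h | h <;> simp [h]), one_mul]
    have h1 : vc ≤ V.valuation (τ (g.eval (algebraMap k E ζ))) := by
      have h2 := hζ τ i0
      have h3 : (g.map (τ : E →+* W)).coeff i0 = algebraMap E W c := by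
        rw [coeff_map]
        exact τ.commutes (AdjoinSimple.gen k c)
      rw [h3] at h2
      refine h2.trans (le_of_eq ?_)
      congr 1
      have h4 : algebraMap k W ζ = (τ : E →+* W) (algebraMap k E ζ) := by
        rw [IsScalarTower.algebraMap_apply k k⟮c⟯ E]
        exact ((τ.commutes _).trans (IsScalarTower.algebraMap_apply k k⟮c⟯ W ζ).symm).symm
      rw [h4, eval_map, eval₂_hom]
      rfl
    haveI : Module.finrank E⟮T⟯ L ≠ 0 := Module.finrank_pos.ne'
    exact h1.trans (le_self_pow (hvc1.le.trans h1) this)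
  -- upper bound
  set M0 := (minpoly k⟮T⟯ (algebraMap E L c)).natDegree with hM0
  have hup : V.valuation (algebraMap k⟮c⟯ W ((minpoly k⟮c⟯ T).eval (algebraMap k k⟮c⟯ ζ))) ≤
      vc ^ M0 := by
    set p : k[X] := Φ.eval (C ζ) with hp
    have hpdeg : p.natDegree ≤ M0 := by
      rw [hp, eval_eq_sum, Polynomial.sum]
      refine natDegree_sum_le_of_forall_le _ _ fun i _ => ?_
      rw [← C_pow]
      exact (natDegree_mul_C_le _ _).trans (hΦc i)
    have e1 : aeval (algebraMap E W c) p = aeval (algebraMap E W c) Φ.leadingCoeff *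
        algebraMap k⟮c⟯ W ((minpoly k⟮c⟯ T).eval (algebraMap k k⟮c⟯ ζ)) := by
      have h1 := congrArg (fun q => algebraMap L W (q.eval (algebraMap k L ζ))) hΦmap
      simp only [hgenc] at h1
      rw [eval_mul, eval_C, map_mul] at h1
      have h2 : algebraMap L W (eval (algebraMap k L ζ)
          (Φ.map (aeval (algebraMap E L c) : k[X] →ₐ[k] L).toRingHom)) =
          aeval (algebraMap E W c) p := by
        have h5 : algebraMap k L ζ = (aeval (algebraMap E L c) : k[X] →ₐ[k] L).toRingHom (C ζ) := by
          simp
        rw [h5, eval_map, eval₂_hom, IsScalarTower.algebraMap_apply E L W, aeval_algebraMap_apply]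
        rfl
      rw [h2] at h1
      rw [h1, IsScalarTower.algebraMap_apply E L W]
      congr 1
      · simp only [aeval_algebraMap_apply]
      rw [IsScalarTower.algebraMap_apply k⟮c⟯ L W, IsScalarTower.algebraMap_apply k k⟮c⟯ L, eval_map,
        eval₂_hom]
    have h1 : V.valuation (aeval (algebraMap E W c) p) ≤ vc ^ M0 := by
      by_cases hp0 : p = 0
      · simp [hp0]
      · rw [SUB_val_poly V hkV _ hvc1 p hp0]
        exact pow_le_pow_right₀ hvc1.le hpdeg
    have h2 : 1 ≤ V.valuation (aeval (algebraMap E W c) Φ.leadingCoeff) := by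
      rw [SUB_val_poly V hkV _ hvc1 _ (leadingCoeff_ne_zero.mpr hΦ0)]
      exact one_le_pow₀ hvc1.le
    rw [e1, map_mul] at h1
    exact (le_mul_of_one_le_left' h2).trans h1
  rw [hN, map_mul, map_mul, map_pow, map_pow, hvε (algebraMap k⟮c⟯ W ε) (by
      rcases hε with h | h <;> simp [h]), one_mul] at hlow
  have hfinal : vc ^ Module.finrank k⟮c⟯ E ≤ vc ^ (M0 * Module.finrank k⟮c⟯⟮T⟯ L) := by
    refine hlow.trans ?_
    rw [pow_mul]
    gcongr
  have := (pow_le_pow_iff_right₀ hvc1).mp hfinal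
  refine this.trans (le_of_eq ?_)
  rw [SUB_finrank_eq, hM0, ← adjoin.finrank (IsIntegral.of_finite k⟮T⟯ _),
    Module.finrank_mul_finrank]

end lemA
end

section
set_option linter.style.haveILetI false
open Polynomial

section lemB
open IntermediateField
variable {k E : Type*} [Field k] [Field E] [Algebra k E]

/-- valuation of elements of `k(π)` at a place where `π` vanishes -/
lemma SUB_val_kpi (π : E) (a : E) (ha : a ∈ k⟮π⟯) (ha0 : a ≠ 0) :
    ∃ n : ℤ, ∀ V : ValuationSubring E, (∀ x : k, algebraMap k E x ∈ V) → V.valuation π < 1 →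
      π ≠ 0 → V.valuation a = V.valuation π ^ n := by
  classical
  have poly : ∀ p : k[X], p ≠ 0 → ∃ n : ℕ, ∀ V : ValuationSubring E,
      (∀ x : k, algebraMap k E x ∈ V) → V.valuation π < 1 →
      V.valuation (aeval π p) = V.valuation π ^ n := by
    intro p hp
    obtain ⟨q, hq, hq0⟩ := exists_eq_pow_rootMultiplicity_mul_and_not_dvd p hp 0
    refine ⟨p.rootMultiplicity 0, fun V hk hπ => ?_⟩
    have hq2 := congrArg (fun r => V.valuation (aeval π r)) hq
    simp only [map_mul] at hq2
    rw [hq2]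
    have h1 : V.valuation (aeval π q) = 1 := by
      have hq1 : q.coeff 0 ≠ 0 := by
        rw [C_0, sub_zero, X_dvd_iff] at hq0; exact hq0
      have : aeval π q = algebraMap k E (q.coeff 0) + π * aeval π q.divX := by
        have h := congrArg (aeval π) (X_mul_divX_add q)
        rw [map_add, map_mul, aeval_X, aeval_C] at h
        rw [← h, add_comm]
      rw [this]
      have hle : V.valuation (aeval π q.divX) ≤ 1 := by
        rw [V.valuation_le_one_iff]
        have hπV : π ∈ V := (V.valuation_le_one_iff _).mp hπ.le
        rw [aeval_eq_sum_range]
        refine sum_mem fun i _ => ?_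
        rw [Algebra.smul_def]
        exact mul_mem (hk _) (pow_mem hπV _)
      rw [Valuation.map_add_eq_of_lt_left, SUB_val_const V hk _ hq1]
      rw [SUB_val_const V hk _ hq1, map_mul]
      calc _ ≤ V.valuation π * 1 := by gcongr
        _ < 1 := by simpa using hπ
    rw [h1, mul_one]
    simp
  rw [mem_adjoin_simple_iff] at ha
  obtain ⟨r, s, rfl⟩ := ha
  have hr : r ≠ 0 := by rintro rfl; simp at ha0
  have hs : s ≠ 0 := by rintro rfl; simp at ha0
  obtain ⟨n, hn⟩ := poly r hr
  obtain ⟨m, hm⟩ := poly s hs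
  refine ⟨n - m, fun V hk hπ hπ0 => ?_⟩
  have : V.valuation π ≠ 0 := by simpa using hπ0
  rw [map_div₀, hn V hk hπ, hm V hk hπ, zpow_sub₀ this]
  simp

lemma SUB_val_kpi_le (π : E) (hπ0 : π ≠ 0) (a : E) (ha : a ∈ k⟮π⟯) (V V' : ValuationSubring E)
    (hk : ∀ x : k, algebraMap k E x ∈ V) (hk' : ∀ x : k, algebraMap k E x ∈ V')
    (hπ : V.valuation π < 1) (hπ' : V'.valuation π < 1) (h : V.valuation a ≤ 1) :
    V'.valuation a ≤ 1 := by
  by_cases ha0 : a = 0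
  · simp [ha0]
  obtain ⟨n, hn⟩ := SUB_val_kpi π a ha ha0
  rw [hn V hk hπ hπ0] at h
  rw [hn V' hk' hπ' hπ0]
  have hp : 0 < V.valuation π := zero_lt_iff.mpr (by simpa using hπ0)
  have hp' : 0 < V'.valuation π := zero_lt_iff.mpr (by simpa using hπ0)
  have hn0 : 0 ≤ n := by
    by_contra hneg
    have : 1 < V.valuation π ^ n := one_lt_zpow_of_neg₀ hp hπ (by omega)
    exact absurd h (not_le.mpr this)
  obtain ⟨m, rfl⟩ := Int.eq_ofNat_of_zero_le hn0
  rw [zpow_natCast]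
  exact pow_le_one' hπ'.le m

lemma SUB_fiber [Infinite k] {ι : Type*} (s : Finset ι) (V : ι → ValuationSubring E)
    (hk : ∀ i, ∀ x : k, algebraMap k E x ∈ V i)
    (hsep : ∀ i ∈ s, ∀ j ∈ s, i ≠ j → ∃ u ∈ V i, u ∉ V j)
    (π : E) (hπ0 : π ≠ 0) (hπ : ∀ i ∈ s, (V i).valuation π < 1) [FiniteDimensional k⟮π⟯ E] :
    s.card ≤ Module.finrank k⟮π⟯ E := by
  classical
  have hw : ∀ i j, ∃ w : E, i ∈ s → j ∈ s → i ≠ j → (V j).valuation w < 1 ∧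
      (V i).valuation w = 1 ∧ ∀ l ∈ s, (V l).valuation w ≤ 1 := by
    intro i j
    by_cases hij : i ∈ s ∧ j ∈ s ∧ i ≠ j
    swap
    · exact ⟨0, fun a b c => absurd ⟨a, b, c⟩ hij⟩
    obtain ⟨hi, hj, hne⟩ := hij
    obtain ⟨u, hui, huj⟩ := hsep i hi j hj hne
    have hfin : (⋃ l ∈ s, {ζ : k | ∃ n, (V l).valuation ((X - C u : E[X]).eval (algebraMap k E ζ))
        < (V l).valuation ((X - C u : E[X]).coeff n)}).Finite :=
      s.finite_toSet.biUnion fun l _ => SUB_gen_eval (V l) (hk l) _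
    obtain ⟨ζ, hζ⟩ := hfin.infinite_compl.nonempty
    have hζ' : ∀ l ∈ s, 1 ≤ (V l).valuation (algebraMap k E ζ - u) := by
      intro l hl
      simp only [Set.mem_compl_iff, Set.mem_iUnion, Set.mem_ofPred_eq, not_exists, not_lt] at hζ
      have := hζ l hl 1
      simpa [coeff_X, coeff_C] using this
    have hone : ∀ l ∈ s, ((V l).valuation (algebraMap k E ζ - u))⁻¹ ≤ 1 := fun l hl =>
      inv_le_one_of_one_le₀ (hζ' l hl)
    refine ⟨(algebraMap k E ζ - u)⁻¹, fun _ _ _ => ⟨?_, ?_, ?_⟩⟩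
    · rw [map_inv₀]
      apply inv_lt_one_of_one_lt₀
      have h1 : 1 < (V j).valuation u := by
        rw [← not_le, (V j).valuation_le_one_iff]; exact huj
      rw [Valuation.map_sub_eq_of_lt_right]
      · exact h1
      · exact (((V j).valuation_le_one_iff _).mpr (hk j ζ)).trans_lt h1
    · rw [map_inv₀, inv_eq_one]
      refine le_antisymm ?_ (hζ' i hi)
      rw [(V i).valuation_le_one_iff]
      exact sub_mem (hk i ζ) hui
    · intro l hl
      rw [map_inv₀]
      exact hone l hl
  choose w hw using hw
  let e : ι → E := fun i => ∏ j ∈ s.erase i, w i j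
  have he1 : ∀ i ∈ s, (V i).valuation (e i) = 1 := by
    intro i hi
    rw [map_prod]
    refine Finset.prod_eq_one fun j hj => ?_
    rw [Finset.mem_erase] at hj
    exact (hw i j hi hj.2 (Ne.symm hj.1)).2.1
  have he2 : ∀ i ∈ s, ∀ j ∈ s, i ≠ j → (V j).valuation (e i) < 1 := by
    intro i hi j hj hij
    have hj' : j ∈ s.erase i := Finset.mem_erase.mpr ⟨Ne.symm hij, hj⟩
    rw [map_prod, ← Finset.mul_prod_erase _ _ hj']
    calc _ ≤ (V j).valuation (w i j) * 1 := by
          gcongr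
          refine Finset.prod_le_one' fun l hl => ?_
          rw [Finset.mem_erase, Finset.mem_erase] at hl
          exact (hw i l hi hl.2.2 (Ne.symm hl.2.1)).2.2 j hj
      _ < 1 := by rw [mul_one]; exact (hw i j hi hj hij).1
  have hli : LinearIndependent k⟮π⟯ (fun i : s => e i) := by
    rw [Fintype.linearIndependent_iff]
    intro a hsum
    by_contra! hcon
    obtain ⟨i1, hi1⟩ := hcon
    obtain ⟨i0, -, hmax⟩ := Finset.exists_max_image (Finset.univ : Finset s)
      (fun i => (V i1).valuation (a i : E)) ⟨i1, by simp⟩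
    have hi0 : a i0 ≠ 0 := by
      intro h0
      have := hmax i1 (by simp)
      rw [h0] at this
      simp at this
      exact hi1 this
    have hi0' : (a i0 : E) ≠ 0 := by simpa using hi0
    have hb : ∀ i : s, (V i0).valuation ((a i : E) / (a i0 : E)) ≤ 1 := by
      intro i
      refine SUB_val_kpi_le π hπ0 _ (div_mem (a i).2 (a i0).2) (V i1) (V i0) (hk _) (hk _)
        (hπ _ i1.2) (hπ _ i0.2) ?_
      rw [map_div₀]
      exact div_le_one_of_le₀ (hmax i (by simp)) (zero_le)
    have hsum' : ∑ i : s, ((a i : E) / (a i0 : E)) * e i = 0 := by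
      have : ∑ i : s, (a i : E) * e i = 0 := by
        rw [← hsum]
        refine Finset.sum_congr rfl fun i _ => ?_
        rw [Algebra.smul_def]; rfl
      calc _ = (∑ i : s, (a i : E) * e i) / (a i0 : E) := by
            rw [Finset.sum_div]
            exact Finset.sum_congr rfl fun i _ => by ring
        _ = 0 := by rw [this, zero_div]
    rw [← Finset.add_sum_erase _ _ (Finset.mem_univ i0), div_self hi0', one_mul] at hsum'
    have h1 : (V i0).valuation (∑ i ∈ Finset.univ.erase i0, ((a i : E) / (a i0 : E)) * e i) < 1 := by
      refine Valuation.map_sum_lt _ one_ne_zero fun i hi => ?_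
      rw [map_mul]
      calc _ ≤ 1 * (V i0).valuation (e i) := by gcongr; exact hb i
        _ < 1 := by
          rw [one_mul]
          refine he2 i i.2 i0 i0.2 fun h => ?_
          exact (Finset.mem_erase.mp hi).1 (Subtype.ext h)
    have h2 := he1 i0 i0.2
    rw [eq_neg_of_add_eq_zero_left hsum', Valuation.map_neg] at h2
    exact absurd h2 h1.ne
  have := hli.fintype_card_le_finrank
  simpa using this

end lemB
end

section
set_option linter.style.haveILetI false
open Polynomial

section lemB2
open IntermediateField
variable {k E : Type*} [Field k] [Field E] [Algebra k E]

lemma SUB_top_of_adjoin (V : ValuationSubring E) (K0 : IntermediateField k E)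
    [FiniteDimensional K0 E] (h : ∀ x ∈ K0, x ∈ V) : V = ⊤ := by
  rw [eq_top_iff]
  intro x _
  letI : Algebra K0 V := (RingHom.codRestrict (algebraMap K0 E) V.toSubring
    (fun x => h x.1 x.2)).toAlgebra
  haveI : IsScalarTower K0 V E := IsScalarTower.of_algebraMap_eq (fun _ => rfl)
  have h1 : IsIntegral K0 x := IsIntegral.of_finite K0 x
  have h2 : IsIntegral V x := h1.tower_top
  obtain ⟨y, hy⟩ := IsIntegrallyClosed.isIntegral_iff.mp h2
  rw [← hy]
  exact y.2

lemma SUB_residue [IsAlgClosed k] (V : ValuationSubring E) (hk : ∀ x : k, algebraMap k E x ∈ V)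
    (htop : V ≠ ⊤) (c : E) [FiniteDimensional k⟮c⟯ E] (hc : c ∈ V) :
    ∃ γ : k, V.valuation (c - algebraMap k E γ) < 1 := by
  by_contra! hcon
  have h1 : ∀ p : k[X], p ≠ 0 → V.valuation (aeval c p) = 1 := by
    intro p hp
    have hs := IsAlgClosed.splits p
    rw [hs.eq_prod_roots]
    rw [map_mul, map_mul, aeval_C, SUB_val_const V hk _ (leadingCoeff_ne_zero.mpr hp), one_mul]
    rw [map_multiset_prod, map_multiset_prod, Multiset.map_map, Multiset.map_map]
    refine Multiset.prod_eq_one ?_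
    intro x hx
    obtain ⟨γ, -, rfl⟩ := Multiset.mem_map.mp hx
    simp only [Function.comp, map_sub, aeval_X, aeval_C]
    refine le_antisymm ?_ (hcon γ)
    rw [V.valuation_le_one_iff]
    exact sub_mem hc (hk γ)
  refine htop (SUB_top_of_adjoin V k⟮c⟯ fun x hx => ?_)
  rw [mem_adjoin_simple_iff] at hx
  obtain ⟨r, s, rfl⟩ := hx
  rw [← V.valuation_le_one_iff]
  by_cases hr : r = 0
  · simp [hr]
  by_cases hs : s = 0
  · simp [hs]
  rw [map_div₀, h1 r hr, h1 s hs, div_one]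

lemma SUB_polyfin (Q M : ℕ) (Φ : k[X][X]) (hΦ : Φ ≠ 0) (hd : Φ.natDegree ≤ M)
    (hcd : ∀ i, (Φ.coeff i).natDegree ≤ M) :
    ∃ Γ : Finset k, Γ.card ≤ (Q + 1) * M ∧ ∀ (V : ValuationSubring E),
      (∀ x : k, algebraMap k E x ∈ V) → ∀ (c u : E) (γ : k),
      V.valuation (c - algebraMap k E γ) < 1 → V.valuation (u - c ^ Q) < 1 → u ≠ c ^ Q →
      (Φ.map (aeval c : k[X] →ₐ[k] E).toRingHom).eval u = 0 → γ ∈ Γ := by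
  classical
  set Ψ := taylor (X ^ Q : k[X]) Φ with hΨ
  have hΨ0 : Ψ ≠ 0 := by
    rw [hΨ, Ne, ← (taylor (X ^ Q : k[X])).map_zero]
    exact fun h => hΦ (taylor_injective _ h)
  have hΨc : ∀ i, (Ψ.coeff i).natDegree ≤ (Q + 1) * M := by
    intro i
    rw [hΨ, taylor_coeff, eval_eq_sum_range]
    refine natDegree_sum_le_of_forall_le _ _ fun j hj => ?_
    have hj' : j ≤ M := by
      have h1 := natDegree_hasseDeriv_le Φ i
      rw [Finset.mem_range] at hj
      omega
    refine natDegree_mul_le.trans ?_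
    have h1 : ((hasseDeriv i Φ).coeff j).natDegree ≤ M := by
      rw [hasseDeriv_coeff, ← nsmul_eq_mul]
      exact (natDegree_smul_le _ _).trans (hcd _)
    have h2 : (((X : k[X]) ^ Q) ^ j).natDegree ≤ Q * M := by
      rw [← pow_mul, natDegree_X_pow]
      exact Nat.mul_le_mul_left _ hj'
    calc _ ≤ M + Q * M := add_le_add h1 h2
      _ = _ := by ring
  obtain ⟨P, hP, hP0⟩ := exists_eq_pow_rootMultiplicity_mul_and_not_dvd Ψ hΨ0 0
  set m := Ψ.rootMultiplicity 0
  rw [C_0, sub_zero] at hP hP0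
  rw [X_dvd_iff] at hP0
  have hPc : P.coeff 0 = Ψ.coeff m := by
    rw [hP]
    have := coeff_X_pow_mul P m 0
    rw [zero_add] at this
    exact this.symm
  refine ⟨(P.coeff 0).roots.toFinset, ?_, ?_⟩
  · refine (Multiset.toFinset_card_le _).trans ((card_roots' _).trans ?_)
    rw [hPc]; exact hΨc m
  intro V hk c u γ hγ hG hG0 hev
  have hcV : c ∈ V := by
    have := add_mem ((V.valuation_le_one_iff _).mp hγ.le) (hk γ)
    simpa using this
  have hGV : u - c ^ Q ∈ V := (V.valuation_le_one_iff _).mp hG.le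
  have haev : ∀ p : k[X], aeval c p ∈ V := by
    intro p
    rw [aeval_eq_sum_range]
    refine sum_mem fun i _ => ?_
    rw [Algebra.smul_def]
    exact mul_mem (hk _) (pow_mem hcV _)
  have hev2 : (Ψ.map (aeval c : k[X] →ₐ[k] E).toRingHom).eval (u - c ^ Q) = 0 := by
    rw [hΨ, map_taylor, taylor_eval]
    simpa using hev
  rw [hP, Polynomial.map_mul, eval_mul, Polynomial.map_pow, map_X, eval_pow, eval_X] at hev2
  have hev3 : (P.map (aeval c : k[X] →ₐ[k] E).toRingHom).eval (u - c ^ Q) = 0 :=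
    (mul_eq_zero.mp hev2).resolve_left (pow_ne_zero _ (sub_ne_zero.mpr hG0))
  have hsplit := congrArg (fun r => (r.map (aeval c : k[X] →ₐ[k] E).toRingHom).eval (u - c ^ Q))
    (X_mul_divX_add P)
  simp only [Polynomial.map_add, Polynomial.map_mul, map_X, map_C, eval_add, eval_mul, eval_X,
    eval_C, hev3] at hsplit
  have hlt1 : V.valuation (aeval c (P.coeff 0)) < 1 := by
    have h1 : aeval c (P.coeff 0) = - ((u - c ^ Q) *
        (P.divX.map (aeval c : k[X] →ₐ[k] E).toRingHom).eval (u - c ^ Q)) :=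
      eq_neg_of_add_eq_zero_right hsplit
    rw [h1, Valuation.map_neg, map_mul]
    have h2 : V.valuation ((P.divX.map (aeval c : k[X] →ₐ[k] E).toRingHom).eval (u - c ^ Q)) ≤ 1 := by
      rw [V.valuation_le_one_iff, eval_eq_sum_range]
      refine sum_mem fun i _ => mul_mem ?_ (pow_mem hGV _)
      rw [coeff_map]
      exact haev _
    calc _ ≤ V.valuation (u - c ^ Q) * 1 := by gcongr
      _ < 1 := by simpa using hG
  rw [Multiset.mem_toFinset, mem_roots hP0, IsRoot]
  by_contra hne
  have h5 := SUB_val_const V hk _ hne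
  have h6 : V.valuation (aeval c (P.coeff 0) - algebraMap k E ((P.coeff 0).eval γ)) < 1 := by
    obtain ⟨q, hq⟩ := X_sub_C_dvd_sub_C_eval (p := P.coeff 0) (a := γ)
    have h7 := congrArg (aeval c) hq
    rw [map_sub, map_mul, map_sub, aeval_X, aeval_C, aeval_C] at h7
    rw [h7, map_mul]
    have h2 := (V.valuation_le_one_iff _).mpr (haev q)
    calc _ ≤ V.valuation (c - algebraMap k E γ) * 1 := by gcongr
      _ < 1 := by simpa using hγ
  have h8 : algebraMap k E ((P.coeff 0).eval γ) = aeval c (P.coeff 0) -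
    (aeval c (P.coeff 0) - algebraMap k E ((P.coeff 0).eval γ)) := by ring
  have h9 : V.valuation (algebraMap k E ((P.coeff 0).eval γ)) < 1 := by
    rw [h8]
    exact (Valuation.map_sub_lt _ hlt1 h6)
  exact absurd h5 h9.ne

lemma SUB_finrank_psi [IsAlgClosed k] (Q : ℕ) (hQ : Q ≠ 0) (ψ : E ≃+* E)
    (hψ : ∀ κ : k, ψ (algebraMap k E κ) = algebraMap k E κ ^ Q) (c : E) :
    Module.finrank k⟮ψ c⟯ E = Module.finrank k⟮c⟯ E := by
  have key : ∀ s s' : Subfield E, s = s' → Module.finrank s E = Module.finrank s' E := by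
    rintro s _ rfl; rfl
  have h1 : k⟮ψ c⟯.toSubfield = k⟮c⟯.toSubfield.map (ψ : E →+* E) := by
    rw [adjoin_toSubfield, adjoin_toSubfield, RingHom.map_field_closure]
    congr 1
    rw [Set.image_union, Set.image_singleton]
    congr 1
    ext y
    constructor
    · rintro ⟨x, rfl⟩
      obtain ⟨z, hz⟩ := IsAlgClosed.exists_pow_nat_eq x (Nat.pos_of_ne_zero hQ)
      exact ⟨_, ⟨z, rfl⟩, by rw [← hz, map_pow]; exact hψ z⟩
    · rintro ⟨_, ⟨x, rfl⟩, rfl⟩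
      exact ⟨x ^ Q, by rw [map_pow]; exact (hψ x).symm⟩
  rw [show Module.finrank k⟮ψ c⟯ E = Module.finrank k⟮ψ c⟯.toSubfield E from rfl, key _ _ h1]
  symm
  let i : k⟮c⟯.toSubfield ≃+* k⟮c⟯.toSubfield.map (ψ : E →+* E) :=
    k⟮c⟯.toSubfield.toSubring.equivMapOfInjective (ψ : E →+* E) ψ.injective
  exact Algebra.finrank_eq_of_equiv_equiv i ψ (by ext x; rfl)

theorem SUB_lemmaB [IsAlgClosed k] (p : ℕ) [Fact p.Prime] [CharP E p] (n : ℕ) (hn : n ≠ 0)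
    (ψ : E ≃+* E) (hψ : ∀ κ : k, ψ (algebraMap k E κ) = algebraMap k E κ ^ (p ^ n))
    {ι : Type*} (V : ι → ValuationSubring E)
    (hk : ∀ i, ∀ x : k, algebraMap k E x ∈ V i) (htop : ∀ i, V i ≠ ⊤)
    (ha : ∀ i x, x ∈ V i → (V i).valuation (ψ x - x ^ (p ^ n)) < 1)
    (hb : ∀ i x, (V i).valuation (ψ x) = (V i).valuation x)
    (s : Finset ι) (hsep : ∀ i ∈ s, ∀ j ∈ s, i ≠ j → ∃ u ∈ V i, u ∉ V j)
    (c : E) (hc : Transcendental k c) [FiniteDimensional k⟮c⟯ E] (M : ℕ)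
    (hM : Module.finrank k⟮c⟯ E ≤ M) : s.card ≤ M * (1 + (p ^ n + 1) * M) := by
  classical
  set Q := p ^ n with hQdef
  have hQ1 : 1 < Q := Nat.one_lt_pow hn (Fact.out : p.Prime).one_lt
  by_cases hs0 : s = ∅
  · simp [hs0]
  obtain ⟨i0, hi0⟩ := Finset.nonempty_iff_ne_empty.mpr hs0
  have hpow : ∀ i (x : E), x ≠ 0 → (V i).valuation x ≠ 1 → (V i).valuation x ≠ (V i).valuation x ^ Q := by
    intro i x hx hx1 h
    have h0 : (V i).valuation x ≠ 0 := by simpa using hx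
    have h2 : (V i).valuation x ^ (Q - 1) = 1 := by
      have : (V i).valuation x ^ (Q - 1) * (V i).valuation x = 1 * (V i).valuation x := by
        rw [← pow_succ, one_mul, Nat.sub_add_cancel hQ1.le, ← h]
      exact mul_right_cancel₀ h0 this
    exact hx1 ((pow_eq_one_iff.mp h2).resolve_right (by omega))
  have hcne : ∀ γ : k, c - algebraMap k E γ ≠ 0 := by
    intro γ h
    rw [sub_eq_zero] at h
    exact hc (h ▸ isAlgebraic_algebraMap γ)
  have hc0 : c ≠ 0 := by simpa using hcne 0
  -- `ψ c ≠ c ^ Q`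
  have hG : ψ c ≠ c ^ Q := by
    intro h
    by_cases hcV : c ∈ V i0
    · obtain ⟨γ, hγ⟩ := SUB_residue (V i0) (hk i0) (htop i0) c hcV
      refine hpow i0 _ (hcne γ) hγ.ne ?_
      rw [← map_pow, hQdef, sub_pow_char_pow, ← hQdef, ← h, ← hψ, ← map_sub, hb]
    · refine hpow i0 c hc0 ?_ ?_
      · rw [← (V i0).valuation_le_one_iff] at hcV
        exact fun h => hcV h.le
      · rw [← map_pow, ← h, hb]
  have hfr := SUB_finrank_psi Q (by omega) ψ hψ c
  haveI hfin : FiniteDimensional k⟮ψ c⟯ E := by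
    apply Module.finite_of_finrank_pos
    rw [hfr]; exact Module.finrank_pos
  have hu : Transcendental k (ψ c) := by
    refine SUB_transc_of_ne _ fun x hx => ?_
    obtain ⟨z, hz⟩ := IsAlgClosed.exists_pow_nat_eq x (show 0 < Q by omega)
    rw [← hz, map_pow, ← hψ] at hx
    have := ψ.injective hx
    exact hcne z (by rw [this, sub_self])
  have hbd := SUB_bideg (AdjoinSimple.gen k c) (ψ c) (SUB_fracRing c hc) hu
    (Algebra.IsAlgebraic.isAlgebraic _)
  obtain ⟨-, Φ, hΦ0, hΦ1, hΦ2, hΦ3⟩ := hbd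
  rw [AdjoinSimple.algebraMap_gen] at hΦ1 hΦ3
  have hd : Φ.natDegree ≤ M := by
    rw [hΦ2]
    exact (minpoly.natDegree_le _).trans hM
  have hcd : ∀ i, (Φ.coeff i).natDegree ≤ M := by
    intro i
    exact (hΦ3 i).trans ((minpoly.natDegree_le _).trans (hfr.le.trans hM))
  obtain ⟨Γ, hΓc, hΓ⟩ := SUB_polyfin (E := E) Q M Φ hΦ0 hd hcd
  have hev : (Φ.map (aeval c : k[X] →ₐ[k] E).toRingHom).eval (ψ c) = 0 := by
    rw [hΦ1, eval_mul]
    have : ((minpoly k⟮c⟯ (ψ c)).map (algebraMap k⟮c⟯ E)).eval (ψ c) = 0 := by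
      rw [eval_map_algebraMap]; exact minpoly.aeval _ _
    rw [this, mul_zero]
  -- labels
  have hlab : ∀ i, ∃ l : Option k, (l ∈ insert none (Γ.map Function.Embedding.some)) ∧
      (∀ γ, l = some γ → (V i).valuation (c - algebraMap k E γ) < 1) ∧
      (l = none → (V i).valuation c⁻¹ < 1) := by
    intro i
    by_cases hcV : c ∈ V i
    · obtain ⟨γ, hγ⟩ := SUB_residue (V i) (hk i) (htop i) c hcV
      refine ⟨some γ, ?_, ?_, by simp⟩
      · simpa using hΓ (V i) (hk i) c (ψ c) γ hγ (ha i c hcV) hG hev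
      · rintro _ ⟨⟩; exact hγ
    · refine ⟨none, by simp, by simp, fun _ => ?_⟩
      rw [← (V i).valuation_le_one_iff, not_le] at hcV
      rw [map_inv₀]
      exact inv_lt_one_of_one_lt₀ hcV
  choose l hl1 hl2 hl3 using hlab
  have key : ∀ s s' : Subfield E, s = s' → Module.finrank s E = Module.finrank s' E := by
    rintro s _ rfl; rfl
  have hπ : ∀ π : E, k⟮π⟯ = k⟮c⟯ → π ≠ 0 → ∀ s' : Finset ι, s' ⊆ s →
      (∀ i ∈ s', (V i).valuation π < 1) → s'.card ≤ M := by
    intro π hπ hπ0 s' hs' hval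
    have hfr' : Module.finrank k⟮π⟯ E = Module.finrank k⟮c⟯ E :=
      key k⟮π⟯.toSubfield k⟮c⟯.toSubfield (by rw [hπ])
    haveI : FiniteDimensional k⟮π⟯ E := by
      apply Module.finite_of_finrank_pos
      rw [hfr']; exact Module.finrank_pos
    refine (SUB_fiber s' V hk (fun i hi j hj => hsep i (hs' hi) j (hs' hj)) π hπ0 hval).trans ?_
    rw [hfr']; exact hM
  have hcard := Finset.card_le_mul_card_image (f := l) s M (by
    intro b hb
    rcases b with _ | γ
    · refine hπ c⁻¹ ?_ (inv_ne_zero hc0) _ (Finset.filter_subset _ _) ?_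
      · apply le_antisymm
        · rw [adjoin_simple_le_iff]
          exact inv_mem (mem_adjoin_simple_self k c)
        · rw [adjoin_simple_le_iff]
          have := inv_mem (mem_adjoin_simple_self k c⁻¹)
          rwa [inv_inv] at this
      · intro i hi
        exact hl3 i (Finset.mem_filter.mp hi).2
    · refine hπ (c - algebraMap k E γ) ?_ (hcne γ) _ (Finset.filter_subset _ _) ?_
      · apply le_antisymm
        · rw [adjoin_simple_le_iff]
          exact sub_mem (mem_adjoin_simple_self k c) (IntermediateField.algebraMap_mem _ _)
        · rw [adjoin_simple_le_iff]
          have := add_mem (mem_adjoin_simple_self k (c - algebraMap k E γ))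
            (IntermediateField.algebraMap_mem _ γ)
          rwa [sub_add_cancel] at this
      · intro i hi
        exact hl2 i γ (Finset.mem_filter.mp hi).2)
  refine hcard.trans (Nat.mul_le_mul_left _ ?_)
  calc (s.image l).card ≤ (insert none (Γ.map Function.Embedding.some)).card := by
        apply Finset.card_le_card
        intro x hx
        obtain ⟨i, -, rfl⟩ := Finset.mem_image.mp hx
        exact hl1 i
    _ ≤ (Γ.map Function.Embedding.some).card + 1 := Finset.card_insert_le _ _
    _ ≤ _ := by rw [Finset.card_map]; omega

end lemB2
end

section
set_option linter.style.haveILetI false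
open Polynomial

section psi
open IntermediateField
variable {k Θ : Type*} [Field k] [Field Θ] [Algebra k Θ]

/-- simultaneous leading form of `x` and `x'` -/
def SUB_Form (k : Type*) {Θ : Type*} [Field k] [Field Θ] [Algebra k Θ] (E1 : Subfield Θ)
    (V : ValuationSubring Θ) (Q : ℕ) (x x' : Θ) : Prop :=
  ∃ (κ : k) (e w w' : Θ), κ ≠ 0 ∧ e ∈ E1 ∧ e ≠ 0 ∧ V.valuation (w - 1) < 1 ∧
    V.valuation (w' - 1) < 1 ∧ x = algebraMap k Θ κ * e * w ∧
    x' = algebraMap k Θ κ ^ Q * e * w'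

lemma SUB_val_w (V : ValuationSubring Θ) (w : Θ) (hw : V.valuation (w - 1) < 1) :
    V.valuation w = 1 := by
  have : w = 1 + (w - 1) := by ring
  rw [this, Valuation.map_add_eq_of_lt_left _ (by simpa using hw), map_one]

lemma SUB_claim (p : ℕ) [Fact p.Prime] [CharP k p] (n : ℕ) (E1 : Subfield Θ)
    (V : ValuationSubring Θ) (hk : ∀ x : k, algebraMap k Θ x ∈ V)
    (hres : ∀ y ∈ E1, y ∈ V → ∃ ρ : k, ρ ^ (p ^ n) = ρ ∧ algebraMap k Θ ρ ∈ E1 ∧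
      V.valuation (y - algebraMap k Θ ρ) < 1) {α : Type*} (s : Finset α) :
    ∀ (κ : α → k) (x : α → Θ), (∀ i, x i ∈ E1) →
    (∑ i ∈ s, algebraMap k Θ (κ i) * x i = 0 ∧
      ∑ i ∈ s, algebraMap k Θ (κ i) ^ (p ^ n) * x i = 0) ∨
    SUB_Form k E1 V (p ^ n) (∑ i ∈ s, algebraMap k Θ (κ i) * x i)
      (∑ i ∈ s, algebraMap k Θ (κ i) ^ (p ^ n) * x i) := by
  classical
  induction' hN : s.card with N ih generalizing s
  · intro κ x _
    rw [Finset.card_eq_zero] at hN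
    left; simp [hN]
  intro κ x hx
  by_cases hall : ∀ i ∈ s, x i = 0
  · left
    exact ⟨Finset.sum_eq_zero fun i hi => by rw [hall i hi, mul_zero],
      Finset.sum_eq_zero fun i hi => by rw [hall i hi, mul_zero]⟩
  push Not at hall
  obtain ⟨i1, hi1, hi1'⟩ := hall
  obtain ⟨j, hj, hmax⟩ := Finset.exists_max_image s (fun i => V.valuation (x i)) ⟨i1, hi1⟩
  have hxj : x j ≠ 0 := by
    intro h
    have := hmax i1 hi1
    rw [h, map_zero] at this
    exact hi1' (by simpa using this)
  have hy : ∀ i, ∃ ρ : k, i ∈ s → (ρ ^ (p ^ n) = ρ ∧ algebraMap k Θ ρ ∈ E1 ∧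
      V.valuation (x i / x j - algebraMap k Θ ρ) < 1) := by
    intro i
    by_cases hi : i ∈ s
    · obtain ⟨ρ, hρ⟩ := hres (x i / x j) (div_mem (hx i) (hx j)) (by
        rw [← V.valuation_le_one_iff, map_div₀]
        exact div_le_one_of_le₀ (hmax i hi) (zero_le))
      exact ⟨ρ, fun _ => hρ⟩
    · exact ⟨0, fun h => absurd h hi⟩
  choose ρ hρ using hy
  have hρj : ρ j = 1 := by
    by_contra hne
    have h1 := (hρ j hj).2.2
    rw [div_self hxj, ← map_one (algebraMap k Θ), ← map_sub,
      SUB_val_const V hk _ (sub_ne_zero.mpr (Ne.symm hne))] at h1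
    exact lt_irrefl _ h1
  set m : α → Θ := fun i => x i / x j - algebraMap k Θ (ρ i) with hm
  set τ : k := ∑ i ∈ s, κ i * ρ i with hτ
  have hτQ : τ ^ (p ^ n) = ∑ i ∈ s, κ i ^ (p ^ n) * ρ i := by
    rw [hτ, sum_pow_char_pow]
    refine Finset.sum_congr rfl fun i hi => ?_
    rw [mul_pow, (hρ i hi).1]
  have hu : ∑ i ∈ s, algebraMap k Θ (κ i) * x i =
      (algebraMap k Θ τ + ∑ i ∈ s, algebraMap k Θ (κ i) * m i) * x j := by
    rw [hτ, map_sum, ← Finset.sum_add_distrib, Finset.sum_mul]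
    refine Finset.sum_congr rfl fun i _ => ?_
    rw [hm, map_mul]
    field_simp
    ring
  have hu' : ∑ i ∈ s, algebraMap k Θ (κ i) ^ (p ^ n) * x i =
      (algebraMap k Θ τ ^ (p ^ n) + ∑ i ∈ s, algebraMap k Θ (κ i) ^ (p ^ n) * m i) * x j := by
    rw [← map_pow, hτQ, map_sum, ← Finset.sum_add_distrib, Finset.sum_mul]
    refine Finset.sum_congr rfl fun i _ => ?_
    rw [hm, map_mul, map_pow]
    field_simp
    ring
  have hlt : ∀ c : α → k, V.valuation (∑ i ∈ s, algebraMap k Θ (c i) * m i) < 1 := by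
    intro c
    refine Valuation.map_sum_lt _ one_ne_zero fun i hi => ?_
    rw [map_mul]
    have h1 := (V.valuation_le_one_iff _).mpr (hk (c i))
    calc _ ≤ 1 * V.valuation (m i) := by gcongr
      _ < 1 := by rw [one_mul]; exact (hρ i hi).2.2
  by_cases hτ0 : τ = 0
  · have hmj : m j = 0 := by simp [hm, hρj, div_self hxj]
    have h3 : ∀ c : α → Θ, (∑ i ∈ s, c i * m i) * x j = ∑ i ∈ s.erase j, c i * (m i * x j) := by
      intro c
      rw [← Finset.add_sum_erase _ _ hj, hmj, mul_zero, zero_add, Finset.sum_mul]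
      exact Finset.sum_congr rfl fun i _ => by ring
    have hcard : (s.erase j).card = N := by rw [Finset.card_erase_of_mem hj, hN]; rfl
    have hp : p ^ n ≠ 0 := pow_ne_zero _ (Fact.out : p.Prime).ne_zero
    rw [hu, hu', hτ0, map_zero, zero_pow hp, zero_add, zero_add, h3, h3]
    -- modify the family off `s`
    have h4 := ih (s.erase j) hcard κ (fun i => if i ∈ s then m i * x j else 0) (by
      intro i
      by_cases hi : i ∈ s
      · rw [if_pos hi]
        exact mul_mem (sub_mem (div_mem (hx i) (hx j)) (hρ i hi).2.1) (hx j)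
      · rw [if_neg hi]; exact zero_mem _)
    have h5 : ∀ c : α → Θ, ∑ i ∈ s.erase j, c i * (if i ∈ s then m i * x j else 0) =
        ∑ i ∈ s.erase j, c i * (m i * x j) := fun c =>
      Finset.sum_congr rfl fun i hi => by rw [if_pos (Finset.mem_of_mem_erase hi)]
    rw [h5, h5] at h4
    exact h4
  · right
    have hτΘ : algebraMap k Θ τ ≠ 0 := by simpa using hτ0
    refine ⟨τ, x j, 1 + (∑ i ∈ s, algebraMap k Θ (κ i) * m i) / algebraMap k Θ τ,
      1 + (∑ i ∈ s, algebraMap k Θ (κ i) ^ (p ^ n) * m i) / algebraMap k Θ τ ^ (p ^ n),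
      hτ0, hx j, hxj, ?_, ?_, ?_, ?_⟩
    · rw [add_sub_cancel_left, map_div₀, SUB_val_const V hk _ hτ0, div_one]
      exact hlt κ
    · rw [add_sub_cancel_left, map_div₀, map_pow, SUB_val_const V hk _ hτ0, one_pow, div_one]
      have := hlt (fun i => κ i ^ (p ^ n))
      simpa only [map_pow] using this
    · rw [hu]; field_simp
    · rw [hu']; field_simp

lemma SUB_Form_div (E1 : Subfield Θ) (V : ValuationSubring Θ) (Q : ℕ) (x x' y y' : Θ)
    (hx : SUB_Form k E1 V Q x x') (hy : SUB_Form k E1 V Q y y') :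
    SUB_Form k E1 V Q (x / y) (x' / y') := by
  obtain ⟨κ, e, w, w', hκ, he, he0, hw, hw', rfl, rfl⟩ := hx
  obtain ⟨κ2, e2, w2, w2', hκ2, he2, he20, hw2, hw2', rfl, rfl⟩ := hy
  have key : ∀ w w2 : Θ, V.valuation (w - 1) < 1 → V.valuation (w2 - 1) < 1 →
      V.valuation (w / w2 - 1) < 1 := by
    intro w w2 hw hw2
    have h1 := SUB_val_w V w2 hw2
    have h0 : w2 ≠ 0 := by rintro rfl; simp at h1
    have : w / w2 - 1 = ((w - 1) - (w2 - 1)) / w2 := by field_simp; ring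
    rw [this, map_div₀, h1, div_one]
    exact Valuation.map_sub_lt _ hw hw2
  refine ⟨κ / κ2, e / e2, w / w2, w' / w2', div_ne_zero hκ hκ2, div_mem he he2,
    div_ne_zero he0 he20, key _ _ hw hw2, key _ _ hw' hw2', ?_, ?_⟩
  · rw [map_div₀]; simp only [div_eq_mul_inv, mul_inv]; ring
  · rw [map_div₀, div_pow]; simp only [div_eq_mul_inv, mul_inv]; ring

lemma SUB_Form_val (E1 : Subfield Θ) (V : ValuationSubring Θ) (Q : ℕ)
    (hk : ∀ x : k, algebraMap k Θ x ∈ V) (x x' : Θ)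
    (hx : SUB_Form k E1 V Q x x') : V.valuation x' = V.valuation x := by
  obtain ⟨κ, e, w, w', hκ, he, he0, hw, hw', rfl, rfl⟩ := hx
  simp [SUB_val_const V hk _ hκ, SUB_val_w V _ hw, SUB_val_w V _ hw']

lemma SUB_Form_frob (p : ℕ) [Fact p.Prime] [CharP Θ p] (n : ℕ) (E1 : Subfield Θ)
    (V : ValuationSubring Θ) (hk : ∀ x : k, algebraMap k Θ x ∈ V)
    (hres : ∀ y ∈ E1, y ∈ V → ∃ ρ : k, ρ ^ (p ^ n) = ρ ∧ algebraMap k Θ ρ ∈ E1 ∧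
      V.valuation (y - algebraMap k Θ ρ) < 1) (x x' : Θ)
    (hx : SUB_Form k E1 V (p ^ n) x x') (hxV : x ∈ V) :
    V.valuation (x' - x ^ (p ^ n)) < 1 := by
  have hp : p ^ n ≠ 0 := pow_ne_zero _ (Fact.out : p.Prime).ne_zero
  obtain ⟨κ, e, w, w', hκ, he, he0, hw, hw', rfl, rfl⟩ := hx
  have heV : e ∈ V := by
    rw [← V.valuation_le_one_iff] at hxV ⊢
    simpa [SUB_val_const V hk _ hκ, SUB_val_w V _ hw] using hxV
  obtain ⟨ρ, hρ1, -, hρ2⟩ := hres e he heV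
  have heV' := (V.valuation_le_one_iff _).mpr heV
  set m := e - algebraMap k Θ ρ with hm
  have hpl : ∀ z : Θ, V.valuation z < 1 → V.valuation (z ^ (p ^ n)) < 1 := by
    intro z hz
    rw [map_pow]; exact pow_lt_one₀ (zero_le) hz hp
  have hmul : ∀ z y : Θ, V.valuation z ≤ 1 → V.valuation y < 1 → V.valuation (z * y) < 1 := by
    intro z y hz hy
    rw [map_mul]
    calc _ ≤ 1 * V.valuation y := by gcongr
      _ < 1 := by rwa [one_mul]
  have h1 : V.valuation (m - m ^ (p ^ n)) < 1 := Valuation.map_sub_lt _ hρ2 (hpl _ hρ2)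
  have h1' : m - m ^ (p ^ n) = e - e ^ (p ^ n) := by
    rw [hm, sub_pow_char_pow, ← map_pow, hρ1]; ring
  have h2 : V.valuation (e * (w' - 1)) < 1 := hmul _ _ heV' hw'
  have h3 : V.valuation (e ^ (p ^ n) * (w - 1) ^ (p ^ n)) < 1 :=
    hmul _ _ (by rw [map_pow]; exact pow_le_one' heV' _) (hpl _ hw)
  have h4 : algebraMap k Θ κ ^ (p ^ n) * e * w' - (algebraMap k Θ κ * e * w) ^ (p ^ n) =
      algebraMap k Θ κ ^ (p ^ n) * (e * (w' - 1) + (m - m ^ (p ^ n)) -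
        e ^ (p ^ n) * (w - 1) ^ (p ^ n)) := by
    rw [h1', sub_pow_char_pow, mul_pow, mul_pow, one_pow]; ring
  rw [h4]
  refine hmul _ _ ?_ (Valuation.map_sub_lt _ (Valuation.map_add_lt _ h2 h1) h3)
  rw [map_pow, SUB_val_const V hk _ hκ, one_pow]

end psi
end

section
set_option linter.style.haveILetI false
open Polynomial

section psi
open IntermediateField
open scoped TensorProduct
variable {k Θ : Type*} [Field k] [Field Θ] [Algebra k Θ]

/-- the ring of pairs `(Σ κᵢ xᵢ, Σ κᵢ^Q xᵢ)` -/
noncomputable def SUB_P (E1 : Subfield Θ) (f : k →+* Θ) : E1 ⊗[ℤ] k →+* Θ :=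
  (Algebra.TensorProduct.lift (E1.subtype.toIntAlgHom) (f.toIntAlgHom)
    (fun _ _ => Commute.all _ _)).toRingHom

lemma SUB_P_tmul (E1 : Subfield Θ) (f : k →+* Θ) (x : E1) (κ : k) :
    SUB_P E1 f (x ⊗ₜ κ) = x * f κ := by
  simp [SUB_P]

theorem SUB_psi [IsAlgClosed k] (p : ℕ) [Fact p.Prime] [CharP Θ p] (n : ℕ) (E1 : Subfield Θ)
    {ι : Type*} [Nonempty ι] (V : ι → ValuationSubring Θ)
    (hk : ∀ i, ∀ x : k, algebraMap k Θ x ∈ V i)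
    (hres : ∀ i, ∀ y ∈ E1, y ∈ V i → ∃ ρ : k, ρ ^ (p ^ n) = ρ ∧ algebraMap k Θ ρ ∈ E1 ∧
      (V i).valuation (y - algebraMap k Θ ρ) < 1) :
    ∃ ψ : adjoin k (E1 : Set Θ) ≃+* adjoin k (E1 : Set Θ),
      (∀ κ : k, ψ (algebraMap k _ κ) = algebraMap k _ κ ^ (p ^ n)) ∧
      ∀ i (x : adjoin k (E1 : Set Θ)), ((x : Θ) ∈ V i →
        (V i).valuation ((ψ x : Θ) - (x : Θ) ^ (p ^ n)) < 1) ∧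
        (V i).valuation (ψ x : Θ) = (V i).valuation (x : Θ) := by
  classical
  haveI : CharP k p := (algebraMap k Θ).charP (algebraMap k Θ).injective p
  have hp : p ^ n ≠ 0 := pow_ne_zero _ (Fact.out : p.Prime).ne_zero
  let f1 : k →+* Θ := algebraMap k Θ
  let f2 : k →+* Θ := (algebraMap k Θ).comp (iterateFrobenius k p n)
  have hf2 : ∀ κ, f2 κ = algebraMap k Θ κ ^ (p ^ n) := by
    intro κ; simp [f2, iterateFrobenius_def]
  let G : Subring (Θ × Θ) := ((SUB_P E1 f1).prod (SUB_P E1 f2)).range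
  have hform : ∀ i, ∀ g : G, (g.1 = 0) ∨ SUB_Form k E1 (V i) (p ^ n) g.1.1 g.1.2 := by
    rintro i ⟨_, z, rfl⟩
    obtain ⟨S, hS⟩ := TensorProduct.exists_finset z
    have h1 := SUB_claim p n E1 (V i) (hk i) (hres i) S (fun a => a.2) (fun a => (a.1 : Θ))
      (fun a => a.1.2)
    have e1 : SUB_P E1 f1 z = ∑ a ∈ S, algebraMap k Θ a.2 * (a.1 : Θ) := by
      rw [hS, map_sum]
      exact Finset.sum_congr rfl fun a _ => by rw [SUB_P_tmul, mul_comm]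
    have e2 : SUB_P E1 f2 z = ∑ a ∈ S, algebraMap k Θ a.2 ^ (p ^ n) * (a.1 : Θ) := by
      rw [hS, map_sum]
      exact Finset.sum_congr rfl fun a _ => by rw [SUB_P_tmul, mul_comm, hf2]
    rw [← e1, ← e2] at h1
    rcases h1 with h1 | h1
    · left; exact Prod.ext h1.1 h1.2
    · right; exact h1
  let i0 : ι := Classical.arbitrary ι
  have hne : ∀ i x x', SUB_Form k E1 (V i) (p ^ n) x x' → x ≠ 0 ∧ x' ≠ 0 := by
    rintro i x x' ⟨κ, e, w, w', hκ, he, he0, hw, hw', rfl, rfl⟩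
    have hw1 : w ≠ 0 := by rintro rfl; have := SUB_val_w _ _ hw; simp at this
    have hw2 : w' ≠ 0 := by rintro rfl; have := SUB_val_w _ _ hw'; simp at this
    have hκ' : algebraMap k Θ κ ≠ 0 := by simpa using hκ
    exact ⟨by positivity, by positivity⟩
  let p1 : G →+* Θ := (RingHom.fst Θ Θ).comp G.subtype
  let p2 : G →+* Θ := (RingHom.snd Θ Θ).comp G.subtype
  have hp1 : Function.Injective p1 := by
    rw [injective_iff_map_eq_zero]
    intro g hg
    rcases hform i0 g with h | h
    · exact Subtype.ext h
    · exact absurd hg (hne _ _ _ h).1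
  have hp2 : Function.Injective p2 := by
    rw [injective_iff_map_eq_zero]
    intro g hg
    rcases hform i0 g with h | h
    · exact Subtype.ext h
    · exact absurd hg (hne _ _ _ h).2
  haveI : IsDomain G := hp1.isDomain p1
  let N := FractionRing G
  let P1 : N →+* Θ := IsFractionRing.lift hp1
  let P2 : N →+* Θ := IsFractionRing.lift hp2
  have hP1 : ∀ g : G, P1 (algebraMap G N g) = g.1.1 := fun g => IsFractionRing.lift_algebraMap hp1 g
  have hP2 : ∀ g : G, P2 (algebraMap G N g) = g.1.2 := fun g => IsFractionRing.lift_algebraMap hp2 g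
  have hgE : ∀ g : G, g.1.1 ∈ adjoin k (E1 : Set Θ) ∧ g.1.2 ∈ adjoin k (E1 : Set Θ) := by
    rintro ⟨_, z, rfl⟩
    induction z using TensorProduct.induction_on with
    | zero => simp
    | tmul x κ =>
      have hx : (x : Θ) ∈ adjoin k (E1 : Set Θ) := subset_adjoin _ _ x.2
      constructor
      · change SUB_P E1 f1 _ ∈ _
        rw [SUB_P_tmul]
        exact mul_mem hx (IntermediateField.algebraMap_mem _ _)
      · change SUB_P E1 f2 _ ∈ _
        rw [SUB_P_tmul]
        exact mul_mem hx (IntermediateField.algebraMap_mem _ _)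
    | add x y hx hy =>
      have h1 : SUB_P E1 f1 (x + y) = SUB_P E1 f1 x + SUB_P E1 f1 y := map_add _ _ _
      have h2 : SUB_P E1 f2 (x + y) = SUB_P E1 f2 x + SUB_P E1 f2 y := map_add _ _ _
      constructor
      · change SUB_P E1 f1 (x + y) ∈ _
        rw [h1]; exact add_mem hx.1 hy.1
      · change SUB_P E1 f2 (x + y) ∈ _
        rw [h2]; exact add_mem hx.2 hy.2
  have hE1G : ∀ x ∈ E1, (x, x) ∈ G := by
    intro x hx
    refine ⟨(⟨x, hx⟩ : E1) ⊗ₜ 1, ?_⟩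
    ext
    · change SUB_P E1 f1 _ = _; rw [SUB_P_tmul]; simp
    · change SUB_P E1 f2 _ = _; rw [SUB_P_tmul]; simp
  have hkG : ∀ κ : k, (algebraMap k Θ κ, algebraMap k Θ κ ^ (p ^ n)) ∈ G := by
    intro κ
    refine ⟨1 ⊗ₜ κ, ?_⟩
    ext
    · change SUB_P E1 f1 _ = _; rw [SUB_P_tmul]; simp [f1]
    · change SUB_P E1 f2 _ = _; rw [SUB_P_tmul, hf2]; simp
  have hdivN : ∀ z : N, ∃ g h : G, h ≠ 0 ∧ z = algebraMap G N g / algebraMap G N h := by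
    intro z
    obtain ⟨g, h, hh, rfl⟩ := IsFractionRing.div_surjective (A := G) z
    exact ⟨g, h, nonZeroDivisors.ne_zero hh, rfl⟩
  have hr1 : P1.fieldRange = (adjoin k (E1 : Set Θ)).toSubfield := by
    apply le_antisymm
    · rintro _ ⟨z, rfl⟩
      obtain ⟨g, h, -, rfl⟩ := hdivN z
      rw [map_div₀, hP1, hP1]
      exact div_mem (hgE g).1 (hgE h).1
    · rw [adjoin_toSubfield, Subfield.closure_le]
      rintro _ (⟨κ, rfl⟩ | hx)
      · exact ⟨algebraMap G N ⟨_, hkG κ⟩, hP1 _⟩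
      · exact ⟨algebraMap G N ⟨_, hE1G _ hx⟩, hP1 _⟩
  have hr2 : P2.fieldRange = (adjoin k (E1 : Set Θ)).toSubfield := by
    apply le_antisymm
    · rintro _ ⟨z, rfl⟩
      obtain ⟨g, h, -, rfl⟩ := hdivN z
      rw [map_div₀, hP2, hP2]
      exact div_mem (hgE g).2 (hgE h).2
    · rw [adjoin_toSubfield, Subfield.closure_le]
      rintro _ (⟨κ, rfl⟩ | hx)
      · obtain ⟨z, hz⟩ := IsAlgClosed.exists_pow_nat_eq κ (Nat.pos_of_ne_zero hp)
        refine ⟨algebraMap G N ⟨_, hkG z⟩, ?_⟩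
        rw [hP2, ← hz, map_pow]
      · exact ⟨algebraMap G N ⟨_, hE1G _ hx⟩, hP2 _⟩
  have hmem1 : ∀ z, P1 z ∈ adjoin k (E1 : Set Θ) := by
    intro z
    have : P1 z ∈ P1.fieldRange := ⟨z, rfl⟩
    rw [hr1] at this; exact this
  have hmem2 : ∀ z, P2 z ∈ adjoin k (E1 : Set Θ) := by
    intro z
    have : P2 z ∈ P2.fieldRange := ⟨z, rfl⟩
    rw [hr2] at this; exact this
  let q1 : N ≃+* adjoin k (E1 : Set Θ) := RingEquiv.ofBijective
    (P1.codRestrict (adjoin k (E1 : Set Θ)) hmem1) ⟨fun a b h => P1.injective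
      (congrArg Subtype.val h), fun y => by
        have : (y : Θ) ∈ P1.fieldRange := by rw [hr1]; exact y.2
        obtain ⟨z, hz⟩ := this
        exact ⟨z, Subtype.ext hz⟩⟩
  let q2 : N ≃+* adjoin k (E1 : Set Θ) := RingEquiv.ofBijective
    (P2.codRestrict (adjoin k (E1 : Set Θ)) hmem2) ⟨fun a b h => P2.injective
      (congrArg Subtype.val h), fun y => by
        have : (y : Θ) ∈ P2.fieldRange := by rw [hr2]; exact y.2
        obtain ⟨z, hz⟩ := this
        exact ⟨z, Subtype.ext hz⟩⟩
  have hq1 : ∀ z, (q1 z : Θ) = P1 z := fun z => rfl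
  have hq2 : ∀ z, (q2 z : Θ) = P2 z := fun z => rfl
  refine ⟨q1.symm.trans q2, ?_, ?_⟩
  · intro κ
    have h1 : q1.symm (algebraMap k _ κ) = algebraMap G N ⟨_, hkG κ⟩ := by
      rw [RingEquiv.symm_apply_eq]
      apply Subtype.ext
      rw [hq1, hP1]; rfl
    rw [RingEquiv.trans_apply, h1]
    apply Subtype.ext
    rw [hq2, hP2]; rfl
  · intro i x
    obtain ⟨z, rfl⟩ := q1.surjective x
    rw [RingEquiv.trans_apply, RingEquiv.symm_apply_apply, hq1, hq2]
    obtain ⟨g, h, hh, rfl⟩ := hdivN z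
    have hh0 : h.1 ≠ 0 := fun h0 => hh (Subtype.ext h0)
    rw [map_div₀, map_div₀, hP1, hP1, hP2, hP2]
    rcases hform i g with h0 | hg
    · rw [h0]; simp [zero_pow (show p ^ n ≠ 0 from hp)]
    · have hF := SUB_Form_div E1 (V i) (p ^ n) _ _ _ _ hg ((hform i h).resolve_left hh0)
      exact ⟨SUB_Form_frob p n E1 (V i) (hk i) (hres i) _ _ hF, SUB_Form_val E1 (V i) _ (hk i) _ _ hF⟩

end psi
end

section
set_option linter.style.haveILetI false
open Polynomial

section ambient
open scoped TensorProduct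

theorem SUB_ambient_core (Ω k T : Type) [Field Ω] [Field k] [CommRing T]
    (O : ValuationSubring Ω) (iO : O →+* T) (ik : k →+* T) (𝔓 : Ideal T) [h𝔓p : 𝔓.IsPrime]
    (hnzd : ∀ c : O, c ≠ 0 → iO c ∈ nonZeroDivisors T)
    (h𝔓 : ∀ c ∈ IsLocalRing.maximalIdeal O, iO c ∈ 𝔓) :
    ∃ (Θ : Type) (_ : Field Θ) (_ : IsAlgClosed Θ) (f : T →+* Θ) (jΩ : Ω →+* Θ)
      (W : ValuationSubring Θ), (∀ c : O, jΩ c = f (iO c)) ∧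
      (∀ κ, f (ik κ) ∈ W) ∧ ∀ x, jΩ x ∈ W ↔ x ∈ O := by
  classical
  obtain ⟨𝔭, h𝔭, hle⟩ := Ideal.exists_minimalPrimes_le (I := (⊥ : Ideal T)) (J := 𝔓) bot_le
  have h𝔭' : 𝔭 ∈ minimalPrimes T := h𝔭
  haveI : 𝔭.IsPrime := h𝔭.1.1
  let D := T ⧸ 𝔭
  let Θ := AlgebraicClosure (FractionRing D)
  let f : T →+* Θ := ((algebraMap (FractionRing D) Θ).comp (algebraMap D (FractionRing D))).comp
    (Ideal.Quotient.mk 𝔭)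
  have hker : ∀ x, f x = 0 ↔ x ∈ 𝔭 := by
    intro x
    rw [← Ideal.Quotient.eq_zero_iff_mem]
    change algebraMap (FractionRing D) Θ (algebraMap D (FractionRing D) _) = 0 ↔ _
    rw [map_eq_zero, IsFractionRing.to_map_eq_zero_iff]
  let fO : O →+* Θ := f.comp iO
  have hfO : Function.Injective fO := by
    rw [injective_iff_map_eq_zero]
    intro c hc
    by_contra hc0
    have h1 : iO c ∈ 𝔭 := (hker _).mp hc
    refine Set.disjoint_left.mp (Ideal.disjoint_nonZeroDivisors_of_mem_minimalPrimes h𝔭') h1 ?_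
    exact hnzd c hc0
  let jΩ : Ω →+* Θ := IsFractionRing.lift hfO
  have hjΩ : ∀ c : O, jΩ (c : Ω) = fO c := fun c => IsFractionRing.lift_algebraMap hfO c
  let I : Ideal f.range := 𝔓.map f.rangeRestrict
  have hI : I ≠ ⊤ := by
    intro h
    have h1 := Ideal.comap_map_of_surjective f.rangeRestrict f.rangeRestrict_surjective 𝔓
    change Ideal.comap _ I = _ at h1
    rw [h, Ideal.comap_top] at h1
    have h2 : 𝔓 ⊔ Ideal.comap f.rangeRestrict ⊥ ≤ 𝔓 := by
      refine sup_le le_rfl fun x hx => hle ?_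
      rw [← hker]
      exact congrArg Subtype.val hx
    rw [← h1] at h2
    exact h𝔓p.ne_top (top_le_iff.mp h2)
  obtain ⟨W, hW1, hW2⟩ := Ideal.image_subset_nonunits_valuationSubring I hI
  refine ⟨Θ, inferInstance, inferInstance, f, jΩ, W, hjΩ, ?_, ?_⟩
  · intro κ
    exact hW1 ⟨_, rfl⟩
  · intro x
    constructor
    · intro hx
      by_contra hxO
      have hx0 : x ≠ 0 := by rintro rfl; exact hxO O.zero_mem
      have hinv : x⁻¹ ∈ O := (O.mem_or_inv_mem x).resolve_left hxO
      let c : O := ⟨x⁻¹, hinv⟩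
      have hc : c ∈ IsLocalRing.maximalIdeal O := by
        rw [IsLocalRing.mem_maximalIdeal, mem_nonunits_iff]
        intro hu
        obtain ⟨u, hu⟩ := hu
        have h1 : (c : Ω) * ((u⁻¹ : Oˣ) : O) = 1 := by
          rw [← hu, ← O.coe_mul, Units.mul_inv]; rfl
        have h2 : x = ((u⁻¹ : Oˣ) : O) := by
          change x⁻¹ * _ = 1 at h1
          field_simp at h1
          exact h1.symm
        exact hxO (h2 ▸ ((u⁻¹ : Oˣ) : O).2)
      have hc2 : iO c ∈ 𝔓 := h𝔓 c hc
      have h4 : fO c ∈ W.nonunits := hW2 ⟨f.rangeRestrict (iO c), Ideal.mem_map_of_mem _ hc2, rfl⟩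
      rw [← hjΩ] at h4
      change jΩ x⁻¹ ∈ _ at h4
      rw [W.mem_nonunits_iff, map_inv₀, map_inv₀] at h4
      rw [← W.valuation_le_one_iff] at hx
      have h5 : W.valuation (jΩ x) ≠ 0 := by simpa using hx0
      have h6 := (inv_lt_one₀ (zero_lt_iff.mpr h5)).mp h4
      exact absurd hx (not_le.mpr h6)
    · intro hx
      have := hjΩ ⟨x, hx⟩
      change jΩ x = _ at this
      rw [this]
      exact hW1 ⟨_, rfl⟩

theorem SUB_ambient (F Ω k : Type) [Field F] [Field Ω] [Field k] [Algebra F Ω] [Algebra F k]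
    (O : ValuationSubring Ω) (hF : ∀ x : F, algebraMap F Ω x ∈ O) :
    ∃ (Θ : Type) (_ : Field Θ) (_ : IsAlgClosed Θ) (jΩ : Ω →+* Θ) (jk : k →+* Θ)
      (W : ValuationSubring Θ), (∀ x : F, jΩ (algebraMap F Ω x) = jk (algebraMap F k x)) ∧
      (∀ κ, jk κ ∈ W) ∧ ∀ x, jΩ x ∈ W ↔ x ∈ O := by
  classical
  letI : Algebra F O := (RingHom.codRestrict (algebraMap F Ω) O.toSubring hF).toAlgebra
  let κO := IsLocalRing.ResidueField O
  let T := O ⊗[F] k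
  let g : T →ₐ[F] (κO ⊗[F] k) := Algebra.TensorProduct.map
    (IsScalarTower.toAlgHom F O κO) (AlgHom.id F k)
  haveI : Nontrivial (κO ⊗[F] k) := inferInstance
  obtain ⟨𝔐, h𝔐⟩ := Ideal.exists_maximal (κO ⊗[F] k)
  haveI := h𝔐.isPrime
  let 𝔓 : Ideal T := 𝔐.comap g
  haveI : 𝔓.IsPrime := Ideal.comap_isPrime g 𝔐
  obtain ⟨Θ, i1, i2, f, jΩ, W, hf, hk, hW⟩ := SUB_ambient_core Ω k T O
    (Algebra.TensorProduct.includeLeftRingHom)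
    (Algebra.TensorProduct.includeRight : k →ₐ[F] T).toRingHom 𝔓 (by
      intro c hc0
      rw [mem_nonZeroDivisors_iff_right]
      intro x hx
      have h2 : c • x = 0 := by
        rw [Algebra.smul_def, mul_comm]; exact hx
      exact (smul_eq_zero.mp h2).resolve_left hc0) (by
      intro c hc
      change g _ ∈ 𝔐
      have h3 : g (c ⊗ₜ 1) = 0 := by
        change (algebraMap O κO c) ⊗ₜ (1 : k) = 0
        have : algebraMap O κO c = 0 := (IsLocalRing.residue_eq_zero_iff c).mpr hc
        rw [this, TensorProduct.zero_tmul]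
      change g (c ⊗ₜ 1) ∈ _
      rw [h3]; exact zero_mem _)
  refine ⟨Θ, i1, i2, jΩ, f.comp (Algebra.TensorProduct.includeRight : k →ₐ[F] T).toRingHom, W,
    ?_, hk, hW⟩
  intro x
  have h1 : jΩ (algebraMap F Ω x) = _ := hf (algebraMap F O x)
  rw [h1]
  change f (algebraMap F O x ⊗ₜ 1) = f (1 ⊗ₜ algebraMap F k x)
  rw [Algebra.algebraMap_eq_smul_one, Algebra.algebraMap_eq_smul_one, TensorProduct.smul_tmul]

end ambient
end

section
set_option linter.style.haveILetI false
open Polynomial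

lemma SUB_na_sub {Ω : Type*} [Field Ω] (v : AbsoluteValue Ω ℝ) (hna : IsNonarchimedean v)
    (x y : Ω) : v (x - y) ≤ max (v x) (v y) := by
  rw [sub_eq_add_neg]
  have := hna x (-y)
  rwa [v.map_neg] at this

lemma SUB_na_eq {Ω : Type*} [Field Ω] (v : AbsoluteValue Ω ℝ) (hna : IsNonarchimedean v)
    (x y : Ω) (h : v y < v x) : v (x - y) = v x := by
  apply le_antisymm
  · exact (SUB_na_sub v hna x y).trans (by rw [max_eq_left h.le])
  · have h1 := hna (x - y) y
    rw [sub_add_cancel] at h1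
    rcases le_max_iff.mp h1 with h2 | h2
    · exact h2
    · exact absurd h2 (not_le.mpr h)

lemma SUB_na_eq2 {Ω : Type*} [Field Ω] (v : AbsoluteValue Ω ℝ) (hna : IsNonarchimedean v)
    (x y z : Ω) (h : v (x - y) < v (y - z)) : v (x - z) = v (y - z) := by
  have h1 : x - z = (y - z) - (y - x) := by ring
  rw [h1]
  apply SUB_na_eq v hna
  rwa [v.map_sub y x]

/-- Escape: points where a size function strictly grows are not preperiodic. -/
lemma SUB_escape {L : Type*} [Field L] (A B : L[X]) {Γ : Type*} [LinearOrder Γ] (φ : L → Γ)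
    (bad : L → Prop)
    (hstep : ∀ w, bad w → B.eval w ≠ 0 ∧ bad (A.eval w / B.eval w) ∧ φ w < φ (A.eval w / B.eval w))
    (z : Option L) (hz : IsPreperiodic (ratP1Map A B) z) (n : ℕ) (w : L)
    (hw : (ratP1Map A B)^[n] z = some w) : ¬ bad w := by
  intro hb
  let g : L → L := fun w => A.eval w / B.eval w
  have hg : ∀ m, bad (g^[m] w) ∧ (ratP1Map A B)^[n + m] z = some (g^[m] w) := by
    intro m
    induction m with
    | zero => exact ⟨hb, by simpa using hw⟩
    | succ m ih =>
      rw [Function.iterate_succ_apply']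
      refine ⟨(hstep _ ih.1).2.1, ?_⟩
      rw [← add_assoc, Function.iterate_succ_apply', ih.2]
      simp [ratP1Map, (hstep _ ih.1).1, g]
  have hmono : StrictMono (fun m => φ (g^[m] w)) := by
    apply strictMono_nat_of_lt_succ
    intro m
    show φ (g^[m] w) < φ (g^[m+1] w)
    rw [Function.iterate_succ_apply']
    exact (hstep _ (hg m).1).2.2
  have hinj : Function.Injective (fun m => g^[m] w) := by
    intro m m' h
    apply hmono.injective
    show φ _ = φ _
    simp only at h
    rw [h]
  have hinf : (Set.range fun m => some (g^[m] w)).Infinite := by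
    apply Set.infinite_range_of_injective
    intro m m' h
    exact hinj (Option.some_injective _ h)
  apply hinf
  apply Set.Finite.subset hz
  rintro _ ⟨m, rfl⟩
  exact ⟨n + m, (hg m).2⟩

structure SUB_Dyn {Ω : Type*} [Field Ω] (v : AbsoluteValue Ω ℝ) (A B : Polynomial Ω) (R : ℝ) (r : Ω → ℝ) :
    Prop where
  hna : IsNonarchimedean v
  hA : A.Monic
  hB : B.Monic
  cop : IsCoprime A B
  deg : B.natDegree + 1 < A.natDegree
  sep : A.Separable
  hRmax : ∀ x, A.IsRoot x → v x ≤ R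
  h1 : 1 < R
  h2 : ∀ x, B.IsRoot x → v x ≤ R
  h4 : ∀ x, A.IsRoot x → 0 < r x ∧ (∀ y, v (y - x) ≤ r x → B.eval y ≠ 0) ∧
      ((fun y => A.eval y / B.eval y) '' {y | v (y - x) ≤ r x} = {w | v w ≤ R})
  h5 : ∀ x x', A.IsRoot x → A.IsRoot x' → x ≠ x' → ∀ y, ¬ (v (y - x) ≤ r x ∧ v (y - x') ≤ r x')

section dyn
set_option linter.unusedSectionVars false
open scoped Classical
variable {Ω : Type*} [Field Ω] [IsAlgClosed Ω] {v : AbsoluteValue Ω ℝ} {A B : Polynomial Ω} {R : ℝ}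
  {r : Ω → ℝ}

lemma SUB_Dyn.dist (H : SUB_Dyn v A B R r) {α α' : Ω} (hα : A.IsRoot α) (hα' : A.IsRoot α')
    (hne : α ≠ α') : r α < v (α - α') := by
  by_contra h
  push Not at h
  refine H.h5 α α' hα hα' hne α' ⟨by rwa [v.map_sub], ?_⟩
  simp [(H.h4 α' hα').1.le]

lemma SUB_Dyn.pole (H : SUB_Dyn v A B R r) {α β : Ω} (hα : A.IsRoot α) (hβ : B.IsRoot β) :
    r α < v (α - β) := by
  by_contra h
  push Not at h
  exact (H.h4 α hα).2.1 β (by rwa [v.map_sub]) hβ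

lemma SUB_val_monic_split (v : AbsoluteValue Ω ℝ) (B : Polynomial Ω) (hB : B.Monic) (x : Ω) :
    v (B.eval x) = (B.roots.map (fun β => v (x - β))).prod := by
  have h := (IsAlgClosed.splits B).eq_prod_roots_of_monic hB
  conv_lhs => rw [h]
  rw [eval_multiset_prod, map_multiset_prod, Multiset.map_map, Multiset.map_map]
  simp [Function.comp_def]

lemma SUB_Dyn.vB (H : SUB_Dyn v A B R r) {α x : Ω} (hα : A.IsRoot α) (hx : v (x - α) ≤ r α) :
    v (B.eval x) = v (B.eval α) := by
  rw [SUB_val_monic_split v B H.hB, SUB_val_monic_split v B H.hB]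
  congr 1
  apply Multiset.map_congr rfl
  intro β hβ
  apply SUB_na_eq2 v H.hna
  exact hx.trans_lt (H.pole hα (isRoot_of_mem_roots hβ))

lemma SUB_Dyn.Bne (H : SUB_Dyn v A B R r) {α x : Ω} (hα : A.IsRoot α) (hx : v (x - α) ≤ r α) :
    B.eval x ≠ 0 := (H.h4 α hα).2.1 x hx

lemma SUB_Dyn.rpos (H : SUB_Dyn v A B R r) {α : Ω} (hα : A.IsRoot α) : v (α - α) ≤ r α := by
  simp [(H.h4 α hα).1.le]

lemma SUB_Dyn.card (H : SUB_Dyn v A B R r) : A.roots.toFinset.card = A.natDegree := by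
  rw [Multiset.toFinset_card_of_nodup (nodup_roots H.sep)]
  exact (IsAlgClosed.card_roots_eq_natDegree (p := A))

lemma SUB_Dyn.memZ (H : SUB_Dyn v A B R r) {α : Ω} : α ∈ A.roots.toFinset ↔ A.IsRoot α := by
  rw [Multiset.mem_toFinset, mem_roots H.hA.ne_zero]

/-- factorisation of `A - y0 B`. -/
lemma SUB_Dyn.fact (H : SUB_Dyn v A B R r) (y0 : Ω) (xs : Ω → Ω)
    (hxs : ∀ α, A.IsRoot α → v (xs α - α) ≤ r α ∧ A.eval (xs α) = y0 * B.eval (xs α)) :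
    A - C y0 * B = ∏ α ∈ A.roots.toFinset, (X - C (xs α)) := by
  have hd : (C y0 * B).degree < A.degree := by
    rw [← smul_eq_C_mul]
    refine (degree_smul_le y0 B).trans_lt ?_
    rw [degree_eq_natDegree H.hB.ne_zero, degree_eq_natDegree H.hA.ne_zero]
    have := H.deg
    exact_mod_cast (by omega)
  have hm : (A - C y0 * B).Monic := H.hA.sub_of_left hd
  have hdeg : (A - C y0 * B).degree = A.natDegree := by
    rw [degree_sub_eq_left_of_degree_lt hd, degree_eq_natDegree H.hA.ne_zero]
  have hpd : (∏ α ∈ A.roots.toFinset, (X - C (xs α))).degree = (A.natDegree : WithBot ℕ) := by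
    rw [degree_prod]; simp [H.card]
  have hinj : Set.InjOn xs (A.roots.toFinset : Set Ω) := by
    intro α hα α' hα' h
    by_contra hne
    have hα := H.memZ.mp hα
    have hα' := H.memZ.mp hα'
    exact H.h5 α α' hα hα' hne (xs α) ⟨(hxs α hα).1, h ▸ (hxs α' hα').1⟩
  apply eq_of_degree_sub_lt_of_eval_index_eq A.roots.toFinset hinj
  · rw [H.card, ← hdeg]
    apply degree_sub_lt_left
    · rw [hdeg, hpd]
    · exact hm.ne_zero
    · rw [hm.leadingCoeff, (monic_prod_X_sub_C _ _).leadingCoeff]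
  · intro α hα
    rw [eval_prod, Finset.prod_eq_zero hα (by simp)]
    simp [(hxs α (H.memZ.mp hα)).2]

lemma SUB_Dyn.exists_xs (H : SUB_Dyn v A B R r) (y0 : Ω) (hy : v y0 ≤ R) :
    ∃ xs : Ω → Ω, ∀ α, A.IsRoot α → v (xs α - α) ≤ r α ∧ A.eval (xs α) = y0 * B.eval (xs α) := by
  have : ∀ α, ∃ x, A.IsRoot α → v (x - α) ≤ r α ∧ A.eval x = y0 * B.eval x := by
    intro α
    by_cases hα : A.IsRoot α
    · have h := (H.h4 α hα).2.2
      have hm : y0 ∈ {w | v w ≤ R} := hy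
      rw [← h] at hm
      obtain ⟨x, hx, hxy⟩ := hm
      refine ⟨x, fun _ => ⟨hx, ?_⟩⟩
      rw [← hxy]
      simp only
      rw [div_mul_cancel₀ _ (H.Bne hα hx)]
    · exact ⟨0, fun h => absurd h hα⟩
  choose xs hxs using this
  exact ⟨xs, hxs⟩

lemma SUB_Dyn.in_disc (H : SUB_Dyn v A B R r) (z : Ω) (hB : B.eval z ≠ 0)
    (hz : v (A.eval z / B.eval z) ≤ R) : ∃ α, A.IsRoot α ∧ v (z - α) ≤ r α := by
  obtain ⟨xs, hxs⟩ := H.exists_xs _ hz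
  have h := congrArg (eval z) (H.fact _ xs hxs)
  simp only [eval_sub, eval_mul, eval_C, div_mul_cancel₀ _ hB, sub_self, eval_prod, eval_X] at h
  obtain ⟨α, hα, h0⟩ := Finset.prod_eq_zero_iff.mp h.symm
  rw [sub_eq_zero] at h0
  have hα := H.memZ.mp hα
  exact ⟨α, hα, h0 ▸ (hxs α hα).1⟩

lemma SUB_Dyn.expand (H : SUB_Dyn v A B R r) {α x y : Ω} (hα : A.IsRoot α)
    (hx : v (x - α) ≤ r α) (hy : v (y - α) ≤ r α) :
    v (A.eval x / B.eval x - A.eval y / B.eval y) =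
      v (A.derivative.eval α) / v (B.eval α) * v (x - y) := by
  have hyR : v (A.eval y / B.eval y) ≤ R := by
    have h := (H.h4 α hα).2.2
    have : A.eval y / B.eval y ∈ (fun y => A.eval y / B.eval y) '' {y | v (y - α) ≤ r α} :=
      ⟨y, hy, rfl⟩
    rw [h] at this
    exact this
  obtain ⟨xs, hxs⟩ := H.exists_xs _ hyR
  have hxs' : ∀ α', A.IsRoot α' → v (Function.update xs α y α' - α') ≤ r α' ∧
      A.eval (Function.update xs α y α') = A.eval y / B.eval y * B.eval (Function.update xs α y α') := by
    intro α' hα'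
    by_cases h : α' = α
    · subst h
      simp [hy, div_mul_cancel₀ _ (H.Bne hα hy)]
    · rw [Function.update_of_ne h]
      exact hxs α' hα'
  have h1 := congrArg (eval x) (H.fact _ _ hxs')
  have h2 := H.fact 0 id (fun α' hα' => ⟨by simpa using (H.h4 α' hα').1.le, by simpa using hα'⟩)
  rw [C_0, zero_mul, sub_zero] at h2
  have hmem := H.memZ.mpr hα
  have h3 : A.derivative.eval α = ∏ β ∈ A.roots.toFinset.erase α, (α - β) := by
    conv_lhs => rw [h2]
    rw [← Finset.mul_prod_erase _ _ hmem, derivative_mul]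
    simp [eval_prod]
  rw [← Finset.mul_prod_erase _ _ hmem] at h1
  simp only [eval_sub, eval_mul, eval_C, eval_X, eval_prod, Function.update_self] at h1
  have h4 : ∏ β ∈ A.roots.toFinset.erase α, v (x - Function.update xs α y β) =
      ∏ β ∈ A.roots.toFinset.erase α, v (α - β) := by
    apply Finset.prod_congr rfl
    intro β hβ
    have hβ1 := Finset.ne_of_mem_erase hβ
    have hβ2 := H.memZ.mp (Finset.mem_of_mem_erase hβ)
    rw [Function.update_of_ne hβ1]
    have e1 : v (x - β) = v (α - β) :=
      SUB_na_eq2 v H.hna _ _ _ (hx.trans_lt (H.dist hα hβ2 hβ1.symm))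
    rw [v.map_sub x, ← e1, v.map_sub x]
    apply SUB_na_eq2 v H.hna
    rw [v.map_sub β x, e1, v.map_sub α β]
    exact (hxs β hβ2).1.trans_lt (H.dist hβ2 hα hβ1)
  have h5 : v (A.eval x - A.eval y / B.eval y * B.eval x) = v (x - y) * v (A.derivative.eval α) := by
    rw [h1, h3, map_mul, map_prod, map_prod, h4]
  have hBx := H.Bne hα hx
  have h6 : A.eval x / B.eval x - A.eval y / B.eval y =
      (A.eval x - A.eval y / B.eval y * B.eval x) / B.eval x := by
    field_simp
  rw [h6, map_div₀, h5, H.vB hα hx]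
  ring

lemma SUB_Dyn.ratpos (H : SUB_Dyn v A B R r) {α : Ω} (hα : A.IsRoot α) :
    0 < v (A.derivative.eval α) / v (B.eval α) := by
  apply div_pos
  · apply v.pos
    have := H.sep
    intro h0
    obtain ⟨u, w, huw⟩ := this
    have := congrArg (eval α) huw
    simp [h0, hα.eq_zero] at this
  · exact v.pos (H.Bne hα (H.rpos hα))

lemma SUB_Dyn.radius (H : SUB_Dyn v A B R r) {α x : Ω} (hα : A.IsRoot α) (α0 : Ω)
    (h0 : v α0 = R) :
    v (x - α) ≤ r α ↔ v ((x - α) * A.derivative.eval α / (α0 * B.eval α)) ≤ 1 := by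
  have hc := H.ratpos hα
  have hR : 0 < R := by linarith [H.h1]
  have e : v ((x - α) * A.derivative.eval α / (α0 * B.eval α)) =
      v (A.derivative.eval α) / v (B.eval α) * v (x - α) / R := by
    rw [map_div₀, map_mul, map_mul, h0]
    have := v.pos (H.Bne hα (H.rpos hα))
    field_simp
  rw [e, div_le_one hR]
  constructor
  · intro hx
    have h := (H.h4 α hα).2.2
    have h1 : A.eval x / B.eval x ∈ (fun y => A.eval y / B.eval y) '' {y | v (y - α) ≤ r α} :=
      ⟨x, hx, rfl⟩
    rw [h] at h1
    have h2 := H.expand hα hx (H.rpos hα)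
    rw [hα.eq_zero] at h2
    simp only [zero_div, sub_zero] at h2
    rw [← h2]
    exact h1
  · intro hx
    have h := (H.h4 α hα).2.2
    have h1 : α0 ∈ {w | v w ≤ R} := h0.le
    rw [← h] at h1
    obtain ⟨y, hy, hy0⟩ := h1
    have h2 := H.expand hα hy (H.rpos hα)
    rw [hα.eq_zero] at h2
    simp only [zero_div, sub_zero] at h2 hy0
    rw [hy0, h0] at h2
    rw [h2] at hx
    exact (le_of_mul_le_mul_left hx hc).trans hy

lemma SUB_Dyn.ratgt (H : SUB_Dyn v A B R r) {α : Ω} (hα : A.IsRoot α) (α0 : Ω) (h0 : v α0 = R) :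
    1 < v (A.derivative.eval α) / v (B.eval α) := by
  by_contra hc
  push Not at hc
  have hpos := H.ratpos hα
  have hR : 0 < R := by linarith [H.h1]
  have : ∃ α' ∈ A.roots.toFinset, α' ≠ α := by
    apply Finset.exists_mem_ne
    rw [H.card]
    have := H.deg
    omega
  obtain ⟨α', hα', hne⟩ := this
  have hα' := H.memZ.mp hα'
  have h1 := H.dist hα hα' hne.symm
  apply absurd h1 (not_lt.mpr _)
  rw [v.map_sub, H.radius hα α0 h0]
  have e : v ((α' - α) * A.derivative.eval α / (α0 * B.eval α)) =
      v (A.derivative.eval α) / v (B.eval α) * v (α' - α) / R := by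
    rw [map_div₀, map_mul, map_mul, h0]
    have := v.pos (H.Bne hα (H.rpos hα))
    field_simp
  rw [e, div_le_one hR]
  have h2 : v (α' - α) ≤ R :=
    (SUB_na_sub v H.hna _ _).trans (max_le (H.hRmax _ hα') (H.hRmax _ hα))
  calc _ ≤ 1 * v (α' - α) := mul_le_mul_of_nonneg_right hc (v.nonneg _)
    _ ≤ R := by rwa [one_mul]

lemma SUB_Dyn.big (H : SUB_Dyn v A B R r) (w : Ω) (hw : R < v w) :
    B.eval w ≠ 0 ∧ v w < v (A.eval w / B.eval w) := by
  have hR := H.h1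
  have key : ∀ P : Polynomial Ω, P.Monic → (∀ x, P.IsRoot x → v x ≤ R) → v (P.eval w) = v w ^ P.natDegree := by
    intro P hP hr
    rw [SUB_val_monic_split v P hP, ← IsAlgClosed.card_roots_eq_natDegree (p := P), ← Multiset.prod_replicate,
      ← Multiset.map_const']
    congr 1
    apply Multiset.map_congr rfl
    intro β hβ
    exact SUB_na_eq v H.hna _ _ ((hr β (isRoot_of_mem_roots hβ)).trans_lt hw)
  have hA := key A H.hA H.hRmax
  have hB := key B H.hB H.h2
  have hw1 : 1 < v w := hR.trans hw
  have hBne : B.eval w ≠ 0 := by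
    rw [← v.pos_iff, hB]; positivity
  refine ⟨hBne, ?_⟩
  rw [map_div₀, hA, hB, lt_div_iff₀ (by positivity), ← pow_succ']
  exact pow_lt_pow_right₀ hw1 H.deg

lemma SUB_Dyn.good (H : SUB_Dyn v A B R r) (z : Option Ω) (hz : IsPreperiodic (ratP1Map A B) z)
    (n : ℕ) (w : Ω) (hw : (ratP1Map A B)^[n] z = some w) : v w ≤ R := by
  have := SUB_escape A B v (fun w => R < v w)
    (fun w hw => ⟨(H.big w hw).1, hw.trans (H.big w hw).2, (H.big w hw).2⟩) z hz n w hw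
  simpa using this

end dyn
end

section
set_option linter.style.haveILetI false
open Polynomial

/-- Two distinct points are separated at first sight. -/
def SUB_Sep {Ω : Type*} [Field Ω] (v : AbsoluteValue Ω ℝ) (A B : Polynomial Ω) (α0 x y : Ω) : Prop :=
  x ≠ y ∧ (B.eval x = 0 ∨ B.eval y = 0 ∨ ∃ α, A.IsRoot α ∧
    v ((x - α) * A.derivative.eval α / (α0 * B.eval α)) ≤ 1 ∧
    1 < v ((y - α) * A.derivative.eval α / (α0 * B.eval α)))

/-- All finite iterates lie in the big disc. -/
def SUB_Good {Ω : Type*} [Field Ω] (v : AbsoluteValue Ω ℝ) (A B : Polynomial Ω) (R : ℝ)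
    (z : Option Ω) : Prop :=
  ∀ n w, (ratP1Map A B)^[n] z = some w → v w ≤ R

open scoped Classical in
/-- The label of a point. -/
noncomputable def SUB_lab {Ω : Type*} [Field Ω] (v : AbsoluteValue Ω ℝ) (A B : Polynomial Ω)
    (r : Ω → ℝ) : Option Ω → Option Ω
  | none => none
  | some x => if B.eval x = 0 then some x else
      if h : ∃ α, A.IsRoot α ∧ v (x - α) ≤ r α then some h.choose else none

section dyn
set_option linter.unusedSectionVars false
open scoped Classical
variable {Ω : Type*} [Field Ω] [IsAlgClosed Ω] {v : AbsoluteValue Ω ℝ} {A B : Polynomial Ω} {R : ℝ}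
  {r : Ω → ℝ}

lemma SUB_rat_some {A B : Polynomial Ω} {x : Ω} (h : B.eval x ≠ 0) :
    ratP1Map A B (some x) = some (A.eval x / B.eval x) := by
  simp [ratP1Map, h]

lemma SUB_Good.next {x : Option Ω} (h : SUB_Good v A B R x) :
    SUB_Good v A B R (ratP1Map A B x) := by
  intro n w hw
  exact h (n + 1) w hw

lemma SUB_Good.here {x : Ω} (h : SUB_Good v A B R (some x)) : v x ≤ R := h 0 x rfl

lemma SUB_Dyn.in_disc' (H : SUB_Dyn v A B R r) {x : Ω} (h : SUB_Good v A B R (some x))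
    (hB : B.eval x ≠ 0) : ∃ α, A.IsRoot α ∧ v (x - α) ≤ r α := by
  apply H.in_disc x hB
  have := h.next
  rw [SUB_rat_some hB] at this
  exact this.here

lemma SUB_Dyn.minC (H : SUB_Dyn v A B R r) (α0 : Ω) (h0 : v α0 = R) :
    ∃ c : ℝ, 1 < c ∧ ∀ α, A.IsRoot α → c ≤ v (A.derivative.eval α) / v (B.eval α) := by
  have hne : A.roots.toFinset.Nonempty := by
    rw [← Finset.card_pos, H.card]
    have := H.deg
    omega
  obtain ⟨α1, h1, h2⟩ := Finset.exists_min_image A.roots.toFinset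
    (fun α => v (A.derivative.eval α) / v (B.eval α)) hne
  exact ⟨_, H.ratgt (H.memZ.mp h1) α0 h0, fun α hα => h2 α (H.memZ.mpr hα)⟩

lemma SUB_Dyn.sep_step (H : SUB_Dyn v A B R r) (α0 : Ω) (h0 : v α0 = R) (c : ℝ) (hc : 1 < c)
    (hcα : ∀ α, A.IsRoot α → c ≤ v (A.derivative.eval α) / v (B.eval α)) (n : ℕ) :
    ∀ x y, SUB_Good v A B R (some x) → SUB_Good v A B R (some y) → R / c ^ n < v (x - y) →
    ∃ m < n, ∃ x' y', (ratP1Map A B)^[m] (some x) = some x' ∧ (ratP1Map A B)^[m] (some y) = some y' ∧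
      SUB_Sep v A B α0 x' y' := by
  have hR : 0 < R := by linarith [H.h1]
  induction n with
  | zero =>
    intro x y hx hy h
    simp only [pow_zero, div_one] at h
    exact absurd h (not_lt.mpr ((SUB_na_sub v H.hna x y).trans (max_le hx.here hy.here)))
  | succ n ih =>
    intro x y hx hy h
    by_cases hs : SUB_Sep v A B α0 x y
    · exact ⟨0, Nat.succ_pos _, x, y, rfl, rfl, hs⟩
    · have hne : x ≠ y := by
        rintro rfl
        rw [sub_self, map_zero] at h
        have : 0 < R / c ^ (n+1) := by positivity
        linarith
      have hBx : B.eval x ≠ 0 := fun hb => hs ⟨hne, Or.inl hb⟩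
      have hBy : B.eval y ≠ 0 := fun hb => hs ⟨hne, Or.inr (Or.inl hb)⟩
      obtain ⟨α, hα, hxα⟩ := H.in_disc' hx hBx
      have hyα : v (y - α) ≤ r α := by
        by_contra hy'
        rw [H.radius hα α0 h0] at hy' hxα
        exact hs ⟨hne, Or.inr (Or.inr ⟨α, hα, hxα, not_le.mp hy'⟩)⟩
      have e := H.expand hα hxα hyα
      have h1 : R / c ^ n < v (A.eval x / B.eval x - A.eval y / B.eval y) := by
        rw [e]
        calc R / c ^ n = c * (R / c ^ (n+1)) := by rw [pow_succ]; field_simp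
          _ < c * v (x - y) := by gcongr
          _ ≤ _ := mul_le_mul_of_nonneg_right (hcα α hα) (v.nonneg _)
      have gx := hx.next
      have gy := hy.next
      rw [SUB_rat_some hBx] at gx
      rw [SUB_rat_some hBy] at gy
      obtain ⟨m, hm, x', y', e1, e2, e3⟩ := ih _ _ gx gy h1
      refine ⟨m + 1, by omega, x', y', ?_, ?_, e3⟩
      · rw [Function.iterate_succ_apply, SUB_rat_some hBx, e1]
      · rw [Function.iterate_succ_apply, SUB_rat_some hBy, e2]

lemma SUB_Dyn.separate (H : SUB_Dyn v A B R r) (α0 : Ω) (h0 : v α0 = R) (x y : Ω)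
    (hx : SUB_Good v A B R (some x)) (hy : SUB_Good v A B R (some y)) (hne : x ≠ y) :
    ∃ m, ∃ x' y', (ratP1Map A B)^[m] (some x) = some x' ∧ (ratP1Map A B)^[m] (some y) = some y' ∧
      SUB_Sep v A B α0 x' y' := by
  obtain ⟨c, hc, hcα⟩ := H.minC α0 h0
  have hpos : 0 < v (x - y) := v.pos (sub_ne_zero.mpr hne)
  have hR : 0 < R := by linarith [H.h1]
  obtain ⟨n, hn⟩ := pow_unbounded_of_one_lt (R / v (x - y)) hc
  obtain ⟨m, _, h⟩ := H.sep_step α0 h0 c hc hcα n x y hx hy (by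
    rw [div_lt_iff₀ (by positivity)]
    rw [div_lt_iff₀ hpos] at hn
    linarith)
  exact ⟨m, h⟩

lemma SUB_lab_B {x : Ω} (h : B.eval x = 0) : SUB_lab v A B r (some x) = some x := by
  simp [SUB_lab, h]

lemma SUB_Dyn.lab_A (H : SUB_Dyn v A B R r) {x α : Ω} (hα : A.IsRoot α) (h : v (x - α) ≤ r α) :
    SUB_lab v A B r (some x) = some α := by
  have hB : B.eval x ≠ 0 := H.Bne hα h
  have hex : ∃ α, A.IsRoot α ∧ v (x - α) ≤ r α := ⟨α, hα, h⟩
  have : hex.choose = α := by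
    by_contra hne
    exact H.h5 _ _ hex.choose_spec.1 hα hne x ⟨hex.choose_spec.2, h⟩
  simp only [SUB_lab, hB, if_false]
  rw [dif_pos hex, this]

lemma SUB_Dyn.notboth (H : SUB_Dyn v A B R r) {x : Ω} (hA : A.eval x = 0) (hB : B.eval x = 0) : False := by
  obtain ⟨u, w, h⟩ := H.cop
  have := congrArg (eval x) h
  simp [hA, hB] at this

lemma SUB_lab_cases (x : Ω) (γ : Ω) (h : SUB_lab v A B r (some x) = some γ) :
    (B.eval x = 0 ∧ γ = x) ∨ (A.IsRoot γ ∧ v (x - γ) ≤ r γ) := by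
  simp only [SUB_lab] at h
  split_ifs at h with h1 h2
  · left; exact ⟨h1, (Option.some_injective _ h).symm⟩
  · right
    have := h2.choose_spec
    rw [Option.some_injective _ h] at this
    exact this

lemma SUB_Dyn.sep_lab (H : SUB_Dyn v A B R r) (α0 : Ω) (h0 : v α0 = R) (x y : Ω)
    (h : SUB_Sep v A B α0 x y) : SUB_lab v A B r (some x) ≠ SUB_lab v A B r (some y) := by
  intro he
  obtain ⟨hne, hb | hb | ⟨α, hα, h1, h2⟩⟩ := h
  · rw [SUB_lab_B hb] at he
    rcases SUB_lab_cases y x he.symm with ⟨_, h⟩ | ⟨h, _⟩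
    · exact hne h
    · exact H.notboth h hb
  · rw [SUB_lab_B hb] at he
    rcases SUB_lab_cases x y he with ⟨_, h⟩ | ⟨h, _⟩
    · exact hne h.symm
    · exact H.notboth h hb
  · rw [← H.radius hα α0 h0] at h1
    rw [H.lab_A hα h1] at he
    rcases SUB_lab_cases y α he.symm with ⟨h, h'⟩ | ⟨_, h⟩
    · exact H.notboth hα (h' ▸ h)
    · rw [H.radius hα α0 h0] at h
      exact absurd h2 (not_lt.mpr h)

lemma SUB_Dyn.itin (H : SUB_Dyn v A B R r) (α0 : Ω) (h0 : v α0 = R) :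
    ∃ N : ℕ, ∀ x y, SUB_Good v A B R (some x) → SUB_Good v A B R (some y) →
      (∀ i < N, SUB_lab v A B r ((ratP1Map A B)^[i] (some x)) =
        SUB_lab v A B r ((ratP1Map A B)^[i] (some y))) → v (x - y) < 1 := by
  obtain ⟨c, hc, hcα⟩ := H.minC α0 h0
  have hR : 0 < R := by linarith [H.h1]
  obtain ⟨n, hn⟩ := pow_unbounded_of_one_lt R hc
  refine ⟨n, fun x y hx hy hl => ?_⟩
  by_contra hge
  push Not at hge
  obtain ⟨m, hm, x', y', e1, e2, hs⟩ := H.sep_step α0 h0 c hc hcα n x y hx hy (by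
    refine lt_of_lt_of_le ?_ hge
    rw [div_lt_one (by positivity)]
    exact hn)
  have := hl m hm
  rw [e1, e2] at this
  exact H.sep_lab α0 h0 x' y' hs this

lemma SUB_Dyn.labT (H : SUB_Dyn v A B R r) :
    ∃ T : Finset (Option Ω), ∀ z, SUB_lab v A B r z ∈ T := by
  refine ⟨insert none ((A.roots.toFinset ∪ B.roots.toFinset).image some), ?_⟩
  intro z
  rcases hz : SUB_lab v A B r z with _ | γ
  · simp
  · rcases z with _ | x
    · simp [SUB_lab] at hz
    · rcases SUB_lab_cases x γ hz with ⟨h, rfl⟩ | ⟨h, _⟩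
      · simp [H.hB.ne_zero, h]
      · simp only [Finset.mem_insert, Finset.mem_image, Finset.mem_union]
        exact Or.inr ⟨γ, Or.inl (H.memZ.mpr h), rfl⟩

/-- equivariance of the map. -/
lemma SUB_rat_map {L M : Type*} [Field L] [Field M] (j : L →+* M) (A B : Polynomial L) (z : Option L) :
    ratP1Map (A.map j) (B.map j) (z.map j) = (ratP1Map A B z).map j := by
  rcases z with _ | x
  · simp only [ratP1Map, Option.map_none, degree_map, leadingCoeff_map]
    split_ifs <;> simp
  · simp only [ratP1Map, Option.map_some, eval_map_apply]
    by_cases h : B.eval x = 0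
    · simp [h]
    · simp [h, map_div₀]

lemma SUB_rat_iter {L M : Type*} [Field L] [Field M] (j : L →+* M) (A B : Polynomial L) (n : ℕ)
    (z : Option L) :
    (ratP1Map (A.map j) (B.map j))^[n] (z.map j) = ((ratP1Map A B)^[n] z).map j := by
  induction n with
  | zero => rfl
  | succ n ih => rw [Function.iterate_succ_apply', Function.iterate_succ_apply', ih, SUB_rat_map]

lemma SUB_prep_map {L M : Type*} [Field L] [Field M] (j : L →+* M) (A B : Polynomial L) 
    (z : Option L) :
    IsPreperiodic (ratP1Map (A.map j) (B.map j)) (z.map j) ↔ IsPreperiodic (ratP1Map A B) z := by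
  unfold IsPreperiodic
  have : (Set.range fun n : ℕ => (ratP1Map (A.map j) (B.map j))^[n] (z.map j)) =
      (Option.map j) '' (Set.range fun n : ℕ => (ratP1Map A B)^[n] z) := by
    rw [← Set.range_comp]
    congr 1
    funext n
    exact SUB_rat_iter j A B n z
  rw [this, Set.finite_image_iff]
  exact (Option.map_injective j.injective).injOn

lemma SUB_Dyn.prep_good (H : SUB_Dyn v A B R r) {z : Option Ω}
    (hz : IsPreperiodic (ratP1Map A B) z) : SUB_Good v A B R z :=
  fun n w hw => H.good z hz n w hw

/-- Galois invariance of preperiodic points. -/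
lemma SUB_Dyn.galois (H : SUB_Dyn v A B R r) (α0 : Ω) (hA0 : A.IsRoot α0) (h0 : v α0 = R)
    (τ : Ω →+* Ω) (hτ : ∀ x, v (τ x) = v x) (hτA : A.map τ = A) (hτB : B.map τ = B)
    (hA : ∀ α, A.IsRoot α → τ α = α) (hB : ∀ β, B.IsRoot β → τ β = β) (x : Ω)
    (hx : IsPreperiodic (ratP1Map A B) (some x)) : τ x = x := by
  by_contra hne
  have hx' : IsPreperiodic (ratP1Map A B) (some (τ x)) := by
    have := (SUB_prep_map τ A B (some x)).mpr hx
    rwa [hτA, hτB] at this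
  obtain ⟨m, x', y', e1, e2, hn, hs⟩ := H.separate α0 h0 (τ x) x (H.prep_good hx') (H.prep_good hx) hne
  have e3 : x' = τ y' := by
    have := SUB_rat_iter τ A B m (some x)
    rw [hτA, hτB, Option.map_some, e1, e2, Option.map_some] at this
    exact Option.some_injective _ this
  subst e3
  have hBe : ∀ w, B.eval (τ w) = τ (B.eval w) := by
    intro w
    conv_lhs => rw [← hτB]
    rw [eval_map_apply]
  rcases hs with hs | hs | ⟨α, hα, h1, h2⟩
  · rw [hBe, map_eq_zero] at hs
    exact hn (hB _ hs)
  · exact hn (hB _ hs)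
  · rw [← hτ, map_div₀, map_mul, map_mul, map_sub, hA α hα, hA α0 hA0, ← hBe, hA α hα] at h2
    have hd : τ (A.derivative.eval α) = A.derivative.eval α := by
      rw [← eval_map_apply, ← derivative_map, hτA, hA α hα]
    rw [hd] at h2
    exact absurd h2 (not_lt.mpr h1)

end dyn
end

section
set_option linter.style.haveILetI false
open Polynomial

lemma SUB_aut {C Ω : Type*} [Field C] [val : Valued C (WithZero (Multiplicative ℤ))] [CompleteSpace C]
    [Field Ω] [Algebra C Ω] [Algebra.IsAlgebraic C Ω] (v : AbsoluteValue Ω ℝ) (hna : IsNonarchimedean v)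
    (q : ℕ) (hq : 1 < q)
    (hext : ∀ x : C, x ≠ 0 → ∃ n : ℤ,
      Valued.v x = ((Multiplicative.ofAdd n : Multiplicative ℤ) : WithZero (Multiplicative ℤ)) ∧
      v (algebraMap C Ω x) = (q : ℝ) ^ n)
    (hnt : ∃ x : C, 1 < v (algebraMap C Ω x)) (τ : Ω ≃ₐ[C] Ω) (x : Ω) : v (τ x) = v x := by
  have hq' : (1 : NNReal) < (q : NNReal) := by exact_mod_cast hq
  letI R1 : Valuation.RankOne val.v :=
    { hom' := (WithZeroMulInt.toNNReal hq'.ne_zero).comp MonoidWithZeroHom.ValueGroup₀.embedding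
      strictMono' := (WithZeroMulInt.toNNReal_strictMono hq').comp
        MonoidWithZeroHom.ValueGroup₀.embedding_strictMono
      exists_val_nontrivial := by
        obtain ⟨x, hx⟩ := hnt
        have hx0 : x ≠ 0 := by
          rintro rfl
          simp at hx
          linarith
        refine ⟨x, by simpa using hx0, ?_⟩
        intro h1
        obtain ⟨n, h2, h3⟩ := hext x hx0
        rw [h1] at h2
        have : n = 0 := by
          have h4 : ((1 : Multiplicative ℤ) : WithZero (Multiplicative ℤ)) =
            ((Multiplicative.ofAdd n : Multiplicative ℤ) : WithZero (Multiplicative ℤ)) := h2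
          have h5 := WithZero.coe_injective h4
          exact (Multiplicative.ofAdd.injective (a₁ := (0:ℤ)) h5).symm
        rw [h3, this] at hx
        simp at hx }
  letI NF : NormedField C := Valued.toNormedField C (WithZero (Multiplicative ℤ))
  have hnorm : ∀ x : C, v (algebraMap C Ω x) = ‖x‖ := by
    intro x
    by_cases hx : x = 0
    · subst hx; simp
    obtain ⟨n, h2, h3⟩ := hext x hx
    rw [h3]
    show _ = ((R1.hom' (val.v.restrict x) : NNReal) : ℝ)
    show _ = ((WithZeroMulInt.toNNReal hq'.ne_zero
      (MonoidWithZeroHom.ValueGroup₀.embedding (val.v.restrict x)) : NNReal) : ℝ)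
    rw [Valuation.embedding_restrict, h2, WithZeroMulInt.toNNReal_neg_apply _ (by simp)]
    simp
  letI NNF : NontriviallyNormedField C :=
    { NF with
      non_trivial := by
        obtain ⟨x, hx⟩ := hnt
        exact ⟨x, by rwa [hnorm] at hx⟩ }
  haveI : IsUltrametricDist C := by
    apply IsUltrametricDist.isUltrametricDist_of_forall_norm_add_le_max_norm
    intro x y
    have := hna (algebraMap C Ω x) (algebraMap C Ω y)
    rw [← map_add, hnorm, hnorm, hnorm] at this
    exact this
  have key := spectralNorm_unique_field_norm_ext (K := C) (f := v) hnorm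
  rw [key, key, ← spectralNorm_eq_of_equiv τ x]

open RatFunc in
lemma SUB_ratfunc_res (F : Type) [Field F] [Fintype F] [DecidableEq (RatFunc F)] (f : RatFunc F)
    (hf : inftyValuation F f ≤ 1) : inftyValuation F (f ^ (Fintype.card F) - f) < 1 := by
  set d := f.denom with hd
  set p := f.num with hp
  have hd0 : d ≠ 0 := RatFunc.denom_ne_zero f
  have hval : ∀ s : Polynomial F, s ≠ 0 → inftyValuation F (algebraMap F[X] (RatFunc F) s) =
      WithZero.exp (s.natDegree : ℤ) := fun s hs => by
    exact inftyValuation.polynomial F hs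
  have hfd : f = algebraMap F[X] (RatFunc F) p / algebraMap F[X] (RatFunc F) d :=
    (RatFunc.num_div_denom f).symm
  have hdv : inftyValuation F (algebraMap F[X] (RatFunc F) d) ≠ 0 := by
    rw [hval d hd0]; simp
  have hdeg : p.natDegree ≤ d.natDegree := by
    by_cases hp0 : p = 0
    · rw [hp0]; simp
    rw [hfd, map_div₀, hval p hp0, hval d hd0, div_le_one₀ (by simp), WithZero.exp_le_exp] at hf
    exact_mod_cast hf
  have hmon : d.Monic := RatFunc.monic_denom f
  set ρ := p.coeff d.natDegree
  have h1 : inftyValuation F (f - RatFunc.C ρ) < 1 := by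
    have e : f - RatFunc.C ρ = algebraMap F[X] (RatFunc F) (p - Polynomial.C ρ * d) /
        algebraMap F[X] (RatFunc F) d := by
      have : algebraMap F[X] (RatFunc F) d ≠ 0 := by simpa using hd0
      rw [map_sub, map_mul, RatFunc.algebraMap_C, sub_div, mul_div_cancel_right₀ _ this, ← hfd]
    rw [e]
    by_cases h0 : p - Polynomial.C ρ * d = 0
    · rw [h0]; simp
    rw [map_div₀, hval _ h0, hval d hd0, div_lt_one₀ (by simp), WithZero.exp_lt_exp]
    have hlt : (p - Polynomial.C ρ * d).degree < d.degree := by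
      rw [degree_eq_natDegree hd0, degree_lt_iff_coeff_zero]
      intro m hm
      rcases hm.lt_or_eq with hm | hm
      · rw [coeff_sub, coeff_C_mul, coeff_eq_zero_of_natDegree_lt (hdeg.trans_lt hm),
          coeff_eq_zero_of_natDegree_lt hm]; simp
      · rw [← hm, coeff_sub, coeff_C_mul, hmon.coeff_natDegree]; simp [ρ]
    have := natDegree_lt_natDegree h0 hlt
    exact_mod_cast this
  obtain ⟨p', hp'⟩ := CharP.exists F
  haveI := hp'
  haveI : Fact p'.Prime := ⟨CharP.char_is_prime F p'⟩
  haveI : CharP (RatFunc F) p' := charP_of_injective_algebraMap (algebraMap F (RatFunc F)).injective p'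
  obtain ⟨n, hn, hcard⟩ := FiniteField.card F p'
  have e : f ^ (Fintype.card F) - f = (f - RatFunc.C ρ) ^ (Fintype.card F) - (f - RatFunc.C ρ) := by
    have : (f - RatFunc.C ρ) ^ (Fintype.card F) = f ^ (Fintype.card F) - RatFunc.C ρ := by
      rw [hcard, sub_pow_char_pow, ← hcard, ← map_pow, FiniteField.pow_card]
    rw [this]; ring
  rw [e]
  apply Valuation.map_sub_lt _ _ h1
  rw [map_pow]
  exact pow_lt_one₀ zero_le h1 Fintype.card_ne_zero

lemma SUB_dense {K Γ : Type*} [Field K] [LinearOrderedCommGroupWithZero Γ] [hv : Valued K Γ]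
    (x : UniformSpace.Completion K) : ∃ y : K, Valued.v (x - (y : UniformSpace.Completion K)) < (1 : Γ) := by
  have hopen : IsOpen {z : UniformSpace.Completion K | Valued.v (x - z) < (1 : Γ)} := by
    have h1 : IsOpen {z : UniformSpace.Completion K | Valued.v z < (1 : Γ)} := by
      have := Valued.isOpen_ball (R := UniformSpace.Completion K) (Γ₀ := Γ) 1
      simpa using this
    exact h1.preimage (continuous_const.sub continuous_id)
  obtain ⟨y, h⟩ := (UniformSpace.Completion.denseRange_coe (α := K)).exists_mem_open hopen ⟨x, by simp⟩
  exact ⟨y, h⟩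

open RatFunc in
lemma SUB_C_res (F : Type) [Field F] [Fintype F] [DecidableEq (RatFunc F)] (x : CompletionAtInfty F)
    (hx : Valued.v x ≤ (1 : WithZero (Multiplicative ℤ))) :
    Valued.v (x ^ (Fintype.card F) - x) < (1 : WithZero (Multiplicative ℤ)) := by
  letI := inftyValued F
  obtain ⟨y, hy⟩ : ∃ y : RatFunc F, Valued.v (x - algebraMap (RatFunc F) (CompletionAtInfty F) y) <
    (1 : WithZero (Multiplicative ℤ)) := @SUB_dense (RatFunc F) _ _ _ (inftyValued F) x
  have hyv : Valued.v (algebraMap (RatFunc F) (CompletionAtInfty F) y) = inftyValuation F y :=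
    @Valued.valuedCompletion_apply (RatFunc F) _ _ _ (inftyValued F) y
  have hyv' : ∀ y, Valued.v (algebraMap (RatFunc F) (CompletionAtInfty F) y) = inftyValuation F y :=
    fun y => @Valued.valuedCompletion_apply (RatFunc F) _ _ _ (inftyValued F) y
  set y' := algebraMap (RatFunc F) (CompletionAtInfty F) y with hy'
  have h1 : Valued.v y' ≤ (1 : WithZero (Multiplicative ℤ)) := by
    have : y' = x - (x - y') := by ring
    rw [this]
    exact (Valuation.map_sub _ _ _).trans (max_le hx hy.le)
  have h2 := SUB_ratfunc_res F y (by rw [← hyv]; exact h1)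
  rw [← hyv', map_sub, map_pow] at h2
  obtain ⟨p', hp'⟩ := CharP.exists F
  haveI := hp'
  haveI : Fact p'.Prime := ⟨CharP.char_is_prime F p'⟩
  haveI : CharP (RatFunc F) p' := charP_of_injective_algebraMap (algebraMap F (RatFunc F)).injective p'
  haveI : CharP (CompletionAtInfty F) p' :=
    charP_of_injective_algebraMap (algebraMap (RatFunc F) (CompletionAtInfty F)).injective p'
  obtain ⟨n, hn, hcard⟩ := FiniteField.card F p'
  have e : x ^ (Fintype.card F) - x = (x - y') ^ (Fintype.card F) - (x - y') + (y' ^ Fintype.card F - y') := by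
    rw [hcard, sub_pow_char_pow]; ring
  rw [e]
  apply Valuation.map_add_lt _ _ h2
  apply Valuation.map_sub_lt _ _ hy
  rw [map_pow]
  exact pow_lt_one₀ zero_le hy Fintype.card_ne_zero

lemma SUB_complete (F : Type) [Field F] [DecidableEq (RatFunc F)] :
    CompleteSpace (RatFunc.CompletionAtInfty F) :=
  @UniformSpace.Completion.completeSpace (RatFunc F) (RatFunc.inftyValued F).toUniformSpace
end

section
set_option linter.style.haveILetI false
open Polynomial

/-- The valuation ring of a nonarchimedean absolute value. -/
def SUB_O {Ω : Type*} [Field Ω] (v : AbsoluteValue Ω ℝ) (hna : IsNonarchimedean v) :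
    ValuationSubring Ω where
  carrier := {x | v x ≤ 1}
  mul_mem' := by
    intro x y hx hy
    simp only [Set.mem_ofPred_eq] at *
    rw [map_mul]
    exact mul_le_one₀ hx (v.nonneg _) hy
  one_mem' := by simp
  add_mem' := by
    intro x y hx hy
    exact (hna x y).trans (max_le hx hy)
  zero_mem' := by simp
  neg_mem' := by
    intro x hx
    simpa using hx
  mem_or_inv_mem' := by
    intro x
    simp only [Set.mem_ofPred_eq, map_inv₀]
    rcases le_total (v x) 1 with h | h
    · exact Or.inl h
    · exact Or.inr (inv_le_one_of_one_le₀ h)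

lemma SUB_O_mem {Ω : Type*} [Field Ω] (v : AbsoluteValue Ω ℝ) (hna : IsNonarchimedean v) (x : Ω) :
    x ∈ SUB_O v hna ↔ v x ≤ 1 := Iff.rfl

lemma SUB_O_res {Ω : Type*} [Field Ω] (v : AbsoluteValue Ω ℝ) (hna : IsNonarchimedean v)
    (x : SUB_O v hna) : IsLocalRing.residue (SUB_O v hna) x = 0 ↔ v (x : Ω) < 1 := by
  rw [IsLocalRing.residue_eq_zero_iff, IsLocalRing.mem_maximalIdeal, mem_nonunits_iff, ← not_iff_comm,
    not_lt]
  constructor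
  · intro h
    by_cases hx0 : (x : Ω) = 0
    · rw [hx0, map_zero] at h; linarith
    have hinv : (x : Ω)⁻¹ ∈ SUB_O v hna := by
      rw [SUB_O_mem, map_inv₀]
      exact inv_le_one_of_one_le₀ h
    exact IsUnit.of_mul_eq_one ⟨_, hinv⟩ (Subtype.ext (mul_inv_cancel₀ hx0))
  · intro h
    obtain ⟨y, hy⟩ := h.exists_right_inv
    have h1 : v (x : Ω) * v (y : Ω) = 1 := by
      rw [← map_mul]
      have := congrArg (Subtype.val) hy
      simp only [MulMemClass.coe_mul, OneMemClass.coe_one] at this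
      rw [this, map_one]
    have h2 : v (y : Ω) ≤ 1 := y.2
    have h3 : v (x : Ω) ≤ 1 := x.2
    nlinarith [v.nonneg (x : Ω), v.nonneg (y : Ω)]

section
variable {C Ω : Type*} [Field C] [Field Ω] [Algebra C Ω]

/-- the reduction of a finite extension is finite -/
lemma SUB_kappa_finite (v : AbsoluteValue Ω ℝ) (hna : IsNonarchimedean v) (q : ℕ) (hq : 1 < q)
    (hres : ∀ c : C, v (algebraMap C Ω c) ≤ 1 → v (algebraMap C Ω c ^ q - algebraMap C Ω c) < 1)
    (E : IntermediateField C Ω) [FiniteDimensional C E] :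
    {y | ∃ x : SUB_O v hna, (x : Ω) ∈ E ∧ IsLocalRing.residue (SUB_O v hna) x = y}.Finite := by
  classical
  set O := SUB_O v hna
  set κ := IsLocalRing.ResidueField O
  set n := Module.finrank C E
  set S0 : Finset κ := (X ^ q - X : Polynomial κ).roots.toFinset with hS0
  have hX : (X ^ q - X : Polynomial κ) ≠ 0 := FiniteField.X_pow_card_sub_X_ne_zero κ hq
  -- finitely many polynomials
  set P : Set (Polynomial κ) := Set.range (fun g : Fin (n+1) → S0 => ∑ i, Polynomial.C (g i : κ) * X ^ (i : ℕ))
  have hP : P.Finite := Set.finite_range _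
  have hfin : (⋃ f ∈ P, {y : κ | f ≠ 0 ∧ f.IsRoot y}).Finite := by
    apply hP.biUnion
    intro f _
    by_cases hf : f = 0
    · simp [hf]
    · apply (finite_setOfPred_isRoot hf).subset
      rintro y ⟨_, h⟩
      exact h
  apply hfin.subset
  rintro y ⟨x, hxE, rfl⟩
  -- a linear dependence
  have hdep : ¬ LinearIndependent C (fun i : Fin (n+1) => (⟨x, hxE⟩ : E) ^ (i : ℕ)) := by
    intro h
    have := h.fintype_card_le_finrank
    simp [n] at this
  rw [Fintype.not_linearIndependent_iff] at hdep
  obtain ⟨g, hg, i0, hi0⟩ := hdep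
  obtain ⟨i1, -, hmax⟩ := Finset.exists_max_image Finset.univ
    (fun i => v (algebraMap C Ω (g i))) ⟨i0, Finset.mem_univ _⟩
  have hi1 : g i1 ≠ 0 := by
    intro h
    have := hmax i0 (Finset.mem_univ _)
    rw [h, map_zero, map_zero] at this
    have h2 : v (algebraMap C Ω (g i0)) = 0 := le_antisymm this (v.nonneg _)
    rw [v.eq_zero, map_eq_zero] at h2
    exact hi0 h2
  have hpos : 0 < v (algebraMap C Ω (g i1)) := v.pos (by simpa using hi1)
  set c : Fin (n+1) → C := fun i => g i / g i1
  have hcO : ∀ i, v (algebraMap C Ω (c i)) ≤ 1 := by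
    intro i
    simp only [c]
    rw [map_div₀, map_div₀, div_le_one hpos]
    exact hmax i (Finset.mem_univ _)
  set c' : Fin (n+1) → O := fun i => ⟨algebraMap C Ω (c i), hcO i⟩
  have hrel : ∑ i, c' i * x ^ (i : ℕ) = 0 := by
    apply Subtype.ext
    have h1 := congrArg (fun e : E => (algebraMap C Ω (g i1))⁻¹ * (e : Ω)) hg
    simp only [ZeroMemClass.coe_zero, mul_zero] at h1
    rw [ZeroMemClass.coe_zero, ← h1]
    push_cast
    rw [Finset.mul_sum]
    apply Finset.sum_congr rfl
    intro i _
    simp only [c', c, map_div₀, Algebra.smul_def]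
    rw [div_eq_inv_mul, mul_assoc]
  have hcS : ∀ i, IsLocalRing.residue O (c' i) ∈ S0 := by
    intro i
    rw [hS0, Multiset.mem_toFinset, mem_roots hX]
    simp only [IsRoot, eval_sub, eval_pow, eval_X]
    rw [← map_pow, ← map_sub, SUB_O_res v hna]
    exact hres (c i) (hcO i)
  simp only [Set.mem_iUnion]
  refine ⟨∑ i, Polynomial.C (IsLocalRing.residue O (c' i)) * X ^ (i : ℕ), ⟨fun i => ⟨_, hcS i⟩, rfl⟩, ?_, ?_⟩
  · intro h0
    have := congrArg (fun f => coeff f (i1 : ℕ)) h0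
    simp only [finsetSum_coeff, coeff_C_mul, coeff_X_pow, coeff_zero] at this
    rw [Finset.sum_eq_single i1] at this
    · have h1 : c' i1 = 1 := by
        apply Subtype.ext
        simp [c', c, hi1]
      rw [h1] at this
      simp at this
    · intro j _ hj
      rw [if_neg (fun h => hj (Fin.ext h.symm)), mul_zero]
    · simp
  · have := congrArg (IsLocalRing.residue O) hrel
    simp only [map_sum, map_mul, map_pow, map_zero] at this
    simp [IsRoot, eval_finsetSum, this]

lemma SUB_resfield (p : ℕ) [Fact p.Prime] [CharP Ω p] (v : AbsoluteValue Ω ℝ) (hna : IsNonarchimedean v)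
    (q : ℕ) (hq : 1 < q)
    (hres : ∀ c : C, v (algebraMap C Ω c) ≤ 1 → v (algebraMap C Ω c ^ q - algebraMap C Ω c) < 1)
    (E : IntermediateField C Ω) [FiniteDimensional C E] :
    ∃ n : ℕ, n ≠ 0 ∧ (∀ x ∈ E, v x ≤ 1 → v (x ^ (p^n) - x) < 1) ∧
      ∀ ω : Ω, ω ^ (p^n) = ω → ∃ x ∈ E, v (ω - x) < 1 := by
  classical
  have hfin := SUB_kappa_finite v hna q hq hres E
  set O := SUB_O v hna
  let E0 : Subring O := E.toSubfield.toSubring.comap O.subtype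
  let κ' : Subring (IsLocalRing.ResidueField O) := E0.map (IsLocalRing.residue O)
  have hκ : ∀ y, y ∈ κ' ↔ ∃ x : O, (x : Ω) ∈ E ∧ IsLocalRing.residue O x = y := fun y => Iff.rfl
  haveI : Finite κ' := by
    apply Set.Finite.to_subtype
    exact hfin
  letI : Fintype κ' := Fintype.ofFinite κ'
  haveI : CharP O p := by
    exact (RingHom.charP_iff O.subtype Subtype.val_injective p).mpr inferInstance
  haveI : CharP (IsLocalRing.ResidueField O) p := by
    have h0 : ((p : ℕ) : IsLocalRing.ResidueField O) = 0 := by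
      have : ((p : ℕ) : O) = 0 := CharP.cast_eq_zero O p
      rw [← map_natCast (IsLocalRing.residue O), this, map_zero]
    exact (CharP.charP_iff_prime_eq_zero (Fact.out : p.Prime)).mpr h0
  haveI : CharP κ' p := 
    (RingHom.charP_iff κ'.subtype Subtype.val_injective p).mpr inferInstance
  letI : Field κ' := Fintype.fieldOfDomain κ'
  obtain ⟨n, hn, hcard⟩ := FiniteField.card κ' p
  refine ⟨n, n.ne_zero, ?_, ?_⟩
  · intro x hxE hxv
    have h1 : IsLocalRing.residue O ⟨x, hxv⟩ ∈ κ' := (hκ _).mpr ⟨⟨x, hxv⟩, hxE, rfl⟩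
    have h2 := FiniteField.pow_card (⟨_, h1⟩ : κ')
    rw [hcard] at h2
    have h3 := congrArg Subtype.val h2
    simp only [SubmonoidClass.coe_pow] at h3
    rw [← sub_eq_zero, ← map_pow, ← map_sub, SUB_O_res] at h3
    exact h3
  · intro ω hω
    have hp1 : 1 < p ^ (n:ℕ) := Nat.one_lt_pow n.ne_zero (Fact.out : p.Prime).one_lt
    have hωv : v ω ≤ 1 := by
      by_contra h
      push Not at h
      have := congrArg v hω
      rw [map_pow] at this
      have h2 := pow_lt_pow_right₀ h hp1
      rw [this, pow_one] at h2
      exact lt_irrefl _ h2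
    set ωb := IsLocalRing.residue O ⟨ω, hωv⟩
    have hX : (X ^ (p ^ (n:ℕ)) - X : Polynomial (IsLocalRing.ResidueField O)) ≠ 0 :=
      FiniteField.X_pow_card_sub_X_ne_zero _ hp1
    have hr : ωb ∈ (X ^ (p ^ (n:ℕ)) - X : Polynomial (IsLocalRing.ResidueField O)).roots.toFinset := by
      rw [Multiset.mem_toFinset, mem_roots hX]
      simp only [IsRoot, eval_sub, eval_pow, eval_X, ωb]
      rw [← map_pow, sub_eq_zero]
      congr 1
      exact Subtype.ext hω
    have heq : (Finset.univ : Finset κ').image Subtype.val =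
        (X ^ (p ^ (n:ℕ)) - X : Polynomial (IsLocalRing.ResidueField O)).roots.toFinset := by
      apply Finset.eq_of_subset_of_card_le
      · intro y hy
        obtain ⟨z, -, rfl⟩ := Finset.mem_image.mp hy
        rw [Multiset.mem_toFinset, mem_roots hX]
        simp only [IsRoot, eval_sub, eval_pow, eval_X]
        have h2 := congrArg Subtype.val (FiniteField.pow_card z)
        rw [hcard] at h2
        simp only [SubmonoidClass.coe_pow] at h2
        rw [h2, sub_self]
      · rw [Finset.card_image_of_injective _ Subtype.val_injective, Finset.card_univ, hcard]
        refine (Multiset.toFinset_card_le _).trans ((card_roots' _).trans ?_)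
        rw [FiniteField.X_pow_card_sub_X_natDegree_eq _ hp1]
    rw [← heq] at hr
    obtain ⟨z, -, hz⟩ := Finset.mem_image.mp hr
    obtain ⟨x, hxE, hx⟩ := (hκ _).mp z.2
    refine ⟨x, hxE, ?_⟩
    rw [hz] at hx
    have : IsLocalRing.residue O (⟨ω, hωv⟩ - x) = 0 := by
      rw [map_sub, hx, sub_self]
    rw [SUB_O_res] at this
    exact this

end
end

section
set_option linter.style.haveILetI false
open Polynomial

/-- invariants of the automorphism group are purely inseparable -/
lemma SUB_insep {E Ω : Type*} [Field E] [Field Ω] [Algebra E Ω] [IsAlgClosed Ω]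
    [Algebra.IsAlgebraic E Ω] (p : ℕ) [Fact p.Prime] [CharP Ω p] (x : Ω)
    (hx : ∀ τ : Ω ≃ₐ[E] Ω, τ x = x) : ∃ m : ℕ, x ^ (p ^ m) ∈ (algebraMap E Ω).range := by
  classical
  haveI : ExpChar Ω p := ExpChar.prime Fact.out
  haveI : CharP E p := (RingHom.charP_iff (algebraMap E Ω) (algebraMap E Ω).injective p).mpr inferInstance
  haveI : ExpChar E p := ExpChar.prime Fact.out
  haveI : IsAlgClosure E Ω := ⟨inferInstance, inferInstance⟩
  haveI : Normal E Ω := IsAlgClosure.normal E Ω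
  rw [← minpoly.natSepDegree_eq_one_iff_pow_mem p, natSepDegree_eq_of_isAlgClosed Ω]
  have hne : minpoly E x ≠ 0 := minpoly.ne_zero (Algebra.IsIntegral.isIntegral x)
  rw [Finset.card_eq_one]
  refine ⟨x, ?_⟩
  ext y
  rw [Multiset.mem_toFinset, mem_aroots, Finset.mem_singleton]
  constructor
  · rintro ⟨_, h⟩
    have hc : IsConjRoot E x y := by
      rw [isConjRoot_iff_aeval_eq_zero (Algebra.IsIntegral.isIntegral x)]
      exact h
    obtain ⟨τ, hτ⟩ := isConjRoot_iff_exists_algEquiv.mp hc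
    have h2 : τ.symm x = y := by
      first
        | (rw [hτ]; simp)
        | (rw [← hτ]; simp)
    rw [← h2, hx]
  · rintro rfl
    exact ⟨hne, minpoly.aeval _ _⟩

lemma SUB_local {C Ω : Type*} [Field C] [Field Ω] [Algebra C Ω] [IsAlgClosed Ω]
    [Algebra.IsAlgebraic C Ω] (p : ℕ) [Fact p.Prime] [CharP Ω p] {v : AbsoluteValue Ω ℝ}
    {A B : Polynomial Ω} {R : ℝ} {r : Ω → ℝ} (H : SUB_Dyn v A B R r)
    (A0 B0 : Polynomial C) (hA0 : A = A0.map (algebraMap C Ω)) (hB0 : B = B0.map (algebraMap C Ω))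
    (haut : ∀ (τ : Ω ≃ₐ[C] Ω) x, v (τ x) = v x)
    (q : ℕ) (hq : 1 < q)
    (hres : ∀ c : C, v (algebraMap C Ω c) ≤ 1 → v (algebraMap C Ω c ^ q - algebraMap C Ω c) < 1)
    (α0 : Ω) (hα0 : A.IsRoot α0) (hR : v α0 = R) :
    ∃ n : ℕ, n ≠ 0 ∧ ∃ G : Subfield Ω, (∀ c : C, algebraMap C Ω c ∈ G) ∧
      (∀ x, A.IsRoot x → x ∈ G) ∧ (∀ x, B.IsRoot x → x ∈ G) ∧
      (∀ x, IsPreperiodic (ratP1Map A B) (some x) → x ∈ G) ∧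
      (∀ ω, ω ^ (p ^ n) = ω → ω ∈ G) ∧
      (∀ x ∈ G, v x ≤ 1 → v (x ^ (p ^ n) - x) < 1) := by
  classical
  let S : Set Ω := ((A.roots.toFinset ∪ B.roots.toFinset : Finset Ω) : Set Ω)
  have hSA : ∀ x, A.IsRoot x → x ∈ S := by
    intro x hx
    simp only [S, Finset.coe_union, Set.mem_union, Finset.mem_coe]
    exact Or.inl (H.memZ.mpr hx)
  have hSB : ∀ x, B.IsRoot x → x ∈ S := by
    intro x hx
    simp only [S, Finset.coe_union, Set.mem_union, Finset.mem_coe]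
    exact Or.inr (by rw [Multiset.mem_toFinset, mem_roots H.hB.ne_zero]; exact hx)
  let E : IntermediateField C Ω := IntermediateField.adjoin C S
  haveI : Finite S := (Finset.finite_toSet _).to_subtype
  haveI : FiniteDimensional C E := IntermediateField.finiteDimensional_adjoin
    (fun x _ => Algebra.IsIntegral.isIntegral x)
  obtain ⟨n, hn, hE, hω⟩ := SUB_resfield p v H.hna q hq hres E
  have hautE : ∀ (τ : Ω ≃ₐ[E] Ω) x, v (τ x) = v x := fun τ x => haut (τ.restrictScalars C) x
  haveI : Algebra.IsAlgebraic E Ω := Algebra.IsAlgebraic.tower_top (K := C) E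
  let G : Subfield Ω := 
    { carrier := {x | ∀ τ : Ω ≃ₐ[E] Ω, τ x = x}
      mul_mem' := fun {a b} ha hb τ => by rw [map_mul, ha τ, hb τ]
      one_mem' := fun τ => map_one τ
      add_mem' := fun {a b} ha hb τ => by rw [map_add, ha τ, hb τ]
      zero_mem' := fun τ => map_zero τ
      neg_mem' := fun {a} ha τ => by rw [map_neg, ha τ]
      inv_mem' := fun a ha τ => by rw [map_inv₀, ha τ] }
  have hG : ∀ x, x ∈ G ↔ ∀ τ : Ω ≃ₐ[E] Ω, τ x = x := fun x => Iff.rfl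
  have hEG : ∀ x ∈ E, x ∈ G := fun x hx τ => τ.commutes ⟨x, hx⟩
  have hSE : ∀ x ∈ S, x ∈ E := fun x hx => IntermediateField.subset_adjoin C S hx
  refine ⟨n, hn, G, fun c => hEG _ (E.algebraMap_mem c), fun x hx => hEG _ (hSE _ (hSA x hx)),
    fun x hx => hEG _ (hSE _ (hSB x hx)), ?_, ?_, ?_⟩
  · intro x hx τ
    have hmap : ∀ P0 : Polynomial C, (P0.map (algebraMap C Ω)).map (τ : Ω →+* Ω) = P0.map (algebraMap C Ω) := by
      intro P0
      rw [Polynomial.map_map]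
      congr 1
      ext c
      exact (τ.restrictScalars C).commutes c
    refine H.galois α0 hα0 hR (τ : Ω →+* Ω) (hautE τ) (by rw [hA0]; exact hmap A0) (by rw [hB0]; exact hmap B0)
      (fun α hα => hEG _ (hSE _ (hSA _ hα)) τ) (fun β hβ => hEG _ (hSE _ (hSB _ hβ)) τ) x hx
  · intro ω hωp τ
    obtain ⟨x, hxE, hx⟩ := hω ω hωp
    have h1 : v (τ ω - x) < 1 := by
      have := hautE τ (ω - x)
      rw [map_sub, hEG x hxE τ] at this
      rw [this]; exact hx
    have h2 : v (τ ω - ω) < 1 := by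
      have : τ ω - ω = (τ ω - x) - (ω - x) := by ring
      rw [this]
      exact (SUB_na_sub v H.hna _ _).trans_lt (max_lt h1 hx)
    have h3 : (τ ω - ω) ^ (p ^ n) = τ ω - ω := by
      rw [sub_pow_char_pow, hωp, ← map_pow, hωp]
    by_contra hne
    have hpos : 0 < v (τ ω - ω) := v.pos (sub_ne_zero.mpr hne)
    have hp1 : 1 < p ^ n := Nat.one_lt_pow hn (Fact.out : p.Prime).one_lt
    have h4 := pow_lt_pow_right_of_lt_one₀ hpos h2 hp1
    rw [← map_pow, h3, pow_one] at h4
    exact lt_irrefl _ h4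
  · intro x hx hxv
    obtain ⟨m, y, hy⟩ := SUB_insep (E := E) p x hx
    have h1 := hE (y : Ω) y.2 (by
      show v (algebraMap E Ω y) ≤ 1
      rw [hy, map_pow]
      exact pow_le_one₀ (v.nonneg _) hxv)
    have e : (y : Ω) = x ^ (p ^ m) := hy
    rw [e] at h1
    have e2 : (x ^ p ^ m) ^ p ^ n - x ^ p ^ m = (x ^ p ^ n - x) ^ (p ^ m) := by
      rw [sub_pow_char_pow]; ring
    rw [e2, map_pow] at h1
    by_contra h
    push Not at h
    exact absurd (one_le_pow₀ h) (not_le.mpr h1)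
end

section
set_option linter.style.haveILetI false
open Polynomial

lemma SUB_val_le {L : Type*} [Field L] (V : ValuationSubring L) (x y : L) (hy : y ≠ 0) :
    V.valuation x ≤ V.valuation y ↔ x / y ∈ V := by
  rw [← V.valuation_le_one_iff, map_div₀, div_le_one₀]
  exact zero_lt_iff.mpr (by simpa using hy)

lemma SUB_comap_le {L M : Type*} [Field L] [Field M] (V : ValuationSubring M) (f : L →+* M)
    (x y : L) : (V.comap f).valuation x ≤ (V.comap f).valuation y ↔
      V.valuation (f x) ≤ V.valuation (f y) := by
  by_cases hy : y = 0
  · subst hy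
    simp
  · rw [SUB_val_le _ _ _ hy, SUB_val_le _ _ _ (by simpa using hy), ValuationSubring.mem_comap,
      map_div₀]

lemma SUB_comap_lt {L M : Type*} [Field L] [Field M] (V : ValuationSubring M) (f : L →+* M)
    (x y : L) : (V.comap f).valuation x < (V.comap f).valuation y ↔
      V.valuation (f x) < V.valuation (f y) := by
  rw [← not_le, ← not_le, SUB_comap_le]

lemma SUB_comap_lt_one {L M : Type*} [Field L] [Field M] (V : ValuationSubring M) (f : L →+* M)
    (x : L) : (V.comap f).valuation x < 1 ↔ V.valuation (f x) < 1 := by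
  have := SUB_comap_lt V f x 1
  simpa using this

lemma SUB_comap_eq {L M : Type*} [Field L] [Field M] (V : ValuationSubring M) (f : L →+* M)
    (x y : L) : (V.comap f).valuation x = (V.comap f).valuation y ↔
      V.valuation (f x) = V.valuation (f y) := by
  rw [le_antisymm_iff, le_antisymm_iff, SUB_comap_le, SUB_comap_le]

/-- If `y^Q - y` is small then `y` is close to a root of `X^Q - X`. -/
lemma SUB_near {k Θ : Type*} [Field k] [IsAlgClosed k] [Field Θ] [Algebra k Θ]
    (p : ℕ) [Fact p.Prime] [CharP Θ p] (n : ℕ) (hn : n ≠ 0) (W : ValuationSubring Θ)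
    (y : Θ) (hy : W.valuation (y ^ (p ^ n) - y) < 1) :
    ∃ ρ : k, ρ ^ (p ^ n) = ρ ∧ W.valuation (y - algebraMap k Θ ρ) < 1 := by
  haveI : CharP k p := (RingHom.charP_iff (algebraMap k Θ) (algebraMap k Θ).injective p).mpr inferInstance
  have h1 : 1 < p ^ n := Nat.one_lt_pow hn (Fact.out : p.Prime).one_lt
  have hm : (X ^ (p ^ n) - X : k[X]).Monic := by
    apply monic_X_pow_sub
    rw [degree_X]
    exact_mod_cast h1
  have hspl := (IsAlgClosed.splits (X ^ (p ^ n) - X : k[X])).eq_prod_roots_of_monic hm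
  have he := congrArg (aeval y) hspl
  rw [map_multiset_prod] at he
  simp only [map_sub, map_pow, aeval_X, Multiset.map_map, Function.comp_def, aeval_C] at he
  by_contra hcon
  push Not at hcon
  have : 1 ≤ W.valuation (y ^ (p ^ n) - y) := by
    rw [he, map_multiset_prod, Multiset.map_map]
    apply Multiset.one_le_prod_of_one_le
    intro z hz
    obtain ⟨ρ, hρ, rfl⟩ := Multiset.mem_map.mp hz
    have := isRoot_of_mem_roots hρ
    simp only [IsRoot, eval_sub, eval_pow, eval_X, sub_eq_zero] at this
    exact hcon ρ this
  exact absurd hy (not_lt.mpr this)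

theorem SUB_count {k Θ : Type*} [Field k] [IsAlgClosed k] [Field Θ] [Algebra k Θ]
    (p : ℕ) [Fact p.Prime] [CharP Θ p] (n : ℕ) (hn : n ≠ 0) (W : ValuationSubring Θ)
    (hk : ∀ x : k, algebraMap k Θ x ∈ W) (t : Θ) (htt : Transcendental k t)
    (G E1 : Subfield Θ) (hG : ∀ x ∈ G, x ∈ W → W.valuation (x ^ (p ^ n) - x) < 1)
    (htE : t ∈ E1) (hroots : ∀ ω : Θ, ω ^ (p ^ n) = ω → ω ∈ E1)
    (L2 : IntermediateField k Θ) (hEL : ∀ x ∈ E1, x ∈ L2) (T : L2) (hT : Transcendental k T)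
    [FiniteDimensional (IntermediateField.adjoin k {T}) L2] (M : ℕ)
    (hM : Module.finrank (IntermediateField.adjoin k {T}) L2 ≤ M)
    (P : Finset (Θ ≃ₐ[k] Θ)) (hPt : ∀ g ∈ P, g t ∉ W) (hPG : ∀ g ∈ P, ∀ x ∈ E1, g x ∈ G)
    (hsep : ∀ g ∈ P, ∀ g' ∈ P, g ≠ g' → ∃ u ∈ E1, g u ∈ W ∧ g' u ∉ W) :
    P.card ≤ M * (1 + (p ^ n + 1) * M) := by
  classical
  rcases P.eq_empty_or_nonempty with rfl | hne
  · simp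
  haveI : Nonempty P := hne.to_subtype
  let V : P → ValuationSubring Θ := fun g => W.comap (g.1 : Θ →+* Θ)
  have hkV : ∀ i x, algebraMap k Θ x ∈ V i := by
    intro i x
    simp only [V, ValuationSubring.mem_comap]
    simpa using hk x
  let E' := IntermediateField.adjoin k (E1 : Set Θ)
  obtain ⟨ψ, hψ, hψ2⟩ : ∃ ψ : E' ≃+* E', (∀ κ : k, ψ (algebraMap k E' κ) = algebraMap k E' κ ^ (p ^ n)) ∧
      ∀ i (x : E'), ((x : Θ) ∈ V i → (V i).valuation ((ψ x : Θ) - (x : Θ) ^ (p ^ n)) < 1) ∧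
        (V i).valuation (ψ x : Θ) = (V i).valuation (x : Θ) := SUB_psi (k := k) p n E1 V hkV (by
    intro i y hy hyV
    have h1 : (i.1 y : Θ) ∈ W := by simpa [V] using hyV
    obtain ⟨ρ, h2, h3⟩ := SUB_near (k := k) p n hn W (i.1 y) (hG _ (hPG i.1 i.2 y hy) h1)
    refine ⟨ρ, h2, hroots _ (by rw [← map_pow, h2]), ?_⟩
    rw [SUB_comap_lt_one]
    simpa using h3)
  have hle : E' ≤ L2 := IntermediateField.adjoin_le_iff.mpr hEL
  letI : Algebra E' L2 := (IntermediateField.inclusion hle).toRingHom.toAlgebra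
  haveI : IsScalarTower k E' L2 := IsScalarTower.of_algebraMap_eq' rfl
  let t' : E' := ⟨t, IntermediateField.subset_adjoin _ _ htE⟩
  have htt' : Transcendental k t' := by
    have : algebraMap E' Θ t' = t := rfl
    rw [← this] at htt
    exact (transcendental_algebraMap_iff (algebraMap E' Θ).injective).mp htt
  haveI : FiniteDimensional (IntermediateField.adjoin k {t'}) L2 :=
    SUB_fin_transc T _ hT (SUB_fracRing t' htt')
  haveI : FiniteDimensional E' L2 := FiniteDimensional.right (IntermediateField.adjoin k {t'}) E' L2
  obtain ⟨c, hc, hcf, hcM⟩ := SUB_lemmaA (k := k) (E := E') T hT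
  haveI := hcf
  haveI : CharP E' p := (RingHom.charP_iff (algebraMap E' Θ) (algebraMap E' Θ).injective p).mpr inferInstance
  have := SUB_lemmaB (k := k) p n hn ψ hψ (fun i : P => (V i).comap (algebraMap E' Θ))
    (by
      intro i x
      exact hkV i x)
    (by
      intro i h
      have h1 : t' ∈ (V i).comap (algebraMap E' Θ) := by rw [h]; trivial
      exact hPt i.1 i.2 (by simpa [V] using h1))
    (by
      intro i x hx
      rw [SUB_comap_lt_one]
      exact (hψ2 i x).1 hx)
    (by
      intro i x
      rw [SUB_comap_eq]
      exact (hψ2 i x).2)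
    Finset.univ
    (by
      intro i _ j _ hij
      obtain ⟨u, hu, h1, h2⟩ := hsep i.1 i.2 j.1 j.2 (fun h => hij (Subtype.ext h))
      refine ⟨⟨u, IntermediateField.subset_adjoin _ _ hu⟩, ?_, ?_⟩
      · simpa [V] using h1
      · simpa [V] using h2)
    c hc M (hcM.trans hM)
  simpa using this

theorem SUB_count2 {k Θ : Type*} [Field k] [IsAlgClosed k] [Field Θ] [Algebra k Θ]
    (p : ℕ) [Fact p.Prime] [CharP Θ p] (n : ℕ) (hn : n ≠ 0) (W : ValuationSubring Θ)
    (hk : ∀ x : k, algebraMap k Θ x ∈ W) (t : Θ) (htt : Transcendental k t)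
    (G E1 : Subfield Θ) (hG : ∀ x ∈ G, x ∈ W → W.valuation (x ^ (p ^ n) - x) < 1)
    (htE : t ∈ E1) (hroots : ∀ ω : Θ, ω ^ (p ^ n) = ω → ω ∈ E1)
    (L2 : IntermediateField k Θ) (hEL : ∀ x ∈ E1, x ∈ L2) (T : L2) (hT : Transcendental k T)
    [FiniteDimensional (IntermediateField.adjoin k {T}) L2] (M : ℕ)
    (hM : Module.finrank (IntermediateField.adjoin k {T}) L2 ≤ M)
    (P : Finset (Θ ≃ₐ[k] Θ)) (hPt : ∀ g ∈ P, g t ∉ W) (hPG : ∀ g ∈ P, ∀ x ∈ E1, g x ∈ G)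
    (F0 : Finset Θ) (hF0 : ∀ g ∈ P, ∀ x ∈ F0, g x ∈ F0)
    (hsep : ∀ g ∈ P, ∀ g' ∈ P, g ≠ g' → (∀ x ∈ F0, g x = g' x) → ∃ u ∈ E1, g u ∈ W ∧ g' u ∉ W) :
    P.card ≤ (M * (1 + (p ^ n + 1) * M)) * F0.card ^ F0.card := by
  classical
  let res : (Θ ≃ₐ[k] Θ) → (F0 → Option F0) := fun g x =>
    if h : g x.1 ∈ F0 then some ⟨g x.1, h⟩ else none
  have himg : (P.image res).card ≤ F0.card ^ F0.card := by
    calc (P.image res).card ≤ ((Finset.univ : Finset (F0 → F0)).image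
          (fun φ x => some (φ x))).card := by
          apply Finset.card_le_card
          intro φ hφ
          obtain ⟨g, hg, rfl⟩ := Finset.mem_image.mp hφ
          refine Finset.mem_image.mpr ⟨fun x => ⟨g x.1, hF0 g hg _ x.2⟩, Finset.mem_univ _, ?_⟩
          funext x
          simp [res, hF0 g hg _ x.2]
      _ ≤ (Finset.univ : Finset (F0 → F0)).card := Finset.card_image_le
      _ = _ := by simp
  refine (Finset.card_le_mul_card_image (f := res) P (M * (1 + (p ^ n + 1) * M)) ?_).trans
    (Nat.mul_le_mul_left _ himg)
  intro φ hφ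
  refine SUB_count p n hn W hk t htt G E1 hG htE hroots L2 hEL T hT M hM _
    (fun g hg => hPt g (Finset.mem_filter.mp hg).1)
    (fun g hg => hPG g (Finset.mem_filter.mp hg).1) ?_
  intro g hg g' hg' hne
  rw [Finset.mem_filter] at hg hg'
  refine hsep g hg.1 g' hg'.1 hne ?_
  intro x hx
  have := congrFun (hg.2.trans hg'.2.symm) ⟨x, hx⟩
  simp only [res, hF0 g hg.1 _ hx, hF0 g' hg'.1 _ hx, dif_pos] at this
  simpa using this
end

section
set_option linter.style.haveILetI false
open Polynomial

/-- automorphisms of the algebraic closure of `F0` in `Θ` extend to `Θ`. -/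
lemma SUB_extend {Θ' Θ : Type*} [Field Θ'] [Field Θ] [IsAlgClosed Θ] [Algebra Θ' Θ]
    (s : Θ' ≃+* Θ') : ∃ g : Θ ≃+* Θ, ∀ x, g (algebraMap Θ' Θ x) = algebraMap Θ' Θ (s x) := by
  obtain ⟨ι, hv⟩ := exists_isTranscendenceBasis Θ' Θ
  haveI := IsAlgClosed.isAlgClosure_of_transcendence_basis _ hv
  let e : Algebra.adjoin Θ' (Set.range (Subtype.val : ι → Θ)) ≃+* Algebra.adjoin Θ' (Set.range (Subtype.val : ι → Θ)) :=
    (hv.1.aevalEquiv.symm.toRingEquiv.trans (MvPolynomial.mapEquiv _ s)).trans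
      hv.1.aevalEquiv.toRingEquiv
  refine ⟨IsAlgClosure.equivOfEquiv Θ Θ e, fun x => ?_⟩
  have h1 : algebraMap Θ' Θ x = algebraMap (Algebra.adjoin Θ' (Set.range (Subtype.val : ι → Θ))) Θ
      (algebraMap Θ' _ x) := rfl
  have h2 : e (algebraMap Θ' _ x) = algebraMap Θ' _ (s x) := by
    simp only [e, RingEquiv.trans_apply]
    change hv.1.aevalEquiv (MvPolynomial.mapEquiv _ s (hv.1.aevalEquiv.symm (algebraMap Θ' _ x))) = _
    rw [AlgEquiv.commutes]
    rw [MvPolynomial.algebraMap_eq, MvPolynomial.mapEquiv_apply, MvPolynomial.map_C]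
    exact AlgEquiv.commutes _ _
  rw [h1, IsAlgClosure.equivOfEquiv_algebraMap, h2]
  rfl

lemma SUB_conj {K Θ : Type*} [Field K] [Field Θ] [IsAlgClosed Θ] [Algebra K Θ] (z z' : Θ)
    (hz : IsIntegral K z) (h : aeval z' (minpoly K z) = 0) : ∃ g : Θ ≃ₐ[K] Θ, g z = z' := by
  have hz' : IsIntegral K z' := ⟨minpoly K z, minpoly.monic hz, h⟩
  let y : algebraicClosure K Θ := ⟨z, mem_algebraicClosure_iff.mpr hz.isAlgebraic⟩
  let y' : algebraicClosure K Θ := ⟨z', mem_algebraicClosure_iff.mpr hz'.isAlgebraic⟩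
  haveI : Normal K (algebraicClosure K Θ) := IsAlgClosure.normal K _
  have hy : minpoly K y = minpoly K z := (minpoly.algebraMap_eq (algebraMap (algebraicClosure K Θ) Θ).injective y).symm
  have hy' : minpoly K y' = minpoly K z' := (minpoly.algebraMap_eq (algebraMap (algebraicClosure K Θ) Θ).injective y').symm
  have : IsConjRoot K y' y := by
    rw [IsConjRoot, hy, hy']
    exact (minpoly.eq_of_irreducible_of_monic (minpoly.irreducible hz) h (minpoly.monic hz)).symm
  obtain ⟨s, hs⟩ := isConjRoot_iff_exists_algEquiv.mp this
  obtain ⟨g, hg⟩ := SUB_extend (Θ := Θ) s.toRingEquiv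
  refine ⟨AlgEquiv.ofRingEquiv (f := g) fun x => ?_, ?_⟩
  · have := hg (algebraMap K _ x)
    rw [← IsScalarTower.algebraMap_apply] at this
    rw [this]
    change algebraMap _ Θ (s (algebraMap K _ x)) = _
    rw [AlgEquiv.commutes, ← IsScalarTower.algebraMap_apply]
  · have := hg y
    change g z = algebraMap _ Θ (s y) at this
    rw [hs] at this
    exact this

/-- A nonzero element integral over `k[t]` has a conjugate that is not small. -/
lemma SUB_norm {k Θ : Type*} [Field k] [IsAlgClosed k] [Field Θ] [IsAlgClosed Θ] [Algebra k Θ]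
    (W : ValuationSubring Θ) (hk : ∀ x : k, algebraMap k Θ x ∈ W) (t : Θ) (ht : t ∉ W)
    (z : Θ) (hz0 : z ≠ 0) (hz : (aeval t : k[X] →ₐ[k] Θ).toRingHom.IsIntegralElem z) :
    ∃ g : Θ ≃ₐ[k] Θ, g t = t ∧ 1 ≤ W.valuation (g z) := by
  have htt : Transcendental k t := SUB_transc_of_ne t (fun x hx => ht (hx ▸ hk x))
  let K0 := IntermediateField.adjoin k {t}
  let s : K0 := IntermediateField.AdjoinSimple.gen k t
  letI : Algebra k[X] K0 := (aeval s).toAlgebra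
  haveI : IsFractionRing k[X] K0 := SUB_fracRing t htt
  letI : Algebra k[X] Θ := (aeval t : k[X] →ₐ[k] Θ).toRingHom.toAlgebra
  haveI : IsScalarTower k[X] K0 Θ := by
    apply IsScalarTower.of_algebraMap_eq
    intro p
    change aeval t p = algebraMap K0 Θ (aeval s p)
    rw [← aeval_algebraMap_apply]
    rfl
  have hz' : IsIntegral k[X] z := hz
  have hzK : IsIntegral K0 z := hz'.tower_top
  have hmin := minpoly.isIntegrallyClosed_eq_field_fractions' K0 hz'
  set m := minpoly K0 z with hm
  have hsp := (IsAlgClosed.splits (m.map (algebraMap K0 Θ)))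
  have hmon : (m.map (algebraMap K0 Θ)).Monic := (minpoly.monic hzK).map _
  have hprod := hsp.coeff_zero_eq_prod_roots_of_monic hmon
  have hc0 : (m.map (algebraMap K0 Θ)).coeff 0 = aeval t ((minpoly k[X] z).coeff 0) := by
    rw [coeff_map, hmin, coeff_map, ← IsScalarTower.algebraMap_apply]
    rfl
  have hne : (minpoly k[X] z).coeff 0 ≠ 0 := by
    intro h
    have : m.coeff 0 = 0 := by rw [hmin, coeff_map, h, map_zero]
    exact hz0 ((minpoly.coeff_zero_eq_zero hzK).mp this)
  have ht1 : 1 < W.valuation t := by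
    rw [← not_le, W.valuation_le_one_iff]
    exact ht
  have hbig : 1 ≤ W.valuation (aeval t ((minpoly k[X] z).coeff 0)) := by
    rw [SUB_val_poly W hk t ht1 _ hne]
    exact one_le_pow₀ ht1.le
  rw [← hc0, hprod, map_mul, map_pow, Valuation.map_neg, map_one, one_pow, one_mul,
    map_multiset_prod] at hbig
  by_contra hcon
  push Not at hcon
  have hall : ∀ z' ∈ (m.map (algebraMap K0 Θ)).roots, W.valuation z' < 1 := by
    intro z' hz'
    have h1 := isRoot_of_mem_roots hz'
    obtain ⟨g, hg⟩ := SUB_conj (K := K0) z z' hzK (by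
      rw [IsRoot, eval_map_algebraMap] at h1
      exact h1)
    have h2 := hcon (g.restrictScalars k) (by
      have : t = algebraMap K0 Θ s := rfl
      rw [this]
      exact g.commutes s)
    rwa [← hg]
  have hnonempty : (m.map (algebraMap K0 Θ)).roots ≠ 0 := by
    have : z ∈ (m.map (algebraMap K0 Θ)).roots := by
      rw [mem_roots hmon.ne_zero, IsRoot, eval_map_algebraMap]
      exact minpoly.aeval _ _
    exact fun h => by simp [h] at this
  have hlt : ∀ s : Multiset Θ, (∀ z' ∈ s, W.valuation z' < 1) → s ≠ 0 → (s.map W.valuation).prod < 1 := by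
    intro s
    induction s using Multiset.induction_on with
    | empty => simp
    | cons a s ih =>
      intro h _
      rw [Multiset.map_cons, Multiset.prod_cons]
      have ha := h a (Multiset.mem_cons_self _ _)
      by_cases hs : s = 0
      · simpa [hs] using ha
      · have := ih (fun z hz => h z (Multiset.mem_cons_of_mem hz)) hs
        exact mul_lt_one_of_nonneg_of_lt_one_left (zero_le) ha this.le
  exact absurd hbig (not_le.mpr (hlt _ hall hnonempty))

lemma SUB_integral {R Θ : Type*} [CommRing R] [Field Θ] (f : R →+* Θ) (z : Θ)
    (h : ∀ V : ValuationSubring Θ, (∀ x, f x ∈ V) → z ∈ V) : f.IsIntegralElem z := by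
  have h1 : z ∈ (⨅ V : {V : ValuationSubring Θ // (Set.range f) ⊆ V.toSubring}, V.1.toSubring) := by
    rw [Subring.mem_iInf]
    rintro ⟨V, hV⟩
    exact h V (fun x => hV ⟨x, rfl⟩)
  rw [iInf_valuationSubring_superset] at h1
  have h2 : IsIntegral (Subring.closure (Set.range f)) z := h1
  obtain ⟨P, hP, he⟩ := h2
  have hcl : ∀ c : Subring.closure (Set.range f), ∃ x, f x = c := by
    intro c
    have h3 : (c : Θ) ∈ f.range := (Subring.closure_le (t := f.range)).mpr (by rintro _ ⟨x, rfl⟩; exact ⟨x, rfl⟩) c.2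
    exact h3
  have hl : P.map (algebraMap (Subring.closure (Set.range f)) Θ) ∈ lifts f := by
    rw [lifts_iff_coeff_lifts]
    intro n
    rw [coeff_map]
    exact hcl _
  obtain ⟨q, hq, -, hqm⟩ := lifts_and_degree_eq_and_monic hl (hP.map _)
  refine ⟨q, hqm, ?_⟩
  rw [eval₂_eq_eval_map, hq, eval_map]
  exact he

lemma SUB_integral_comp {R R' Θ : Type*} [CommRing R] [CommRing R'] [Field Θ] (f : R →+* R')
    (g : R' →+* Θ) (z : Θ) (h : (g.comp f).IsIntegralElem z) : g.IsIntegralElem z := by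
  obtain ⟨P, hP, he⟩ := h
  refine ⟨P.map f, hP.map _, ?_⟩
  rwa [eval₂_map]

/-- elements integral over an algebraically closed field lie in it -/
lemma SUB_range {Ω Θ : Type*} [Field Ω] [IsAlgClosed Ω] [Field Θ] (j : Ω →+* Θ) (P : Polynomial Ω)
    (hP : P ≠ 0) (x : Θ) (hx : (P.map j).IsRoot x) : ∃ y, P.IsRoot y ∧ j y = x := by
  have h1 := (IsAlgClosed.splits P).roots_map j
  have h2 : x ∈ (P.map j).roots := by
    rw [mem_roots (by simpa using hP)]; exact hx
  rw [h1] at h2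
  obtain ⟨y, hy, rfl⟩ := Multiset.mem_map.mp h2
  exact ⟨y, isRoot_of_mem_roots hy, rfl⟩

lemma SUB_pick {α β : Type*} (Γ : Set α) (ρ : α → β) (N : ℕ)
    (h : ∀ P : Finset α, (∀ x ∈ P, x ∈ Γ) → Set.InjOn ρ P → P.card ≤ N) :
    ∃ P : Finset α, P.card ≤ N ∧ (∀ x ∈ P, x ∈ Γ) ∧ ∀ x ∈ Γ, ∃ y ∈ P, ρ x = ρ y := by
  classical
  let p : ℕ → Prop := fun n => ∃ P : Finset α, (∀ x ∈ P, x ∈ Γ) ∧ Set.InjOn ρ P ∧ P.card = n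
  have h0 : p 0 := ⟨∅, by simp, by simp, rfl⟩
  obtain ⟨P, h1, h2, h3⟩ := Nat.findGreatest_spec (P := p) (Nat.zero_le N) h0
  refine ⟨P, h P h1 h2, h1, fun x hx => ?_⟩
  by_contra hcon
  push Not at hcon
  have hxP : x ∉ P := fun hxP => hcon x hxP rfl
  have h4 : p (P.card + 1) := by
    refine ⟨insert x P, ?_, ?_, Finset.card_insert_of_notMem hxP⟩
    · intro y hy
      rcases Finset.mem_insert.mp hy with rfl | hy
      · exact hx
      · exact h1 y hy
    · rw [Finset.coe_insert, Set.injOn_insert (by simpa using hxP)]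
      refine ⟨h2, ?_⟩
      rintro ⟨y, hy, he⟩
      exact hcon y hy he.symm
  obtain ⟨Q, q1, q2, q3⟩ := h4
  have h5 : P.card + 1 ≤ N := q3 ▸ h Q q1 q2
  have h6 := Nat.le_findGreatest (P := p) h5 (⟨Q, q1, q2, q3⟩ : p (P.card + 1))
  omega
end

section
set_option linter.style.haveILetI false
open Polynomial

lemma SUB_val_monic {Θ : Type*} [Field Θ] (V : ValuationSubring Θ) (P : Polynomial Θ) (hP : P.Monic)
    (hc : ∀ i, P.coeff i ∈ V) (w : Θ) (hw : 1 < V.valuation w) :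
    V.valuation (P.eval w) = V.valuation w ^ P.natDegree := by
  have hw0 : (0 : V.ValueGroup) < V.valuation w := lt_trans zero_lt_one hw
  rw [eval_eq_sum_range, Finset.sum_range_succ, hP.coeff_natDegree, one_mul, ← map_pow]
  apply Valuation.map_add_eq_of_lt_right
  apply Valuation.map_sum_lt
  · rw [map_pow]
    exact (pow_pos hw0 _).ne'
  · intro i hi
    rw [map_mul, map_pow, map_pow]
    calc V.valuation (P.coeff i) * V.valuation w ^ i ≤ 1 * V.valuation w ^ i := by
          gcongr
          exact (V.valuation_le_one_iff _).mpr (hc i)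
      _ = V.valuation w ^ i := one_mul _
      _ < _ := pow_lt_pow_right₀ hw (Finset.mem_range.mp hi)

lemma SUB_prep_int {R Θ : Type*} [CommRing R] [Field Θ] (f : R →+* Θ) (a b : R[X])
    (ha : a.Monic) (hb : b.Monic) (hdeg : b.natDegree + 1 < a.natDegree) (s : Θ)
    (hs : IsPreperiodic (ratP1Map (a.map f) (b.map f)) (some s)) : f.IsIntegralElem s := by
  apply SUB_integral
  intro V hV
  have hA : ∀ w, 1 < V.valuation w → V.valuation ((a.map f).eval w) = V.valuation w ^ a.natDegree := by
    intro w hw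
    rw [SUB_val_monic V _ (ha.map f) (fun i => by rw [coeff_map]; exact hV _) w hw, ha.natDegree_map]
  have hB : ∀ w, 1 < V.valuation w → V.valuation ((b.map f).eval w) = V.valuation w ^ b.natDegree := by
    intro w hw
    rw [SUB_val_monic V _ (hb.map f) (fun i => by rw [coeff_map]; exact hV _) w hw, hb.natDegree_map]
  have := SUB_escape (a.map f) (b.map f) V.valuation (fun w => 1 < V.valuation w) (by
    intro w hw
    have hw0 : (0 : V.ValueGroup) < V.valuation w := lt_trans zero_lt_one hw
    have hBp : 0 < V.valuation ((b.map f).eval w) := by rw [hB w hw]; exact pow_pos hw0 _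
    have hlt : V.valuation w < V.valuation ((a.map f).eval w / (b.map f).eval w) := by
      rw [map_div₀, lt_div_iff₀ hBp, hA w hw, hB w hw, ← pow_succ']
      exact pow_lt_pow_right₀ hw hdeg
    refine ⟨?_, hw.trans hlt, hlt⟩
    intro h
    rw [h, map_zero] at hBp
    exact lt_irrefl _ hBp) (some s) hs 0 s rfl
  rw [← V.valuation_le_one_iff]
  exact not_lt.mp this
end

section
set_option linter.style.haveILetI false
open Polynomial

lemma SUB_root_map {Θ : Type*} [Field Θ] (A : Polynomial Θ) (g : Θ →+* Θ) (hg : A.map g = A) (x : Θ) :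
    A.IsRoot (g x) ↔ A.IsRoot x := by
  conv_lhs => rw [← hg]
  rw [IsRoot, eval_map_apply, map_eq_zero, IsRoot]

lemma SUB_eval_fix {Θ : Type*} [Field Θ] (A : Polynomial Θ) (g : Θ →+* Θ) (hg : A.map g = A) (x : Θ) :
    g (A.eval x) = A.eval (g x) := by
  conv_rhs => rw [← hg]
  rw [eval_map_apply]

lemma SUB_root_j {Ω Θ : Type*} [Field Ω] [Field Θ] (j : Ω →+* Θ) (A : Polynomial Ω) (x : Ω) :
    (A.map j).IsRoot (j x) ↔ A.IsRoot x := by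
  rw [IsRoot, eval_map_apply, map_eq_zero, IsRoot]

/-- The separating element. -/
lemma SUB_sepu {k Ω Θ : Type*} [Field Ω] [IsAlgClosed Ω] [Field k] [Field Θ] [Algebra k Θ]
    (jΩ : Ω →+* Θ) {v : AbsoluteValue Ω ℝ} {A B : Polynomial Ω} {R : ℝ} {r : Ω → ℝ}
    (H : SUB_Dyn v A B R r) (W : ValuationSubring Θ) (hW : ∀ x, jΩ x ∈ W ↔ v x ≤ 1)
    (α0 : Ω) (hα0 : A.IsRoot α0) (hR : v α0 = R)
    (E1 : Subfield Θ) (A1 B1 : Polynomial E1) (hA1 : A1.map E1.subtype = A.map jΩ)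
    (hB1 : B1.map E1.subtype = B.map jΩ)
    (hEA : ∀ x, (A.map jΩ).IsRoot x → x ∈ E1)
    (s : Θ) (hs : s ∈ E1) (g g' : Θ ≃ₐ[k] Θ)
    (hgA : (A.map jΩ).map (g : Θ →+* Θ) = A.map jΩ) (hgB : (B.map jΩ).map (g : Θ →+* Θ) = B.map jΩ)
    (hgA' : (A.map jΩ).map (g' : Θ →+* Θ) = A.map jΩ) (hgB' : (B.map jΩ).map (g' : Θ →+* Θ) = B.map jΩ)
    (hagA : ∀ x, (A.map jΩ).IsRoot x → g x = g' x) (hagB : ∀ x, (B.map jΩ).IsRoot x → g x = g' x)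
    (x y : Ω) (hx : jΩ x = g s) (hy : jΩ y = g' s) (hgx : SUB_Good v A B R (some x))
    (hgy : SUB_Good v A B R (some y)) (hne : g s ≠ g' s) :
    ∃ u ∈ E1, g u ∈ W ∧ g' u ∉ W := by
  obtain ⟨m, x', y', e1, e2, hn, hsep⟩ := H.separate α0 hR x y hgx hgy
    (fun h => hne (by rw [← hx, ← hy, h]))
  -- the iterate of `s`
  have hsx : ((ratP1Map (A.map jΩ) (B.map jΩ))^[m] (some s)).map (g : Θ →+* Θ) = some (jΩ x') := by
    rw [← SUB_rat_iter, hgA, hgB]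
    have := SUB_rat_iter jΩ A B m (some x)
    rw [e1] at this
    simp only [Option.map_some] at this ⊢
    rw [← this, hx]
    rfl
  have hsy : ((ratP1Map (A.map jΩ) (B.map jΩ))^[m] (some s)).map (g' : Θ →+* Θ) = some (jΩ y') := by
    rw [← SUB_rat_iter, hgA', hgB']
    have := SUB_rat_iter jΩ A B m (some y)
    rw [e2] at this
    simp only [Option.map_some] at this ⊢
    rw [← this, hy]
    rfl
  obtain ⟨w, hw, hwx⟩ := Option.map_eq_some_iff.mp hsx
  rw [hw, Option.map_some] at hsy
  have hwy : (g' : Θ →+* Θ) w = jΩ y' := Option.some_injective _ hsy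
  have hwx' : g w = jΩ x' := hwx
  have hwy' : g' w = jΩ y' := hwy
  have hwE : w ∈ E1 := by
    have := SUB_rat_iter E1.subtype A1 B1 m (some ⟨s, hs⟩)
    rw [hA1, hB1] at this
    simp only [Option.map_some, Subfield.subtype_apply] at this
    rw [hw] at this
    obtain ⟨w1, -, h1⟩ := Option.map_eq_some_iff.mp this.symm
    rw [← h1]
    exact w1.2
  have hBroot : (B.map jΩ).IsRoot w → False := by
    intro h
    have := hagB w h
    rw [hwx', hwy'] at this
    exact hn (jΩ.injective this)
  rcases hsep with h | h | ⟨α, hα, h1, h2⟩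
  · exfalso
    apply hBroot
    rw [← SUB_root_map _ _ hgB w, hwx, SUB_root_j]
    exact h
  · exfalso
    apply hBroot
    rw [← SUB_root_map _ _ hgB' w, hwy, SUB_root_j]
    exact h
  · have hdA : (A.map jΩ).derivative.map (g : Θ →+* Θ) = (A.map jΩ).derivative := by
      rw [← derivative_map, hgA]
    have hdA' : (A.map jΩ).derivative.map (g' : Θ →+* Θ) = (A.map jΩ).derivative := by
      rw [← derivative_map, hgA']
    have hδ : ∀ β, A.IsRoot β → ∃ δ ∈ E1, g δ = jΩ β ∧ g' δ = jΩ β := by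
      intro β hβ
      have h3 : (A.map jΩ).IsRoot (g.symm (jΩ β)) := by
        rw [← SUB_root_map _ _ hgA]
        simp only [RingHom.coe_coe, AlgEquiv.apply_symm_apply]
        rwa [SUB_root_j]
      refine ⟨g.symm (jΩ β), hEA _ h3, AlgEquiv.apply_symm_apply _ _, ?_⟩
      rw [← hagA _ h3, AlgEquiv.apply_symm_apply]
    obtain ⟨δ, hδE, hδ1, hδ2⟩ := hδ α hα
    obtain ⟨δ0, hδ0E, hδ01, hδ02⟩ := hδ α0 hα0
    have key : ∀ (g : Θ ≃ₐ[k] Θ) (x' : Ω), (B.map jΩ).map (g : Θ →+* Θ) = B.map jΩ →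
        (A.map jΩ).derivative.map (g : Θ →+* Θ) = (A.map jΩ).derivative →
        g w = jΩ x' → g δ = jΩ α → g δ0 = jΩ α0 →
        g ((w - δ) * (A.map jΩ).derivative.eval δ / (δ0 * (B.map jΩ).eval δ)) =
          jΩ ((x' - α) * A.derivative.eval α / (α0 * B.eval α)) := by
      intro g x' hB hA k1 k2 k3
      have e1 : g ((A.map jΩ).derivative.eval δ) = (A.map jΩ).derivative.eval (g δ) :=
        SUB_eval_fix _ _ hA δ
      have e2 : g ((B.map jΩ).eval δ) = (B.map jΩ).eval (g δ) := SUB_eval_fix _ _ hB δ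
      rw [map_div₀, map_mul, map_mul, map_sub, e1, e2, k1, k2, k3, derivative_map, eval_map_apply,
        eval_map_apply]
      simp
    refine ⟨(w - δ) * (A.map jΩ).derivative.eval δ / (δ0 * (B.map jΩ).eval δ), ?_, ?_, ?_⟩
    · have m1 : (A.map jΩ).derivative.eval δ ∈ E1 := by
        rw [← hA1, derivative_map]
        have := eval_map_apply E1.subtype (p := A1.derivative) (x := ⟨δ, hδE⟩)
        rw [Subfield.subtype_apply] at this
        rw [this]
        exact Subtype.property _
      have m2 : (B.map jΩ).eval δ ∈ E1 := by
        rw [← hB1]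
        have := eval_map_apply E1.subtype (p := B1) (x := ⟨δ, hδE⟩)
        rw [Subfield.subtype_apply] at this
        rw [this]
        exact Subtype.property _
      exact E1.div_mem (E1.mul_mem (E1.sub_mem hwE hδE) m1) (E1.mul_mem hδ0E m2)
    · rw [key g x' hgB hdA hwx' hδ1 hδ01, hW]
      exact h1
    · rw [key g' y' hgB' hdA' hwy' hδ2 hδ02, hW]
      exact not_le.mpr h2
end

section
set_option linter.style.haveILetI false
open Polynomial

set_option maxHeartbeats 1000000 in
theorem SUB_core {F Ω k Θ : Type*} [Field F] [Field Ω] [IsAlgClosed Ω] [Field k] [IsAlgClosed k]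
    [Field Θ] [IsAlgClosed Θ] [Algebra k Θ] (eF : F →+* Ω) (iF : F →+* k) (jΩ : Ω →+* Θ)
    (hj : ∀ x, jΩ (eF x) = algebraMap k Θ (iF x)) (p : ℕ) [Fact p.Prime] [CharP Θ p]
    (a b : F[X][X]) (ha : a.Monic) (hb : b.Monic) (hdeg : b.natDegree + 1 < a.natDegree)
    (t0 : Ω) {v : AbsoluteValue Ω ℝ} {A B : Polynomial Ω} {R : ℝ} {r : Ω → ℝ}
    (hA : A = a.map (eval₂RingHom eF t0)) (hB : B = b.map (eval₂RingHom eF t0))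
    (H : SUB_Dyn v A B R r) (ht0 : 1 < v t0)
    (W : ValuationSubring Θ) (hk : ∀ x : k, algebraMap k Θ x ∈ W) (hW : ∀ x, jΩ x ∈ W ↔ v x ≤ 1)
    (α0 : Ω) (hα0 : A.IsRoot α0) (hR : v α0 = R)
    (n : ℕ) (hn : n ≠ 0) (G : Subfield Ω) (hGF : ∀ x, eF x ∈ G) (hGt : t0 ∈ G)
    (hGA : ∀ x, A.IsRoot x → x ∈ G) (hGB : ∀ x, B.IsRoot x → x ∈ G)
    (hGP : ∀ x, IsPreperiodic (ratP1Map A B) (some x) → x ∈ G)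
    (hGω : ∀ ω : Ω, ω ^ (p ^ n) = ω → ω ∈ G) (hGres : ∀ x ∈ G, v x ≤ 1 → v (x ^ (p ^ n) - x) < 1)
    (M : ℕ) :
    ∃ Bd : ℕ, ∀ (L2 : IntermediateField k Θ) (T : L2), Transcendental k T →
      FiniteDimensional (IntermediateField.adjoin k {T}) L2 →
      Module.finrank (IntermediateField.adjoin k {T}) L2 ≤ M →
      jΩ t0 ∈ L2 → (∀ α, A.IsRoot α → jΩ α ∈ L2) → (∀ α, B.IsRoot α → jΩ α ∈ L2) →
      ∀ S : Finset Θ, (∀ s ∈ S, s ∈ L2) →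
      (∀ s ∈ S, IsPreperiodic (ratP1Map (A.map jΩ) (B.map jΩ)) (some s)) → S.card ≤ Bd := by
  classical
  obtain ⟨N0, hN0⟩ := H.itin α0 hR
  obtain ⟨Lab, hLab⟩ := H.labT
  have hA0 : A ≠ 0 := H.hA.ne_zero
  have hB0 : B ≠ 0 := H.hB.ne_zero
  let F0 : Finset Θ := (A.map jΩ).roots.toFinset ∪ (B.map jΩ).roots.toFinset
  have hF0 : ∀ x, x ∈ F0 ↔ (A.map jΩ).IsRoot x ∨ (B.map jΩ).IsRoot x := by
    intro x
    simp only [F0, Finset.mem_union, Multiset.mem_toFinset]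
    rw [mem_roots ((Polynomial.map_ne_zero_iff jΩ.injective).mpr hA0),
      mem_roots ((Polynomial.map_ne_zero_iff jΩ.injective).mpr hB0)]
  let N := (M * (1 + (p ^ n + 1) * M)) * F0.card ^ F0.card
  refine ⟨(Lab.card ^ N0) ^ N, ?_⟩
  intro L2 T hT hfin hM htL hAL hBL S hSL hS
  set t : Θ := jΩ t0 with ht
  have htW : t ∉ W := by rw [ht, hW]; exact not_le.mpr ht0
  have htt : Transcendental k t := SUB_transc_of_ne t (fun x hx => htW (hx ▸ hk x))
  -- the structure map
  let φ : F[X] →+* Θ := jΩ.comp (eval₂RingHom eF t0)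
  have hAφ : A.map jΩ = a.map φ := by rw [hA, Polynomial.map_map]
  have hBφ : B.map jΩ = b.map φ := by rw [hB, Polynomial.map_map]
  have hφ : φ = (aeval t : k[X] →ₐ[k] Θ).toRingHom.comp (mapRingHom iF) := by
    apply Polynomial.ringHom_ext
    · intro x; simp [φ, hj]
    · simp [φ, ht]
  have h_itg : ∀ s, IsPreperiodic (ratP1Map (A.map jΩ) (B.map jΩ)) (some s) → φ.IsIntegralElem s := by
    intro s hs
    rw [hAφ, hBφ] at hs
    exact SUB_prep_int φ a b ha hb hdeg s hs
  have hlift : ∀ s, IsPreperiodic (ratP1Map (A.map jΩ) (B.map jΩ)) (some s) →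
      ∃ y, jΩ y = s ∧ IsPreperiodic (ratP1Map A B) (some y) := by
    intro s hs
    obtain ⟨P, hP, he⟩ := SUB_integral_comp _ jΩ s (h_itg s hs)
    obtain ⟨y, -, hy⟩ := SUB_range jΩ P hP.ne_zero s (by rw [IsRoot, eval_map]; exact he)
    refine ⟨y, hy, ?_⟩
    rw [← SUB_prep_map jΩ, Option.map_some, hy]
    exact hs
  -- automorphisms fixing t
  let Γ : Set (Θ ≃ₐ[k] Θ) := {g | g t = t}
  have hgφ : ∀ g ∈ Γ, ((g : Θ ≃ₐ[k] Θ) : Θ →+* Θ).comp φ = φ := by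
    intro g hg
    apply Polynomial.ringHom_ext
    · intro x
      simp [φ, hj]
    · have hg' : g (jΩ t0) = jΩ t0 := hg
      simpa [φ] using hg'
  have hgA : ∀ g ∈ Γ, (A.map jΩ).map ((g : Θ ≃ₐ[k] Θ) : Θ →+* Θ) = A.map jΩ := by
    intro g hg
    rw [hAφ, Polynomial.map_map, hgφ g hg]
  have hgB : ∀ g ∈ Γ, (B.map jΩ).map ((g : Θ ≃ₐ[k] Θ) : Θ →+* Θ) = B.map jΩ := by
    intro g hg
    rw [hBφ, Polynomial.map_map, hgφ g hg]
  have hgP : ∀ g ∈ Γ, ∀ s, IsPreperiodic (ratP1Map (A.map jΩ) (B.map jΩ)) (some s) →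
      IsPreperiodic (ratP1Map (A.map jΩ) (B.map jΩ)) (some ((g : Θ ≃ₐ[k] Θ) s)) := by
    intro g hg s hs
    have := (SUB_prep_map ((g : Θ ≃ₐ[k] Θ) : Θ →+* Θ) (A.map jΩ) (B.map jΩ) (some s)).mpr hs
    rw [hgA g hg, hgB g hg] at this
    exact this
  -- the field of definition
  let gens : Set Θ := Set.range φ ∪ F0 ∪ {ω | ω ^ (p ^ n) = ω} ∪ S
  let E1 : Subfield Θ := Subfield.closure gens
  have hsub : ∀ x ∈ gens, x ∈ E1 := fun x hx => Subfield.subset_closure hx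
  have hEφ : ∀ x, φ x ∈ E1 := fun x => hsub _ (Or.inl (Or.inl (Or.inl ⟨x, rfl⟩)))
  have hEF0 : ∀ x ∈ F0, x ∈ E1 := fun x hx => hsub _ (Or.inl (Or.inl (Or.inr hx)))
  have hEω : ∀ ω : Θ, ω ^ (p ^ n) = ω → ω ∈ E1 := fun x hx => hsub _ (Or.inl (Or.inr hx))
  have hES : ∀ s ∈ S, s ∈ E1 := fun x hx => hsub _ (Or.inr hx)
  have htE : t ∈ E1 := by
    have := hEφ X
    simpa [φ] using this
  have hGφ : ∀ x : F[X], eval₂RingHom eF t0 x ∈ G := by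
    intro x
    rw [coe_eval₂RingHom, eval₂_eq_sum_range]
    exact G.sum_mem fun i _ => G.mul_mem (hGF _) (G.pow_mem hGt _)
  have h1Q : 1 < p ^ n := Nat.one_lt_pow hn (Fact.out : p.Prime).one_lt
  have hXne : ∀ (R : Type _) [Field R], (X ^ (p ^ n) - X : Polynomial R) ≠ 0 := by
    intro R _
    apply Monic.ne_zero
    apply monic_X_pow_sub
    rw [degree_X]
    exact_mod_cast h1Q
  have hXne' : (X ^ (p ^ n) - X : Polynomial k) ≠ 0 := by
    apply Monic.ne_zero
    apply monic_X_pow_sub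
    rw [degree_X]
    exact_mod_cast h1Q
  have hωlift : ∀ ω : Θ, ω ^ (p ^ n) = ω → ∃ y : Ω, y ^ (p ^ n) = y ∧ jΩ y = ω := by
    intro ω hω
    obtain ⟨y, hy, h⟩ := SUB_range jΩ (X ^ (p ^ n) - X) (hXne Ω) ω (by simp [IsRoot, hω])
    refine ⟨y, ?_, h⟩
    simpa [IsRoot, sub_eq_zero] using hy
  have hωk : ∀ ω : Θ, ω ^ (p ^ n) = ω → ∃ y : k, algebraMap k Θ y = ω := by
    intro ω hω
    obtain ⟨y, hy, h⟩ := SUB_range (algebraMap k Θ) (X ^ (p ^ n) - X) hXne' ω (by simp [IsRoot, hω])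
    exact ⟨y, h⟩
  have hgF0 : ∀ g ∈ Γ, ∀ x ∈ F0, (g : Θ ≃ₐ[k] Θ) x ∈ F0 := by
    intro g hg x hx
    rw [hF0] at hx ⊢
    have h1 := SUB_root_map _ _ (hgA g hg) x
    have h2 := SUB_root_map _ _ (hgB g hg) x
    exact hx.imp h1.mpr h2.mpr
  have hF0lift : ∀ x ∈ F0, x ∈ G.map jΩ := by
    intro x hx
    rw [hF0] at hx
    rcases hx with hx | hx
    · obtain ⟨y, hy, rfl⟩ := SUB_range jΩ A hA0 x hx
      exact ⟨y, hGA y hy, rfl⟩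
    · obtain ⟨y, hy, rfl⟩ := SUB_range jΩ B hB0 x hx
      exact ⟨y, hGB y hy, rfl⟩
  have hgE : ∀ g ∈ Γ, ∀ x ∈ E1, (g : Θ ≃ₐ[k] Θ) x ∈ G.map jΩ := by
    intro g hg
    have : E1 ≤ (G.map jΩ).comap ((g : Θ ≃ₐ[k] Θ) : Θ →+* Θ) := by
      rw [Subfield.closure_le]
      rintro x (((⟨y, rfl⟩ | hx) | hx) | hx)
      · change g (φ y) ∈ G.map jΩ
        have : g (φ y) = φ y := RingHom.congr_fun (hgφ g hg) y
        rw [this]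
        exact ⟨_, hGφ y, rfl⟩
      · exact hF0lift _ (hgF0 g hg x hx)
      · obtain ⟨y, hy, h⟩ := hωlift (g x) (by rw [← map_pow, hx])
        exact ⟨y, hGω y hy, h⟩
      · obtain ⟨y, h, hy⟩ := hlift _ (hgP g hg x (hS x hx))
        exact ⟨y, hGP y hy, h⟩
    exact this
  have hEL : ∀ x ∈ E1, x ∈ L2 := by
    have : E1 ≤ L2.toSubfield := by
      rw [Subfield.closure_le]
      rintro x (((⟨y, rfl⟩ | hx) | hx) | hx)
      · change φ y ∈ L2
        rw [hφ]
        change aeval t (y.map iF) ∈ L2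
        rw [aeval_eq_sum_range]
        exact L2.sum_mem fun i _ => L2.smul_mem (pow_mem htL i)
      · have := (hF0 x).mp hx
        rcases this with hx | hx
        · obtain ⟨y, hy, rfl⟩ := SUB_range jΩ A hA0 x hx
          exact hAL y hy
        · obtain ⟨y, hy, rfl⟩ := SUB_range jΩ B hB0 x hx
          exact hBL y hy
      · obtain ⟨y, rfl⟩ := hωk x hx
        exact L2.algebraMap_mem y
      · exact hSL x hx
    exact this
  have hcomap : ∀ x : Ω, W.valuation (jΩ x) < 1 ↔ v x < 1 := by
    intro x
    by_cases hx : x = 0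
    · simp [hx]
    · have h1 := hW x⁻¹
      have hx' : jΩ x ≠ 0 := by simpa using hx
      rw [← W.valuation_le_one_iff, map_inv₀, map_inv₀, map_inv₀,
        inv_le_one₀ (zero_lt_iff.mpr (by simpa using hx')), inv_le_one₀ (v.pos hx)] at h1
      rw [← not_le, ← not_le, h1]
  have hGr : ∀ x ∈ G.map jΩ, x ∈ W → W.valuation (x ^ (p ^ n) - x) < 1 := by
    rintro _ ⟨y, hy, rfl⟩ hyW
    rw [← map_pow, ← map_sub, hcomap]
    exact hGres y hy ((hW y).mp hyW)
  -- coefficients in E1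
  have hliftE : ∀ c : F[X][X], ∃ c1 : Polynomial E1, c1.map E1.subtype = c.map φ := by
    intro c
    refine ⟨c.map (φ.codRestrict E1 hEφ), ?_⟩
    rw [Polynomial.map_map]
    rfl
  obtain ⟨A1, hA1⟩ := hliftE a
  obtain ⟨B1, hB1⟩ := hliftE b
  rw [← hAφ] at hA1
  rw [← hBφ] at hB1
  -- counting
  obtain ⟨P, hPN, hPΓ, hPall⟩ := SUB_pick Γ (fun g => fun x : (S ∪ F0 : Finset Θ) => g x.1) N (by
    intro P hP hinj
    refine SUB_count2 p n hn W hk t htt (G.map jΩ) E1 hGr htE hEω L2 hEL T hT M hM P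
      (fun g hg => by have : g t = t := hP g hg; rwa [this]) (fun g hg => hgE g (hP g hg)) F0
      (fun g hg => hgF0 g (hP g hg)) ?_
    intro g hg g' hg' hne hag
    have : ∃ s ∈ S, g s ≠ g' s := by
      by_contra hcon
      push Not at hcon
      apply hne
      apply hinj hg hg'
      funext x
      rcases Finset.mem_union.mp x.2 with hx | hx
      · exact hcon _ hx
      · exact hag _ hx
    obtain ⟨s, hs, hss⟩ := this
    obtain ⟨x, hx, hxp⟩ := hlift _ (hgP g (hP g hg) s (hS s hs))
    obtain ⟨y, hy, hyp⟩ := hlift _ (hgP g' (hP g' hg') s (hS s hs))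
    exact SUB_sepu jΩ H W hW α0 hα0 hR E1 A1 B1 hA1 hB1
      (fun x hx => hEF0 x ((hF0 x).mpr (Or.inl hx))) s (hES s hs) g g' (hgA g (hP g hg))
      (hgB g (hP g hg)) (hgA g' (hP g' hg')) (hgB g' (hP g' hg'))
      (fun x hx => hag x ((hF0 x).mpr (Or.inl hx))) (fun x hx => hag x ((hF0 x).mpr (Or.inr hx)))
      x y hx hy (H.prep_good hxp) (H.prep_good hyp) hss)
  -- pigeonhole
  by_contra hcard
  push Not at hcard
  have hch : ∀ (g : P) (s : S), ∃ y, jΩ y = g.1 s.1 ∧ IsPreperiodic (ratP1Map A B) (some y) :=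
    fun g s => hlift _ (hgP g.1 (hPΓ g.1 g.2) s.1 (hS s.1 s.2))
  choose pre hpre1 hpre2 using hch
  let itin : S → (P → Fin N0 → Lab) := fun s g i =>
    ⟨SUB_lab v A B r ((ratP1Map A B)^[i.1] (some (pre g s))), hLab _⟩
  have hLpos : 1 ≤ Lab.card := Finset.card_pos.mpr ⟨_, hLab none⟩
  have hlt : Fintype.card (P → Fin N0 → Lab) < Fintype.card S := by
    simp only [Fintype.card_fun, Fintype.card_coe, Fintype.card_fin]
    refine lt_of_le_of_lt ?_ hcard
    exact Nat.pow_le_pow_right (Nat.one_le_pow _ _ hLpos) hPN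
  obtain ⟨x, y, hxy, he⟩ := Fintype.exists_ne_map_eq_of_card_lt itin hlt
  have hclose : ∀ g ∈ P, W.valuation (g (x.1 - y.1)) < 1 := by
    intro g hg
    have h1 := hN0 (pre ⟨g, hg⟩ x) (pre ⟨g, hg⟩ y) (H.prep_good (hpre2 _ _)) (H.prep_good (hpre2 _ _))
      (by
        intro i hi
        have := congrFun (congrFun he ⟨g, hg⟩) ⟨i, hi⟩
        exact congrArg Subtype.val this)
    rw [← hcomap, map_sub, hpre1, hpre1] at h1
    rwa [map_sub]
  have hclose' : ∀ g ∈ Γ, W.valuation ((g : Θ ≃ₐ[k] Θ) (x.1 - y.1)) < 1 := by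
    intro g hg
    obtain ⟨g', hg', h⟩ := hPall g hg
    have e1 := congrFun h ⟨x.1, Finset.mem_union_left _ x.2⟩
    have e2 := congrFun h ⟨y.1, Finset.mem_union_left _ y.2⟩
    simp only at e1 e2
    have := hclose g' hg'
    rwa [map_sub, ← e1, ← e2, ← map_sub] at this
  have hz0 : x.1 - y.1 ≠ 0 := sub_ne_zero.mpr (fun h => hxy (Subtype.ext h))
  have hzint : (aeval t : k[X] →ₐ[k] Θ).toRingHom.IsIntegralElem (x.1 - y.1) := by
    have i1 := h_itg x.1 (hS x.1 x.2)
    have i2 := h_itg y.1 (hS y.1 y.2)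
    rw [hφ] at i1 i2
    exact RingHom.IsIntegralElem.sub _ (SUB_integral_comp _ _ _ i1) (SUB_integral_comp _ _ _ i2)
  obtain ⟨g, hg, hg1⟩ := SUB_norm W hk t htW _ hz0 hzint
  exact absurd (hclose' g hg) (not_lt.mpr hg1)
end

section
set_option linter.style.haveILetI false
open Polynomial IntermediateField

lemma SUB_tower1 {K1 Θ : Type*} [Field K1] [Field Θ] [Algebra K1 Θ] (E : IntermediateField K1 Θ)
    [FiniteDimensional K1 E] (m : ℕ) (x : Θ) (P : Polynomial Θ) (hP : P.Monic)
    (hd : P.natDegree ≤ m) (hc : ∀ i, P.coeff i ∈ E) (hx : P.IsRoot x) :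
    ∃ E' : IntermediateField K1 Θ, E ≤ E' ∧ x ∈ E' ∧ FiniteDimensional K1 E' ∧
      Module.finrank K1 E' ≤ m * Module.finrank K1 E := by
  have hl : P ∈ lifts (algebraMap E Θ) := by
    rw [lifts_iff_coeff_lifts]
    intro i
    exact ⟨⟨_, hc i⟩, rfl⟩
  obtain ⟨q, hq, hqd, hqm⟩ := lifts_and_natDegree_eq_and_monic hl hP
  have hroot : aeval x q = 0 := by
    rw [← eval_map_algebraMap, hq]; exact hx
  have h_itg : IsIntegral E x := ⟨q, hqm, hroot⟩
  haveI : FiniteDimensional E E⟮x⟯ := adjoin.finiteDimensional h_itg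
  haveI : Module.Free E E⟮x⟯ := Module.Free.of_divisionRing E E⟮x⟯
  haveI : Module.Free K1 E := Module.Free.of_divisionRing K1 E
  haveI : FiniteDimensional K1 E⟮x⟯ := FiniteDimensional.trans K1 E E⟮x⟯
  refine ⟨E⟮x⟯.restrictScalars K1, ?_, ?_, ?_, ?_⟩
  · intro y hy
    exact (E⟮x⟯).algebraMap_mem ⟨y, hy⟩
  · exact mem_adjoin_simple_self E x
  · exact this
  · change Module.finrank K1 E⟮x⟯ ≤ _
    rw [← Module.finrank_mul_finrank K1 E E⟮x⟯, adjoin.finrank h_itg, mul_comm]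
    apply Nat.mul_le_mul_right
    refine le_trans ?_ (hqd.trans_le hd)
    exact natDegree_le_of_dvd (minpoly.dvd E x hroot) hqm.ne_zero

lemma SUB_tower {K1 Θ : Type*} [Field K1] [Field Θ] [Algebra K1 Θ] (E : IntermediateField K1 Θ)
    [FiniteDimensional K1 E] (m : ℕ) (S : Finset Θ) (hS : ∀ x ∈ S, ∃ P : Polynomial Θ, P.Monic ∧
      P.natDegree ≤ m ∧ (∀ i, P.coeff i ∈ E) ∧ P.IsRoot x) :
    ∃ E' : IntermediateField K1 Θ, E ≤ E' ∧ (∀ x ∈ S, x ∈ E') ∧ FiniteDimensional K1 E' ∧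
      Module.finrank K1 E' ≤ m ^ S.card * Module.finrank K1 E := by
  classical
  induction S using Finset.induction_on with
  | empty => exact ⟨E, le_rfl, by simp, inferInstance, by simp⟩
  | insert a S ha ih =>
    obtain ⟨E1, h1, h2, h3, h4⟩ := ih (fun x hx => hS x (Finset.mem_insert_of_mem hx))
    obtain ⟨P, p1, p2, p3, p4⟩ := hS a (Finset.mem_insert_self _ _)
    haveI := h3
    obtain ⟨E2, e1, e2, e3, e4⟩ := SUB_tower1 E1 m a P p1 p2 (fun i => h1 (p3 i)) p4
    refine ⟨E2, h1.trans e1, ?_, e3, ?_⟩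
    · intro x hx
      rcases Finset.mem_insert.mp hx with rfl | hx
      · exact e2
      · exact e1 (h2 x hx)
    · rw [Finset.card_insert_of_notMem ha, pow_succ', mul_assoc]
      exact e4.trans (Nat.mul_le_mul_left _ h4)

/-- the embedding -/
lemma SUB_embed {k L Θ : Type*} [Field k] [Field L] [Field Θ] [IsAlgClosed Θ] [Algebra k L]
    [Algebra k Θ] (T : L) (hT : Transcendental k T) [FiniteDimensional k⟮T⟯ L] (σ : L)
    (hσ : Transcendental k σ) (t : Θ) (ht : Transcendental k t) : ∃ J : L →ₐ[k] Θ, J σ = t := by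
  haveI : FiniteDimensional k⟮σ⟯ L := SUB_fin_transc T _ hT (SUB_fracRing σ hσ)
  let s : k⟮σ⟯ := AdjoinSimple.gen k σ
  letI : Algebra k[X] k⟮σ⟯ := (aeval s).toAlgebra
  haveI : IsFractionRing k[X] k⟮σ⟯ := SUB_fracRing σ hσ
  have hinj : Function.Injective (aeval t : k[X] →ₐ[k] Θ).toRingHom :=
    transcendental_iff_injective.mp ht
  let l : k⟮σ⟯ →+* Θ := IsFractionRing.lift hinj
  have hl : ∀ p : k[X], l (aeval s p) = aeval t p := fun p => IsFractionRing.lift_algebraMap hinj p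
  letI : Algebra k⟮σ⟯ Θ := l.toAlgebra
  let J : L →ₐ[k⟮σ⟯] Θ := IsAlgClosed.lift
  refine ⟨{ J.toRingHom with commutes' := ?_ }, ?_⟩
  · intro c
    change J (algebraMap k L c) = _
    have h1 : algebraMap k L c = algebraMap k⟮σ⟯ L (aeval s (C c)) := by
      rw [aeval_C]; rfl
    rw [h1, J.commutes]
    change l _ = _
    rw [hl, aeval_C]
  · change J σ = t
    have h1 : σ = algebraMap k⟮σ⟯ L (aeval s (X : k[X])) := by rw [aeval_X]; rfl
    calc J σ = J (algebraMap k⟮σ⟯ L (aeval s (X : k[X]))) := congrArg J h1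
      _ = l (aeval s (X : k[X])) := J.commutes _
      _ = t := by rw [hl, aeval_X]

lemma SUB_finrank_lift {k Θ : Type*} [Field k] [Field Θ] [Algebra k Θ] (L2 : IntermediateField k Θ)
    (T : L2) (E : IntermediateField k⟮(T : Θ)⟯ Θ) (hE : E.restrictScalars k = L2)
    [FiniteDimensional k⟮(T : Θ)⟯ E] : FiniteDimensional k⟮T⟯ L2 ∧
      Module.finrank k⟮T⟯ L2 = Module.finrank k⟮(T : Θ)⟯ E := by
  have hlift : IntermediateField.lift k⟮T⟯ = k⟮(T : Θ)⟯ := lift_adjoin_simple k L2 T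
  let i : k⟮T⟯ ≃ₐ[k] k⟮(T : Θ)⟯ := (IntermediateField.liftAlgEquiv k⟮T⟯).trans (equivOfEq hlift)
  let j : L2 ≃ₐ[k] E.restrictScalars k := equivOfEq hE.symm
  have hfr : Module.finrank k⟮T⟯ L2 = Module.finrank k⟮(T : Θ)⟯ E := by
    refine Algebra.finrank_eq_of_equiv_equiv i.toRingEquiv (j.toRingEquiv : L2 ≃+* E) ?_
    ext x
    rfl
  refine ⟨?_, hfr⟩
  apply Module.finite_of_finrank_pos
  rw [hfr]
  exact Module.finrank_pos
end

section
set_option linter.style.haveILetI false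
open Polynomial IntermediateField

lemma SUB_hrat {k L k' Θ : Type*} [Field k] [Field L] [Field k'] [Field Θ] [Algebra (RatFunc k) L]
    [Algebra k' Θ] (J : L →+* Θ)
    (hJk : ∀ c : k, ∃ c' : k', J (algebraMap (RatFunc k) L (RatFunc.C c)) = algebraMap k' Θ c') :
    ∀ f : RatFunc k, J (algebraMap (RatFunc k) L f) ∈ k'⟮J (algebraMap (RatFunc k) L RatFunc.X)⟯ := by
  set T0 : Θ := J (algebraMap (RatFunc k) L RatFunc.X) with hT0
  let K1 := k'⟮T0⟯
  have hpoly : ∀ p : k[X], J (algebraMap (RatFunc k) L (algebraMap k[X] (RatFunc k) p)) ∈ K1 := by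
    intro p
    induction p using Polynomial.induction_on' with
    | add p q hp hq => simpa only [map_add] using K1.add_mem hp hq
    | monomial n c =>
      rw [← C_mul_X_pow_eq_monomial, map_mul, map_mul, map_mul, map_pow, map_pow, map_pow,
        RatFunc.algebraMap_C, RatFunc.algebraMap_X]
      obtain ⟨c', hc'⟩ := hJk c
      rw [hc']
      exact K1.mul_mem (K1.algebraMap_mem _) (pow_mem (mem_adjoin_simple_self k' T0) n)
  have hrat : ∀ f : RatFunc k, J (algebraMap (RatFunc k) L f) ∈ K1 := by
    intro f
    rw [← RatFunc.num_div_denom f, map_div₀, map_div₀]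
    exact K1.div_mem (hpoly _) (hpoly _)
  exact hrat

lemma SUB_makeL2 {k L k' Θ : Type*} [Field k] [Field L] [Field k'] [Field Θ] [Algebra (RatFunc k) L]
    [FiniteDimensional (RatFunc k) L] [Algebra k' Θ] (J : L →+* Θ)
    (hJk : ∀ c : k, ∃ c' : k', J (algebraMap (RatFunc k) L (RatFunc.C c)) = algebraMap k' Θ c')
    (m1 : ℕ) (hm1 : Module.finrank (RatFunc k) L ≤ m1) (F0 : Finset Θ) (m2 : ℕ)
    (hF0 : ∀ x ∈ F0, ∃ P : Polynomial Θ, P.Monic ∧ P.natDegree ≤ m2 ∧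
      (∀ E : IntermediateField k' Θ, (∀ x, J x ∈ E) → ∀ i, P.coeff i ∈ E) ∧ P.IsRoot x) :
    ∃ (L2 : IntermediateField k' Θ) (T : L2), (T : Θ) = J (algebraMap (RatFunc k) L RatFunc.X) ∧
      FiniteDimensional k'⟮T⟯ L2 ∧ Module.finrank k'⟮T⟯ L2 ≤ m2 ^ F0.card * m1 ^ m1 ∧
      (∀ x, J x ∈ L2) ∧ ∀ x ∈ F0, x ∈ L2 := by
  classical
  set T0 : Θ := J (algebraMap (RatFunc k) L RatFunc.X) with hT0
  let K1 := k'⟮T0⟯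
  have hrat : ∀ f : RatFunc k, J (algebraMap (RatFunc k) L f) ∈ K1 := SUB_hrat J hJk
  let bs := Module.finBasis (RatFunc k) L
  let S : Finset Θ := Finset.univ.image (fun i => J (bs i))
  have hScard : S.card ≤ m1 := by
    refine Finset.card_image_le.trans ?_
    simpa using hm1
  have hm1' : 1 ≤ m1 := le_trans Module.finrank_pos hm1
  obtain ⟨E1, -, hE1, hfd1, hfr1⟩ := SUB_tower (⊥ : IntermediateField K1 Θ) m1 S (by
    intro x hx
    obtain ⟨i, -, rfl⟩ := Finset.mem_image.mp hx
    have hi : IsIntegral (RatFunc k) (bs i) := Algebra.IsIntegral.isIntegral _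
    refine ⟨(minpoly (RatFunc k) (bs i)).map (J.comp (algebraMap (RatFunc k) L)),
      (minpoly.monic hi).map _, ?_, ?_, ?_⟩
    · rw [(minpoly.monic hi).natDegree_map]
      exact (minpoly.natDegree_le _).trans hm1
    · intro j
      rw [coeff_map]
      exact (⊥ : IntermediateField K1 Θ).algebraMap_mem ⟨_, hrat _⟩
    · rw [← Polynomial.map_map, IsRoot, eval_map_apply, eval_map_algebraMap, minpoly.aeval, map_zero])
  have hJE : ∀ x, J x ∈ E1 := by
    intro x
    rw [← bs.sum_repr x, map_sum]
    refine E1.sum_mem fun i _ => ?_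
    rw [Algebra.smul_def, map_mul]
    exact E1.mul_mem (E1.algebraMap_mem ⟨_, hrat _⟩) (hE1 _ (Finset.mem_image_of_mem _ (Finset.mem_univ i)))
  haveI := hfd1
  obtain ⟨E2, hle, hE2, hfd2, hfr2⟩ := SUB_tower E1 m2 F0 (by
    intro x hx
    obtain ⟨P, p1, p2, p3, p4⟩ := hF0 x hx
    exact ⟨P, p1, p2, p3 (E1.restrictScalars k') hJE, p4⟩)
  haveI := hfd2
  let L2 : IntermediateField k' Θ := E2.restrictScalars k'
  have hT0L : T0 ∈ L2 := E2.algebraMap_mem ⟨T0, mem_adjoin_simple_self k' T0⟩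
  obtain ⟨r1, r2⟩ := SUB_finrank_lift L2 ⟨T0, hT0L⟩ E2 rfl
  refine ⟨L2, ⟨T0, hT0L⟩, rfl, r1, ?_, fun x => hle (hJE x), hE2⟩
  rw [r2]
  refine hfr2.trans (Nat.mul_le_mul_left _ (hfr1.trans ?_))
  rw [IntermediateField.finrank_bot, mul_one]
  exact Nat.pow_le_pow_right hm1' hScard

/-- `T` transcendental and finite-dimensionality. -/
lemma SUB_ratfunc_fin {k L : Type*} [Field k] [Field L] [Algebra (RatFunc k) L] [Algebra k L]
    [IsScalarTower k (RatFunc k) L] [FiniteDimensional (RatFunc k) L] :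
    Transcendental k (algebraMap (RatFunc k) L RatFunc.X) ∧
      FiniteDimensional k⟮algebraMap (RatFunc k) L RatFunc.X⟯ L := by
  constructor
  · rw [transcendental_algebraMap_iff (algebraMap (RatFunc k) L).injective]
    exact RatFunc.transcendental_X
  · let K1 := k⟮algebraMap (RatFunc k) L RatFunc.X⟯
    have hr : ∀ f : RatFunc k, algebraMap (RatFunc k) L f ∈ K1 :=
      SUB_hrat (k := k) (L := L) (k' := k) (Θ := L) (RingHom.id L) (fun c => ⟨c, by
        rw [RingHom.id_apply, IsScalarTower.algebraMap_apply k (RatFunc k) L, RatFunc.algebraMap_eq_C]⟩)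
    letI : Algebra (RatFunc k) K1 := ((algebraMap (RatFunc k) L).codRestrict K1 hr).toAlgebra
    haveI : IsScalarTower (RatFunc k) K1 L := IsScalarTower.of_algebraMap_eq fun x => rfl
    exact FiniteDimensional.right (RatFunc k) K1 L
end

section
set_option linter.style.haveILetI false
open Polynomial IntermediateField

lemma SUB_mobius_id {Ξ : Type*} [Field Ξ] : mobiusMap (1 : Ξ) 0 0 1 = id := by
  funext z
  cases z with
  | none => simp [mobiusMap, ratP1Map]
  | some x => simp [mobiusMap, ratP1Map]

lemma SUB_isotriv {k Ξ : Type*} [Field k] [Field Ξ] [Algebra k Ξ] (p q : Polynomial Ξ) (hq : q ≠ 0)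
    (hp : ∀ n, IsAlgebraic k (p.coeff n)) (hq' : ∀ n, IsAlgebraic k (q.coeff n)) :
    IsotrivialMap (algebraMap k Ξ) (ratP1Map p q) := by
  have key : ∀ x : Ξ, IsAlgebraic k x → AlgebraicOver (algebraMap k Ξ) x := by
    rintro x ⟨f, hf, he⟩
    exact ⟨f, hf, by rw [IsRoot, eval_map_algebraMap]; exact he⟩
  refine ⟨1, 0, 0, 1, by simp, p, q, hq, fun n => key _ (hp n), fun n => key _ (hq' n), ?_⟩
  rw [neg_zero, SUB_mobius_id]
  rfl

lemma SUB_set_bound {α : Type*} (s : Set α) (N : ℕ) (h : ∀ S : Finset α, (S : Set α) ⊆ s → S.card ≤ N) :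
    s.Finite ∧ s.ncard ≤ N := by
  have hf : s.Finite := by
    by_contra hinf
    obtain ⟨S, hS, hc⟩ := Set.Infinite.exists_subset_card_eq hinf (N + 1)
    have := h S hS
    omega
  refine ⟨hf, ?_⟩
  rw [Set.ncard_eq_toFinset_card s hf]
  exact h _ (by simp)

open scoped Classical in
theorem SUB_perL {F Ω k k' Θ L : Type*} [Field F] [Field Ω] [Field k] [Field k']
    [Field Θ] [IsAlgClosed Θ] [Algebra k k'] [Algebra.IsAlgebraic k k'] [Algebra k' Θ] [Algebra F k]
    (eF : F →+* Ω) (jΩ : Ω →+* Θ)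
    (hj : ∀ x, jΩ (eF x) = algebraMap k' Θ (algebraMap k k' (algebraMap F k x)))
    (a b : F[X][X]) (ha : a.Monic) (hb : b.Monic) (hdeg : b.natDegree + 1 < a.natDegree)
    (t0 : Ω) {A B : Polynomial Ω}
    (hA : A = a.map (eval₂RingHom eF t0)) (hB : B = b.map (eval₂RingHom eF t0))
    (htt : Transcendental k' (jΩ t0)) (m1 Bd : ℕ)
    (hBd : ∀ (L2 : IntermediateField k' Θ) (T : L2), Transcendental k' T →
      FiniteDimensional (IntermediateField.adjoin k' {T}) L2 →
      Module.finrank (IntermediateField.adjoin k' {T}) L2 ≤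
        a.natDegree ^ ((A.map jΩ).roots.toFinset ∪ (B.map jΩ).roots.toFinset).card * m1 ^ m1 →
      jΩ t0 ∈ L2 → (∀ α, A.IsRoot α → jΩ α ∈ L2) → (∀ α, B.IsRoot α → jΩ α ∈ L2) →
      ∀ S : Finset Θ, (∀ s ∈ S, s ∈ L2) →
      (∀ s ∈ S, IsPreperiodic (ratP1Map (A.map jΩ) (B.map jΩ)) (some s)) → S.card ≤ Bd)
    [Field L] [Algebra (RatFunc k) L] [Algebra k L] [IsScalarTower k (RatFunc k) L]
    [FiniteDimensional (RatFunc k) L] (hm1 : Module.finrank (RatFunc k) L ≤ m1)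
    (σ : L) (hσ : Transcendental k σ) (ρ : F →+* L)
    (hρ : ∀ x, ρ x = algebraMap k L (algebraMap F k x)) :
    {x : Option L | IsPreperiodic (ratP1Map (a.map (eval₂RingHom ρ σ)) (b.map (eval₂RingHom ρ σ))) x}.Finite ∧
    {x : Option L | IsPreperiodic (ratP1Map (a.map (eval₂RingHom ρ σ)) (b.map (eval₂RingHom ρ σ))) x}.ncard
      ≤ Bd + 1 := by
  letI : Algebra k Θ := ((algebraMap k' Θ).comp (algebraMap k k')).toAlgebra
  haveI : IsScalarTower k k' Θ := IsScalarTower.of_algebraMap_eq fun x => rfl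
  obtain ⟨hT, hTfin⟩ := SUB_ratfunc_fin (k := k) (L := L)
  haveI := hTfin
  have htk : Transcendental k (jΩ t0) := fun h => htt (h.extendScalars (algebraMap k k').injective)
  obtain ⟨J, hJσ⟩ := SUB_embed _ hT σ hσ (jΩ t0) htk
  have hcomp : (J : L →+* Θ).comp (eval₂RingHom ρ σ) = jΩ.comp (eval₂RingHom eF t0) := by
    apply Polynomial.ringHom_ext
    · intro x
      simp only [RingHom.comp_apply, coe_eval₂RingHom, eval₂_C, hρ, hj, RingHom.coe_coe, J.commutes]
      rfl
    · simpa using hJσ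
  have hAJ : (a.map (eval₂RingHom ρ σ)).map (J : L →+* Θ) = A.map jΩ := by
    rw [hA, Polynomial.map_map, Polynomial.map_map, hcomp]
  have hBJ : (b.map (eval₂RingHom ρ σ)).map (J : L →+* Θ) = B.map jΩ := by
    rw [hB, Polynomial.map_map, Polynomial.map_map, hcomp]
  have hAm : A.Monic := by rw [hA]; exact ha.map _
  have hBm : B.Monic := by rw [hB]; exact hb.map _
  obtain ⟨L2, T, hTT, hfd, hfr, hJL, hF0L⟩ := SUB_makeL2 (k := k) (k' := k') (J : L →+* Θ)
    (fun c => ⟨algebraMap k k' c, by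
      rw [← RatFunc.algebraMap_eq_C, ← IsScalarTower.algebraMap_apply]
      exact J.commutes c⟩) m1 hm1
    ((A.map jΩ).roots.toFinset ∪ (B.map jΩ).roots.toFinset) a.natDegree (by
      intro x hx
      rcases Finset.mem_union.mp hx with hx | hx
      · refine ⟨A.map jΩ, hAm.map _, ?_, ?_, isRoot_of_mem_roots (Multiset.mem_toFinset.mp hx)⟩
        · rw [hAm.natDegree_map, hA, ha.natDegree_map]
        · intro E hE i
          rw [← hAJ, coeff_map]
          exact hE _
      · refine ⟨B.map jΩ, hBm.map _, ?_, ?_, isRoot_of_mem_roots (Multiset.mem_toFinset.mp hx)⟩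
        · rw [hBm.natDegree_map, hB, hb.natDegree_map]
          omega
        · intro E hE i
          rw [← hBJ, coeff_map]
          exact hE _)
  have hTtr : Transcendental k' T := by
    intro h
    have h1 : IsAlgebraic k' (T : Θ) := h.algebraMap
    rw [hTT] at h1
    have h2 : IsAlgebraic k (J (algebraMap (RatFunc k) L RatFunc.X)) := h1.restrictScalars k
    exact hT ((isAlgebraic_algHom_iff J J.injective).mp h2)
  apply SUB_set_bound
  intro S hS
  have hcard : (S.eraseNone.image J).card ≤ Bd := by
    refine hBd L2 T hTtr hfd hfr ?_ ?_ ?_ _ ?_ ?_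
    · rw [← hJσ]; exact hJL σ
    · intro α hα
      apply hF0L
      rw [Finset.mem_union, Multiset.mem_toFinset, Multiset.mem_toFinset, mem_roots (hAm.map _).ne_zero,
        SUB_root_j]
      exact Or.inl hα
    · intro α hα
      apply hF0L
      rw [Finset.mem_union, Multiset.mem_toFinset, Multiset.mem_toFinset,
        mem_roots (hBm.map jΩ).ne_zero, SUB_root_j]
      exact Or.inr hα
    · intro s hs
      obtain ⟨x, -, rfl⟩ := Finset.mem_image.mp hs
      exact hJL x
    · intro s hs
      obtain ⟨x, hx, rfl⟩ := Finset.mem_image.mp hs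
      have h1 : IsPreperiodic _ (some x) := hS (Finset.mem_eraseNone.mp hx)
      have := (SUB_prep_map (J : L →+* Θ) _ _ (some x)).mpr h1
      rw [hAJ, hBJ] at this
      exact this
  rw [Finset.card_image_of_injective _ (show Function.Injective (fun x : L => J x) from J.injective)] at hcard
  have h2 : S ⊆ insert none (S.eraseNone.image some) := by
    intro x hx
    cases x with
    | none => exact Finset.mem_insert_self _ _
    | some y =>
      exact Finset.mem_insert_of_mem (Finset.mem_image_of_mem _ (Finset.mem_eraseNone.mpr hx))
  calc S.card ≤ (insert none (S.eraseNone.image some)).card := Finset.card_le_card h2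
    _ ≤ (S.eraseNone.image some).card + 1 := Finset.card_insert_le _ _
    _ ≤ S.eraseNone.card + 1 := by gcongr; exact Finset.card_image_le
    _ ≤ Bd + 1 := by omega
end

section
set_option linter.style.haveILetI false
open Polynomial

/-- If `σ` is algebraic over `k`, all coefficients of the specialised polynomial are algebraic. -/
lemma SUB_coeff_alg {F k L Ξ : Type*} [Field F] [Field k] [Field L] [Field Ξ] [Algebra F k]
    [Algebra k L] [Algebra L Ξ] [Algebra k Ξ] [IsScalarTower k L Ξ] (σ : L) (hσ : IsAlgebraic k σ)
    (ρ : F →+* L) (hρ : ∀ x, ρ x = algebraMap k L (algebraMap F k x)) (a : F[X][X]) (n : ℕ) :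
    IsAlgebraic k (((a.map (eval₂RingHom ρ σ)).map (algebraMap L Ξ)).coeff n) := by
  rw [coeff_map, coeff_map]
  apply IsAlgebraic.algebraMap
  rw [coe_eval₂RingHom, eval₂_eq_sum_range]
  have hmem : ∀ x : L, x ∈ algebraicClosure k L ↔ IsAlgebraic k x :=
    fun x => mem_algebraicClosure_iff
  rw [← hmem]
  refine sum_mem fun i _ => mul_mem ?_ (pow_mem ((hmem _).mpr hσ) i)
  rw [hρ, hmem]
  exact isAlgebraic_algebraMap _

theorem SUB_abs {F Ω : Type} [Field F] [Field Ω] [IsAlgClosed Ω] (eF : F →+* Ω)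
    (p : ℕ) [Fact p.Prime] [CharP Ω p]
    (a b : F[X][X]) (ha : a.Monic) (hb : b.Monic) (hdeg : b.natDegree + 1 < a.natDegree)
    (t0 : Ω) {v : AbsoluteValue Ω ℝ} {A B : Polynomial Ω} {R : ℝ} {r : Ω → ℝ}
    (hA : A = a.map (eval₂RingHom eF t0)) (hB : B = b.map (eval₂RingHom eF t0))
    (H : SUB_Dyn v A B R r) (ht0 : 1 < v t0) (heF : ∀ x, v (eF x) ≤ 1)
    (α0 : Ω) (hα0 : A.IsRoot α0) (hR : v α0 = R)
    (n : ℕ) (hn : n ≠ 0) (G : Subfield Ω) (hGF : ∀ x, eF x ∈ G) (hGt : t0 ∈ G)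
    (hGA : ∀ x, A.IsRoot x → x ∈ G) (hGB : ∀ x, B.IsRoot x → x ∈ G)
    (hGP : ∀ x, IsPreperiodic (ratP1Map A B) (some x) → x ∈ G)
    (hGω : ∀ ω : Ω, ω ^ (p ^ n) = ω → ω ∈ G) (hGres : ∀ x ∈ G, v x ≤ 1 → v (x ^ (p ^ n) - x) < 1)
    (k : Type) [Field k] [Algebra F k]
    (K : Type) [Field K] [Algebra (RatFunc k) K] [FiniteDimensional (RatFunc k) K] (D : ℕ) :
    ∃ B : ℕ, ∀ (L : Type) [Field L] [Algebra K L] [FiniteDimensional K L],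
      Module.finrank K L ≤ D → ∀ σ : L, ∀ ρ : F →+* L,
        ρ = (algebraMap K L).comp ((algebraMap (RatFunc k) K).comp
          (RatFunc.C.comp (algebraMap F k))) → ∀ ι : k →+* AlgebraicClosure L,
        ι = (algebraMap L (AlgebraicClosure L)).comp ((algebraMap K L).comp
          ((algebraMap (RatFunc k) K).comp RatFunc.C)) →
      ¬ IsotrivialMap ι
          (ratP1Map ((a.map (eval₂RingHom ρ σ)).map (algebraMap L (AlgebraicClosure L)))
            ((b.map (eval₂RingHom ρ σ)).map (algebraMap L (AlgebraicClosure L)))) →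
      ({x : Option L | IsPreperiodic (ratP1Map (a.map (eval₂RingHom ρ σ))
          (b.map (eval₂RingHom ρ σ))) x}.Finite ∧
        {x : Option L | IsPreperiodic (ratP1Map (a.map (eval₂RingHom ρ σ))
          (b.map (eval₂RingHom ρ σ))) x}.ncard ≤ B) := by
  classical
  letI algΩ : Algebra F Ω := eF.toAlgebra
  let k' := AlgebraicClosure k
  obtain ⟨Θ, iΘ, iΘ', jΩ, jk, W, hj, hk, hW⟩ := SUB_ambient F Ω k' (SUB_O v H.hna) heF
  letI : Algebra k' Θ := jk.toAlgebra
  have hW' : ∀ x, jΩ x ∈ W ↔ v x ≤ 1 := fun x => (hW x).trans (SUB_O_mem v H.hna x)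
  haveI : CharP Θ p := charP_of_injective_ringHom jΩ.injective p
  have htt : Transcendental k' (jΩ t0) := SUB_transc_of_ne _ (fun x hx => by
    have h1 : jΩ t0 ∈ W := hx ▸ hk x
    rw [hW'] at h1
    linarith)
  have hj' : ∀ x, jΩ (eF x) = algebraMap k' Θ (algebraMap k k' (algebraMap F k x)) := by
    intro x
    rw [← IsScalarTower.algebraMap_apply F k k']
    exact hj x
  let m1 := Module.finrank (RatFunc k) K * D
  obtain ⟨Bd, hBd⟩ := SUB_core eF (algebraMap F k') jΩ hj p a b ha hb hdeg t0 hA hB H ht0 W hk hW'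
    α0 hα0 hR n hn G hGF hGt hGA hGB hGP hGω hGres
    (a.natDegree ^ ((A.map jΩ).roots.toFinset ∪ (B.map jΩ).roots.toFinset).card * m1 ^ m1)
  refine ⟨Bd + 1, ?_⟩
  intro L _ _ _ hL σ ρ hρ ι hι hiso
  letI : Algebra (RatFunc k) L := ((algebraMap K L).comp (algebraMap (RatFunc k) K)).toAlgebra
  haveI : IsScalarTower (RatFunc k) K L := IsScalarTower.of_algebraMap_eq fun x => rfl
  haveI : FiniteDimensional (RatFunc k) L := FiniteDimensional.trans (RatFunc k) K L
  letI : Algebra k L := ((algebraMap (RatFunc k) L).comp RatFunc.C).toAlgebra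
  haveI : IsScalarTower k (RatFunc k) L := IsScalarTower.of_algebraMap_eq fun x => by
    rw [RatFunc.algebraMap_eq_C]; rfl
  have hm1 : Module.finrank (RatFunc k) L ≤ m1 := by
    rw [← Module.finrank_mul_finrank (RatFunc k) K L]
    exact Nat.mul_le_mul_left _ hL
  have hρ' : ∀ x, ρ x = algebraMap k L (algebraMap F k x) := by
    intro x; rw [hρ]; rfl
  have hσ : Transcendental k σ := by
    intro hσ
    apply hiso
    have hι' : ι = algebraMap k (AlgebraicClosure L) := by
      rw [hι, IsScalarTower.algebraMap_eq k L (AlgebraicClosure L)]; rfl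
    rw [hι']
    refine SUB_isotriv _ _ ((hb.map _).map _).ne_zero ?_ ?_
    · exact fun n => SUB_coeff_alg σ hσ ρ hρ' a n
    · exact fun n => SUB_coeff_alg σ hσ ρ hρ' b n
  exact SUB_perL eF jΩ hj' a b ha hb hdeg t0 hA hB htt m1 Bd hBd hm1 σ hσ ρ hρ'
end

lemma SUB_val_cmp {C Ω : Type*} [Field C] [Valued C (WithZero (Multiplicative ℤ))]
    [Field Ω] [Algebra C Ω] (q : ℕ) (hq : 1 < q) (v : AbsoluteValue Ω ℝ)
    (hext : ∀ x : C, x ≠ 0 → ∃ n : ℤ,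
      Valued.v x = ((Multiplicative.ofAdd n : Multiplicative ℤ) : WithZero (Multiplicative ℤ)) ∧
      v (algebraMap C Ω x) = (q : ℝ) ^ n) (x : C) :
    (v (algebraMap C Ω x) ≤ 1 ↔ Valued.v x ≤ (1 : WithZero (Multiplicative ℤ))) ∧
    (v (algebraMap C Ω x) < 1 ↔ Valued.v x < (1 : WithZero (Multiplicative ℤ))) := by
  have hqR : (1 : ℝ) < (q : ℝ) := by exact_mod_cast hq
  by_cases hx : x = 0
  · subst hx; simp
  · obtain ⟨n, h1, h2⟩ := hext x hx
    have h1' : Valued.v x = WithZero.exp n := h1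
    rw [h1', h2, ← WithZero.exp_zero, WithZero.exp_le_exp, WithZero.exp_lt_exp,
      zpow_le_one_iff_right₀ hqR, zpow_lt_one_iff_right₀ hqR]
    exact ⟨Iff.rfl, Iff.rfl⟩

open FunctionField in
open scoped Multiplicative in
/-- Proposition 4.1 of Doyle–Faber.  Let `F = F_q` be a finite field and
`f_t = a/b` with `a, b ∈ F_q[t][z]` monic in `z`, coprime over `F_q(t)`,
`deg_z a > deg_z b + 1`, and `a` separable in `z`.  Let `Ω` be the algebraic closure of the
completion `F_q((1/t))` of `F_q(t)` at `ord_∞` (with `jC` the canonical inclusion of `F_q(t)`,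
characterized by compatibility with the valuation at infinity), equipped with the (unique)
nonarchimedean absolute-value extension `v` of the `∞`-adic absolute value, normalized so that
`‖x‖ = q^(ord_∞-degree)`.  Let `R` be the maximum of `v` over the roots of `a` in `Ω`, and assume
hypotheses (i)–(v).  Then for every field `k ⊇ F_q`, every function field `K/k`, and every
`D ≥ 1` there is a bound `B` such that: for every extension `L/K` with `[L : K] ≤ D` and every
`σ ∈ L` for which `f_σ = a(σ,·)/b(σ,·)` is not isotrivial over `k`, the number of preperiodic
points of `f_σ` in `P¹(L)` is at most `B`. -/
theorem strong_uniform_boundedness_technical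
    (F : Type) [Field F] [Fintype F] [DecidableEq (RatFunc F)]
    (a b : Polynomial (Polynomial F))
    (ha_monic : a.Monic) (hb_monic : b.Monic)
    (hcop : IsCoprime (a.map (algebraMap (Polynomial F) (RatFunc F)))
      (b.map (algebraMap (Polynomial F) (RatFunc F))))
    (hdeg : b.natDegree + 1 < a.natDegree)
    (hsep : (a.map (algebraMap (Polynomial F) (RatFunc F))).Separable)
    -- the canonical inclusion of `F_q(t)` into its completion at infinity
    (jC : RatFunc F →+* RatFunc.CompletionAtInfty F)
    (hjC : ∀ f : RatFunc F, Valued.v (jC f) = inftyValuationDef F f)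
    -- the unique extension of the `∞`-adic absolute value to `Ω = AlgebraicClosure (FqtInfty F)`
    (v : AbsoluteValue (AlgebraicClosure (RatFunc.CompletionAtInfty F)) ℝ)
    (hna : IsNonarchimedean v)
    (hext : ∀ x : RatFunc.CompletionAtInfty F, x ≠ 0 → ∃ n : ℤ,
      Valued.v x = ((Multiplicative.ofAdd n : Multiplicative ℤ) : WithZero (Multiplicative ℤ)) ∧
      v (algebraMap (RatFunc.CompletionAtInfty F) (AlgebraicClosure (RatFunc.CompletionAtInfty F)) x) = (Fintype.card F : ℝ) ^ n)
    -- `R` : the maximum absolute value of a root of `a` in `Ω`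
    (R : ℝ)
    (hRmax : ∀ x, (a.map (coeffEmbed F jC)).IsRoot x → v x ≤ R)
    (hRmem : ∃ x, (a.map (coeffEmbed F jC)).IsRoot x ∧ v x = R)
    -- (i)
    (h1 : 1 < R)
    -- (ii) : the roots of `b` lie in the disk `D(0,R)`
    (h2 : ∀ x, (b.map (coeffEmbed F jC)).IsRoot x → v x ≤ R)
    -- (iii) : `a(z) - z·b(z)` has a root of absolute value exactly `R`
    (h3 : ∃ x, ((a - X * b).map (coeffEmbed F jC)).IsRoot x ∧ v x = R)
    -- (iv) : for each root `α` of `a` there is `r α > 0` such that `D(α, r α)` contains no pole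
    -- of `f = a/b` and `f` maps `D(α, r α)` onto `D(0, R)`
    (r : AlgebraicClosure (RatFunc.CompletionAtInfty F) → ℝ)
    (h4 : ∀ x, (a.map (coeffEmbed F jC)).IsRoot x →
      0 < r x ∧
      (∀ y, v (y - x) ≤ r x → (b.map (coeffEmbed F jC)).eval y ≠ 0) ∧
      ((fun y => (a.map (coeffEmbed F jC)).eval y / (b.map (coeffEmbed F jC)).eval y) ''
        {y | v (y - x) ≤ r x} = {w | v w ≤ R}))
    -- (v) : the disks `D(α, r α)` are pairwise disjoint
    (h5 : ∀ x x', (a.map (coeffEmbed F jC)).IsRoot x → (a.map (coeffEmbed F jC)).IsRoot x' →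
      x ≠ x' → ∀ y, ¬ (v (y - x) ≤ r x ∧ v (y - x') ≤ r x'))
    (k : Type) [Field k] [Algebra F k]
    (K : Type) [Field K] [Algebra (RatFunc k) K] [FiniteDimensional (RatFunc k) K]
    (D : ℕ) (hD : 1 ≤ D) :
    ∃ B : ℕ, ∀ (L : Type) [Field L] [Algebra K L] [FiniteDimensional K L],
      Module.finrank K L ≤ D → ∀ σ : L,
      let ρ : F →+* L :=
        (algebraMap K L).comp ((algebraMap (RatFunc k) K).comp
          (RatFunc.C.comp (algebraMap F k)));
      let ι : k →+* AlgebraicClosure L :=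
        (algebraMap L (AlgebraicClosure L)).comp ((algebraMap K L).comp
          ((algebraMap (RatFunc k) K).comp RatFunc.C));
      let aσ : Polynomial L := a.map (Polynomial.eval₂RingHom ρ σ);
      let bσ : Polynomial L := b.map (Polynomial.eval₂RingHom ρ σ);
      ¬ IsotrivialMap ι
          (ratP1Map (aσ.map (algebraMap L (AlgebraicClosure L)))
            (bσ.map (algebraMap L (AlgebraicClosure L)))) →
      ({x : Option L | IsPreperiodic (ratP1Map aσ bσ) x}.Finite ∧
        {x : Option L | IsPreperiodic (ratP1Map aσ bσ) x}.ncard ≤ B) := by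
  classical
  obtain ⟨α0, hα0, hα0R⟩ := hRmem
  have hq : 1 < Fintype.card F := Fintype.one_lt_card
  have hqR : (1 : ℝ) < (Fintype.card F : ℝ) := by exact_mod_cast hq
  have hext' := SUB_val_cmp (Fintype.card F) hq v hext
  let eF : F →+* AlgebraicClosure (RatFunc.CompletionAtInfty F) := (coeffEmbed F jC).comp Polynomial.C
  let t0 : AlgebraicClosure (RatFunc.CompletionAtInfty F) := coeffEmbed F jC Polynomial.X
  have hemb : coeffEmbed F jC = eval₂RingHom eF t0 := by
    apply Polynomial.ringHom_ext
    · intro x; simp [eF]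
    · simp [t0]
  have hjC' : ∀ f : RatFunc F, Valued.v (jC f) = RatFunc.inftyValuation F f := hjC
  have ht0C : t0 = algebraMap (RatFunc.CompletionAtInfty F) (AlgebraicClosure (RatFunc.CompletionAtInfty F)) (jC RatFunc.X) := by
    simp [t0, coeffEmbed]
  have ht0 : 1 < v t0 := by
    rw [ht0C, ← not_le, (hext' _).1, hjC', RatFunc.inftyValuation.X, not_le, ← WithZero.exp_zero, WithZero.exp_lt_exp]
    exact one_pos
  have heFC : ∀ x, eF x = algebraMap (RatFunc.CompletionAtInfty F) (AlgebraicClosure (RatFunc.CompletionAtInfty F)) (jC (RatFunc.C x)) := by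
    intro x
    simp [eF, coeffEmbed]
  have heF : ∀ x, v (eF x) ≤ 1 := by
    intro x
    rw [heFC, (hext' _).1, hjC']
    by_cases hx : x = 0
    · rw [hx, _root_.map_zero, _root_.map_zero]; exact zero_le_one
    · rw [RatFunc.inftyValuation.C F hx]
  obtain ⟨p, hp⟩ := CharP.exists F
  haveI := hp
  haveI : Fact p.Prime := ⟨CharP.char_is_prime F p⟩
  haveI : CharP (AlgebraicClosure (RatFunc.CompletionAtInfty F)) p := charP_of_injective_ringHom eF.injective p
  let g : RatFunc F →+* AlgebraicClosure (RatFunc.CompletionAtInfty F) := (algebraMap (RatFunc.CompletionAtInfty F) (AlgebraicClosure (RatFunc.CompletionAtInfty F))).comp jC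
  have hmap : ∀ f : Polynomial (Polynomial F), f.map (coeffEmbed F jC) =
      (f.map (algebraMap (Polynomial F) (RatFunc F))).map g := by
    intro f; rw [Polynomial.map_map]; rfl
  have hmap2 : ∀ f : Polynomial (Polynomial F), f.map (coeffEmbed F jC) =
      (f.map (jC.comp (algebraMap (Polynomial F) (RatFunc F)))).map (algebraMap (RatFunc.CompletionAtInfty F) (AlgebraicClosure (RatFunc.CompletionAtInfty F))) := by
    intro f; rw [Polynomial.map_map]; rfl
  have H : SUB_Dyn v (a.map (coeffEmbed F jC)) (b.map (coeffEmbed F jC)) R r :=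
    { hna := hna
      hA := ha_monic.map _
      hB := hb_monic.map _
      cop := by
        rw [hmap, hmap]
        exact hcop.map (Polynomial.mapRingHom g)
      deg := by rw [ha_monic.natDegree_map, hb_monic.natDegree_map]; exact hdeg
      sep := by rw [hmap]; exact hsep.map
      hRmax := hRmax
      h1 := h1
      h2 := h2
      h4 := h4
      h5 := h5 }
  haveI : CompleteSpace (RatFunc.CompletionAtInfty F) := SUB_complete F
  have haut : ∀ (τ : AlgebraicClosure (RatFunc.CompletionAtInfty F) ≃ₐ[RatFunc.CompletionAtInfty F]
      AlgebraicClosure (RatFunc.CompletionAtInfty F)) (x : AlgebraicClosure (RatFunc.CompletionAtInfty F)), v (τ x) = v x :=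
    SUB_aut v hna (Fintype.card F) hq hext ⟨jC RatFunc.X, by rw [ht0C] at ht0; exact ht0⟩
  have hres : ∀ c : RatFunc.CompletionAtInfty F, v (algebraMap (RatFunc.CompletionAtInfty F) (AlgebraicClosure (RatFunc.CompletionAtInfty F)) c) ≤ 1 →
      v (algebraMap (RatFunc.CompletionAtInfty F) (AlgebraicClosure (RatFunc.CompletionAtInfty F)) c ^ (Fintype.card F) - algebraMap (RatFunc.CompletionAtInfty F) (AlgebraicClosure (RatFunc.CompletionAtInfty F)) c) < 1 := by
    intro c hc
    rw [← map_pow, ← map_sub]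
    exact (hext' _).2.mpr (SUB_C_res F c ((hext' _).1.mp hc))
  obtain ⟨n, hn, G, hG0, hGA, hGB, hGP, hGω, hGres⟩ := SUB_local p H _ _ (hmap2 a) (hmap2 b) haut
    (Fintype.card F) hq hres α0 hα0 hα0R
  obtain ⟨Bd, hBd⟩ := SUB_abs eF p a b ha_monic hb_monic hdeg t0 (by rw [hemb]) (by rw [hemb]) H ht0
    heF α0 hα0 hα0R n hn G (fun x => by rw [heFC]; exact hG0 _) (by rw [ht0C]; exact hG0 _)
    hGA hGB hGP hGω hGres k K D
  refine ⟨Bd, ?_⟩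
  intro L _ _ _ hL σ ρ ι aσ bσ hiso
  exact hBd L hL σ ρ rfl ι rfl hiso
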